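/- Fix b with 0 < b ≤ 1 and define K_b(z) := (1/(2π)) ∫_{−1}^{1} (j_F(α)/cosh(bα)) e^{izα} dα with j_F(α) := max{1 − |α|, 0}. Then, as T → ∞, Σ_{ρ,ρ' : T<γ,γ'≤2T} K_b(−i(ρ−ρ') log T) · W(ρ−ρ') = (1/(2π)) ( 1 + 2 ∫_{0}^{1} α(1−α)/cosh(bα) dα + O(1/√(log T)) ) · (T/(2π)) log T, where W(u) = 4/(4 − u²) and the sums run over pairs of nontrivial zeros ρ = β+iγ, ρ' = β'+iγ' of the Riemann zeta function counted with multiplicity. (This is unconditional.) -/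

import Mathlib

open Filter Topology MeasureTheory Set

/-- The multiplicity of `ρ` as a zero of the Riemann zeta function:
the least `n` such that the `n`-th iterated derivative of `ζ` is nonzero at `ρ`. -/
noncomputable def zetaMult (ρ : ℂ) : ℕ :=
  sInf {n : ℕ | iteratedDeriv n riemannZeta ρ ≠ 0}

/-- `ρ` is a nontrivial zero of the Riemann zeta function. -/
def IsNontrivialZero (ρ : ℂ) : Prop :=
  riemannZeta ρ = 0 ∧ 0 < ρ.re ∧ ρ.re < 1

/-- The set of nontrivial zeros `ρ = β + iγ` with `T < γ ≤ 2T`. -/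
def zeroBand (T : ℝ) : Set ℂ :=
  {ρ | IsNontrivialZero ρ ∧ T < ρ.im ∧ ρ.im ≤ 2 * T}

/-- Number of nontrivial zeros with `T < γ ≤ 2T`, counted with multiplicity. -/
noncomputable def Ntot (T : ℝ) : ℝ :=
  ∑ᶠ ρ ∈ zeroBand T, (zetaMult ρ : ℝ)

/-- Number of simple nontrivial zeros with `T < γ ≤ 2T`. -/
noncomputable def Nsimple (T : ℝ) : ℝ :=
  ∑ᶠ ρ ∈ {ρ ∈ zeroBand T | zetaMult ρ = 1}, (1 : ℝ)

/-- Number of nontrivial zeros with `T < γ ≤ 2T` on the critical line, with multiplicity. -/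
noncomputable def Nline (T : ℝ) : ℝ :=
  ∑ᶠ ρ ∈ {ρ ∈ zeroBand T | ρ.re = 1/2}, (zetaMult ρ : ℝ)

/-- Number of simple critical-line nontrivial zeros with `T < γ ≤ 2T`. -/
noncomputable def NlineSimple (T : ℝ) : ℝ :=
  ∑ᶠ ρ ∈ {ρ ∈ zeroBand T | ρ.re = 1/2 ∧ zetaMult ρ = 1}, (1 : ℝ)

/-- The weight `W(u) = 4/(4 - u²)`. -/
noncomputable def Wweight (u : ℂ) : ℂ := 4 / (4 - u ^ 2)

/-- The Fejér kernel `j_F(α) = max{1 - |α|, 0}`. -/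
noncomputable def jF (α : ℝ) : ℝ := max (1 - |α|) 0

/-- The Tsang kernel `K_b(z) = (1/(2π)) ∫_{-1}^{1} (j_F(α)/cosh(bα)) e^{izα} dα`. -/
noncomputable def Kb (b : ℝ) (z : ℂ) : ℂ :=
  (1 / (2 * Real.pi)) * ∫ α in (-1 : ℝ)..1,
    ((jF α / Real.cosh (b * α) : ℝ) : ℂ) * Complex.exp (Complex.I * z * α)

lemma hd_order_ne_top {f : ℂ → ℂ} (hf : Differentiable ℂ f) (h0 : f 0 ≠ 0) (z : ℂ) :
    analyticOrderAt f z ≠ ⊤ := by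
  intro h
  rw [analyticOrderAt_eq_top] at h
  have ha : AnalyticOnNhd ℂ f univ := fun w _ => hf.analyticAt w
  have := ha.eqOn_zero_of_preconnected_of_eventuallyEq_zero isPreconnected_univ (mem_univ z) h
  exact h0 (this (mem_univ 0))

lemma hd_factor {f : ℂ → ℂ} (hf : Differentiable ℂ f) (h0 : f 0 ≠ 0) (Z : Finset ℂ) :
    ∃ g : ℂ → ℂ, Differentiable ℂ g ∧
      (∀ z, f z = (∏ ρ ∈ Z, (z - ρ) ^ (analyticOrderNatAt f ρ)) * g z) ∧ ∀ ρ ∈ Z, g ρ ≠ 0 := by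
  classical
  induction Z using Finset.induction_on with
  | empty => exact ⟨f, hf, by simp, by simp⟩
  | insert ρ Z hρ ih =>
    obtain ⟨g, hg, hfg, hgn⟩ := ih
    set p : ℂ → ℂ := fun z => ∏ ρ ∈ Z, (z - ρ) ^ (analyticOrderNatAt f ρ) with hp
    have hpd : Differentiable ℂ p := by rw [hp]; fun_prop
    have hpρ : p ρ ≠ 0 := by
      rw [hp]; simp only
      refine Finset.prod_ne_zero_iff.2 fun r hr => pow_ne_zero _ (sub_ne_zero.2 ?_)
      rintro rfl; exact hρ hr
    have hfe : f = p * g := funext hfg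
    have hord : analyticOrderAt f ρ = analyticOrderAt g ρ := by
      conv_lhs => rw [hfe]
      rw [analyticOrderAt_mul (hpd.analyticAt ρ) (hg.analyticAt ρ),
        (hpd.analyticAt ρ).analyticOrderAt_eq_zero.2 hpρ, zero_add]
    have hgt : analyticOrderAt g ρ ≠ ⊤ := hord ▸ hd_order_ne_top hf h0 ρ
    obtain ⟨k, hk, hkρ, hgk⟩ := ((hg.analyticAt ρ).analyticOrderAt_ne_top).1 hgt
    have hnat : analyticOrderNatAt g ρ = analyticOrderNatAt f ρ := by
      simp [analyticOrderNatAt, hord]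
    rw [hnat] at hgk
    set n := analyticOrderNatAt f ρ
    set h : ℂ → ℂ := fun z => if z = ρ then k ρ else g z / (z - ρ) ^ n with hh
    have hgh : ∀ z, g z = (z - ρ) ^ n * h z := by
      intro z
      by_cases hz : z = ρ
      · subst hz
        simpa [hh] using hgk.self_of_nhds
      · have : (z - ρ) ^ n ≠ 0 := pow_ne_zero _ (sub_ne_zero.2 hz)
        simp only [hh, hz, if_false]; field_simp
    refine ⟨h, ?_, ?_, ?_⟩
    · intro z
      by_cases hz : z = ρ
      · subst hz
        have : h =ᶠ[𝓝 z] k := by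
          filter_upwards [hgk] with w hw
          by_cases hwz : w = z
          · simp [hh, hwz]
          · have : (w - z) ^ n ≠ 0 := pow_ne_zero _ (sub_ne_zero.2 hwz)
            simp only [hh, hwz, if_false, hw, smul_eq_mul]; field_simp
        exact this.differentiableAt_iff.2 hk.differentiableAt
      · have : h =ᶠ[𝓝 z] fun w => g w / (w - ρ) ^ n := by
          filter_upwards [isOpen_ne.mem_nhds hz] with w hw
          simp only [hh, if_neg hw]
        refine this.differentiableAt_iff.2 ?_
        exact (hg z).div (by fun_prop) (pow_ne_zero _ (sub_ne_zero.2 hz))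
    · intro z
      rw [Finset.prod_insert hρ, hfg z, hgh z]; ring
    · intro r hr
      rcases Finset.mem_insert.1 hr with rfl | hr
      · simpa [hh] using hkρ
      · intro h'
        exact hgn r hr (by rw [hgh r, h', mul_zero])

lemma hd_logDeriv {f g : ℂ → ℂ} {Z : Finset ℂ} {n : ℂ → ℕ} (hg : Differentiable ℂ g)
    (hfg : ∀ z, f z = (∏ ρ ∈ Z, (z - ρ) ^ (n ρ)) * g z) {z : ℂ} (hz : f z ≠ 0) :
    logDeriv f z = ∑ ρ ∈ Z, (n ρ : ℂ) * (1 / (z - ρ)) + logDeriv g z := by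
  have hfe : f = (fun z => (∏ ρ ∈ Z, (z - ρ) ^ (n ρ)) * g z) := funext hfg
  have h1 := hz
  rw [hfg z] at h1
  have hp := left_ne_zero_of_mul h1
  rw [hfe, logDeriv_mul z hp (right_ne_zero_of_mul h1) (by fun_prop) (hg z)]
  congr 1
  have hpp : ∀ ρ ∈ Z, (z - ρ) ^ (n ρ) ≠ 0 := fun ρ hρ => (Finset.prod_ne_zero_iff.1 hp) ρ hρ
  rw [logDeriv_prod (s := Z) (f := fun ρ z => (z - ρ) ^ (n ρ)) hpp (fun i _ => by fun_prop)]
  refine Finset.sum_congr rfl fun ρ hρ => ?_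
  rw [logDeriv_fun_pow (by fun_prop)]
  simp [logDeriv_apply]

/-- Landau's local estimate. -/
lemma hd_landau {f : ℂ → ℂ} (hf : Differentiable ℂ f) (h0 : f 0 ≠ 0) {R M : ℝ} (hR : 0 < R)
    (hM : 0 < M) (hb : ∀ z, ‖z‖ ≤ R → ‖f z‖ ≤ Real.exp M * ‖f 0‖) {Z : Finset ℂ}
    (hZ : ∀ z, ‖z‖ ≤ R / 2 → f z = 0 → z ∈ Z) (hZ' : ∀ ρ ∈ Z, ‖ρ‖ ≤ R / 2)
    {s s' : ℂ} (hs : ‖s‖ < R / 16) (hs' : ‖s'‖ < R / 16) (hfs : f s ≠ 0) (hfs' : f s' ≠ 0) :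
    ‖logDeriv f s - logDeriv f s' -
      ∑ ρ ∈ Z, (analyticOrderNatAt f ρ : ℂ) * (1 / (s - ρ) - 1 / (s' - ρ))‖
      ≤ 256 * M / R ^ 2 * ‖s - s'‖ := by
  obtain ⟨g, hg, hfg, hgn⟩ := hd_factor hf h0 Z
  set n := analyticOrderNatAt f
  have hg0 : g 0 ≠ 0 := fun h => h0 (by rw [hfg, h, mul_zero])
  have hgne : ∀ z ∈ Metric.ball (0 : ℂ) (R / 2), g z ≠ 0 := by
    intro z hz h
    have hz' : ‖z‖ < R / 2 := by simpa using hz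
    have : f z = 0 := by rw [hfg, h, mul_zero]
    exact hgn z (hZ z hz'.le this) h
  -- bound for g
  have hgb : ∀ z ∈ Metric.closedBall (0 : ℂ) R, ‖g z‖ ≤ Real.exp M * ‖g 0‖ := by
    intro z hz
    refine Complex.norm_le_of_forall_mem_frontier_norm_le Metric.isBounded_ball
      hg.diffContOnCl (fun w hw => ?_) (by rwa [closure_ball _ hR.ne'])
    rw [frontier_ball _ hR.ne'] at hw
    have hw : ‖w‖ = R := by simpa using hw
    have h1 := hb w hw.le
    rw [hfg w, hfg 0, norm_mul, norm_mul, norm_prod, norm_prod] at h1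
    have h2 : (∏ ρ ∈ Z, ‖(0 - ρ) ^ n ρ‖) ≤ ∏ ρ ∈ Z, ‖(w - ρ) ^ n ρ‖ := by
      refine Finset.prod_le_prod (fun _ _ => norm_nonneg _) fun ρ hρ => ?_
      rw [norm_pow, norm_pow]
      refine pow_le_pow_left₀ (norm_nonneg _) ?_ _
      have := norm_sub_norm_le w ρ
      have := hZ' ρ hρ
      rw [zero_sub, norm_neg]; linarith
    have h3 : 0 < ∏ ρ ∈ Z, ‖(0 - ρ) ^ n ρ‖ := by
      have := h0
      rw [hfg 0] at this
      rw [← norm_prod]; exact norm_pos_iff.2 (left_ne_zero_of_mul this)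
    have h4 := mul_le_mul_of_nonneg_right h2 (norm_nonneg (g w))
    have h5 : (∏ ρ ∈ Z, ‖(0 - ρ) ^ n ρ‖) * ‖g w‖ ≤
      (∏ ρ ∈ Z, ‖(0 - ρ) ^ n ρ‖) * (Real.exp M * ‖g 0‖) := by linarith
    exact le_of_mul_le_mul_left h5 h3
  have hld : DifferentiableOn ℂ (logDeriv g) (Metric.ball 0 (R / 2)) := by
    intro z hz
    have h1 : DifferentiableAt ℂ (deriv g) z := (hg.analyticAt z).deriv.differentiableAt
    exact (h1.div (hg z) (hgne z hz)).differentiableWithinAt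
  obtain ⟨H₀, hH₀⟩ := hld.isExactOn_ball
  set H : ℂ → ℂ := fun z => H₀ z - H₀ 0 with hHdef
  have hH : ∀ z ∈ Metric.ball (0 : ℂ) (R / 2), HasDerivAt H (logDeriv g z) z :=
    fun z hz => (hH₀ z hz).sub_const _
  have hH0 : H 0 = 0 := by simp [hHdef]
  have h0mem : (0 : ℂ) ∈ Metric.ball (0 : ℂ) (R / 2) := by simpa using by linarith
  have hexp : ∀ z ∈ Metric.ball (0 : ℂ) (R / 2), g z = g 0 * Complex.exp (H z) := by
    intro z hz
    have hd : ∀ w ∈ Metric.ball (0 : ℂ) (R / 2),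
        HasDerivWithinAt (fun w => g w * Complex.exp (-H w)) 0 (Metric.ball (0 : ℂ) (R / 2)) w := by
      intro w hw
      have h1 := ((hg w).hasDerivAt.mul (hH w hw).neg.cexp)
      refine (h1.congr_deriv ?_).hasDerivWithinAt
      rw [logDeriv_apply]
      have := hgne w hw
      simp only [Pi.neg_apply]
      field_simp
      ring
    have := (convex_ball (0 : ℂ) (R / 2)).is_const_of_fderivWithin_eq_zero (𝕜 := ℂ)
      (f := fun w => g w * Complex.exp (-H w)) (fun w hw => (hd w hw).differentiableWithinAt)
      (fun w hw => by
        have h1 := (hd w hw).hasFDerivWithinAt.fderivWithin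
          (Metric.isOpen_ball.uniqueDiffWithinAt hw)
        rw [h1]; ext; simp) hz h0mem
    simp only [hH0, neg_zero, Complex.exp_zero, mul_one] at this
    rw [← this, mul_assoc, ← Complex.exp_add]; simp
  have hRe : MapsTo H (Metric.ball 0 (R / 2)) {z | z.re ≤ M} := by
    intro z hz
    have h1 := hgb z (by
      have : ‖z‖ < R / 2 := by simpa using hz
      simpa using by linarith)
    rw [hexp z hz, norm_mul, Complex.norm_exp, mul_comm] at h1
    have := le_of_mul_le_mul_right h1 (norm_pos_iff.2 hg0)
    exact Real.exp_le_exp.1 this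
  have hHd : DifferentiableOn ℂ H (Metric.ball 0 (R / 2)) :=
    fun z hz => (hH z hz).differentiableAt.differentiableWithinAt
  have hH1 : ∀ z, ‖z‖ ≤ R / 4 → ‖H z‖ ≤ 2 * M := by
    intro z hz
    have h1 := Complex.borelCaratheodory_zero hM hHd hRe (by linarith) (z := z)
      (by simpa using by linarith) hH0
    refine h1.trans ?_
    rw [div_le_iff₀ (by linarith)]
    nlinarith
  have hH2 : ∀ z, ‖z‖ < R / 8 → ‖logDeriv g z‖ ≤ 16 * M / R := by
    intro z hz
    have h1 := Complex.norm_deriv_le_of_forall_mem_sphere_norm_le (c := z) (R := R / 8)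
      (C := 2 * M) (F := ℂ) (f := H) (by linarith) ?_ ?_
    · rw [(hH z (by simpa using by linarith)).deriv] at h1
      refine h1.trans (le_of_eq ?_); field_simp; ring
    · refine DifferentiableOn.diffContOnCl ?_
      rw [closure_ball _ (by positivity)]
      refine hHd.mono fun w hw => ?_
      have : ‖w - z‖ ≤ R / 8 := by simpa [dist_eq_norm] using hw
      have := norm_le_norm_add_norm_sub z w
      rw [norm_sub_rev] at this
      simpa using by linarith
    · intro w hw
      have : ‖w - z‖ = R / 8 := by simpa [dist_eq_norm] using hw
      have := norm_le_norm_add_norm_sub z w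
      rw [norm_sub_rev] at this
      exact hH1 w (by linarith)
  have hH3 : ∀ z, ‖z‖ < R / 16 → ‖deriv (logDeriv g) z‖ ≤ 256 * M / R ^ 2 := by
    intro z hz
    have h1 := Complex.norm_deriv_le_of_forall_mem_sphere_norm_le (c := z) (R := R / 16)
      (C := 16 * M / R) (F := ℂ) (f := logDeriv g) (by linarith) ?_ ?_
    · refine h1.trans (le_of_eq ?_); field_simp; ring
    · refine DifferentiableOn.diffContOnCl ?_
      rw [closure_ball _ (by positivity)]
      refine hld.mono fun w hw => ?_
      have : ‖w - z‖ ≤ R / 16 := by simpa [dist_eq_norm] using hw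
      have := norm_le_norm_add_norm_sub z w
      rw [norm_sub_rev] at this
      simpa using by linarith
    · intro w hw
      have : ‖w - z‖ = R / 16 := by simpa [dist_eq_norm] using hw
      have := norm_le_norm_add_norm_sub z w
      rw [norm_sub_rev] at this
      exact hH2 w (by linarith)
  have hfin := (convex_ball (0 : ℂ) (R / 16)).norm_image_sub_le_of_norm_deriv_le (𝕜 := ℂ)
    (f := logDeriv g) (C := 256 * M / R ^ 2) (x := s') (y := s)
    (fun w hw => by
      have hw : ‖w‖ < R / 16 := by simpa using hw
      exact hld.differentiableAt (Metric.isOpen_ball.mem_nhds (by simpa using by linarith)))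
    (fun w hw => hH3 w (by simpa using hw)) (by simpa using hs') (by simpa using hs)
  rw [hd_logDeriv hg hfg hfs, hd_logDeriv hg hfg hfs']
  refine le_trans (le_of_eq ?_) hfin
  congr 1
  simp only [mul_sub, Finset.sum_sub_distrib]
  ring

/-- growth of the entire completed zeta function -/
lemma xi_growth_aux : ∃ A B p : ℝ, 0 < A ∧ 0 < B ∧ 0 < p ∧ ∀ s : ℂ, 1/2 ≤ s.re →
    ‖completedRiemannZeta₀ s‖ ≤ A + B * (s.re / p) ^ (s.re / 2) := by
  obtain ⟨p, hp, hO⟩ := HurwitzZeta.isBigO_atTop_evenKernel_sub 0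
  simp only [if_true] at hO
  set P := HurwitzZeta.hurwitzEvenFEPair 0 with hP
  have hconv : ∀ s : ℂ, MellinConvergent P.f_modif s := fun s =>
    (P.isStrongFEPair_toStrongFEPair.hasMellin s).1
  set h : ℝ → ℝ := fun x => Real.exp (p/2 * x) * ‖HurwitzZeta.evenKernel 0 x - 1‖ with hh
  have hcont : ContinuousOn h (Ici 1) := by
    have := (HurwitzZeta.continuousOn_evenKernel 0).mono (show Ici (1:ℝ) ⊆ Ioi 0 from fun x hx => mem_Ioi.2 (lt_of_lt_of_le one_pos (mem_Ici.1 hx)))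
    exact (Continuous.continuousOn (by fun_prop)).mul ((this.sub continuousOn_const).norm)
  have hint : IntegrableOn h (Ioi 1) := by
    refine integrable_of_isBigO_exp_neg (b := p/2) (by positivity) hcont ?_
    have := (Asymptotics.isBigO_refl (fun x : ℝ => Real.exp (p/2*x)) atTop).mul hO.norm_left
    refine this.congr_right fun x => ?_
    rw [← Real.exp_add]; congr 1; ring
  have hfm : ∀ x : ℝ, 1 < x → ‖P.f_modif x‖ = ‖HurwitzZeta.evenKernel 0 x - 1‖ := by
    intro x hx
    have h1 : P.f_modif x = P.f x - P.f₀ := by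
      simp [WeakFEPair.f_modif, mem_Ioi.mpr hx, notMem_Ioo_of_ge hx.le]
    rw [h1]
    have : P.f x - P.f₀ = ((HurwitzZeta.evenKernel 0 x - 1 : ℝ) : ℂ) := by
      simp [hP, HurwitzZeta.hurwitzEvenFEPair]
    rw [this, Complex.norm_real]
  have hI1 := (hconv (1/4 : ℝ)).norm
  set A := ∫ x in Ioi (0:ℝ), ‖(x:ℂ) ^ (((1/4:ℝ):ℂ) - 1) • P.f_modif x‖ with hA
  set B := ∫ x in Ioi (1:ℝ), h x with hB
  have hA0 : 0 ≤ A := integral_nonneg fun x => norm_nonneg _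
  have hB0 : 0 ≤ B := integral_nonneg fun x => by positivity
  refine ⟨A + 1, B + 1, p, by linarith, by linarith, hp, fun s hs => ?_⟩
  set κ := s.re / 2 with hκ
  have hκ4 : 1/4 ≤ κ := by rw [hκ]; linarith
  have key : ‖mellin P.f_modif (s/2)‖ ≤ A + (2*κ/p)^κ * B := by
    unfold mellin
    refine (norm_integral_le_integral_norm _).trans ?_
    have hq : ∫ x in Ioi (1:ℝ), (2*κ/p)^κ * h x = ∫ x in Ioi (0:ℝ), (Ioi (1:ℝ)).indicator (fun x => (2*κ/p)^κ * h x) x := by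
      rw [setIntegral_indicator measurableSet_Ioi]
      congr 2
      ext x; simp only [mem_inter_iff, mem_Ioi]
      constructor
      · intro h; exact ⟨by linarith, h⟩
      · exact fun h => h.2
    rw [hA, hB, ← integral_const_mul, hq, ← integral_add]
    · refine setIntegral_mono_on (hconv (s/2)).norm ?_ measurableSet_Ioi ?_
      · refine hI1.add ?_
        rw [integrable_indicator_iff measurableSet_Ioi]
        refine ((hint.const_mul _).mono_measure ?_)
        exact Measure.restrict_mono_measure Measure.restrict_le_self _
      · intro x hx
        have hx : 0 < x := hx
        rw [norm_smul, norm_smul, Complex.norm_cpow_eq_rpow_re_of_pos hx,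
          Complex.norm_cpow_eq_rpow_re_of_pos hx]
        have e1 : (s/2 - 1).re = κ - 1 := by simp [hκ]
        have e2 : (((1/4:ℝ):ℂ) - 1).re = 1/4 - 1 := by simp
        rw [e1, e2]
        rcases le_or_gt x 1 with h1 | h1
        · rw [indicator_of_notMem (by simpa using h1), add_zero]
          gcongr ?_ * _
          exact Real.rpow_le_rpow_of_exponent_ge hx h1 (by linarith)
        · rw [indicator_of_mem (by simpa using h1)]
          have : x ^ (κ - 1) * ‖P.f_modif x‖ ≤ (2*κ/p)^κ * h x := by
            rw [hh, hfm x h1, ← mul_assoc]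
            gcongr ?_ * _
            have h3 : x ^ (κ - 1) ≤ x ^ κ :=
              Real.rpow_le_rpow_of_exponent_le h1.le (by linarith)
            refine h3.trans ?_
            have hκ0 : 0 < κ := by linarith
            have h4 : x = (2*κ/p) * (p*x/(2*κ)) := by field_simp
            have h5 : x ^ κ = (2*κ/p)^κ * (p*x/(2*κ))^κ := by
              rw [← Real.mul_rpow (by positivity) (by positivity), ← h4]
            rw [h5]
            gcongr
            rw [Real.rpow_def_of_pos (by positivity)]
            apply Real.exp_le_exp.2
            have := Real.log_le_sub_one_of_pos (show 0 < p*x/(2*κ) by positivity)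
            calc Real.log (p*x/(2*κ)) * κ ≤ (p*x/(2*κ)) * κ := by gcongr; linarith
              _ = p/2*x := by field_simp
          have h6 : 0 ≤ x ^ ((1:ℝ)/4 - 1) * ‖P.f_modif x‖ := by positivity
          linarith
    · exact hI1
    · rw [integrable_indicator_iff measurableSet_Ioi]
      refine ((hint.const_mul _).mono_measure ?_)
      exact Measure.restrict_mono_measure Measure.restrict_le_self _
  have e : completedRiemannZeta₀ s = mellin P.f_modif (s/2) / 2 := rfl
  rw [e, norm_div]
  have e3 : s.re / p = 2*κ/p := by rw [hκ]; ring
  rw [e3]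
  have hpos : 0 ≤ (2*κ/p)^κ := by positivity
  have : ‖(2:ℂ)‖ = 2 := by simp
  rw [this]
  have := mul_nonneg hpos hB0
  nlinarith [norm_nonneg (mellin P.f_modif (s/2))]

/-- Entire completed zeta `s(1-s)Λ(s)`. -/
noncomputable def xiF (s : ℂ) : ℂ := s * (1 - s) * completedRiemannZeta₀ s - 1

lemma xiF_diff : Differentiable ℂ xiF := by
  unfold xiF
  have := differentiable_completedZeta₀
  fun_prop

lemma xiF_zero : xiF 0 = -1 := by simp [xiF]
lemma xiF_one : xiF 1 = -1 := by simp [xiF]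

lemma xiF_one_sub (s : ℂ) : xiF (1 - s) = xiF s := by
  simp only [xiF, completedRiemannZeta₀_one_sub]; ring

lemma xiF_growth : ∃ C : ℝ, 0 < C ∧ ∀ s : ℂ, ‖xiF s‖ ≤ Real.exp (C * (1 + ‖s‖) ^ (3/2 : ℝ)) := by
  obtain ⟨A, B, p, hA, hB, hp, h⟩ := xi_growth_aux
  have main : ∀ s : ℂ, 1/2 ≤ s.re → ‖xiF s‖ ≤
      Real.exp ((A + B + 4 + 2 / Real.sqrt p) * (1 + ‖s‖) ^ (3/2 : ℝ)) := by
    intro s hs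
    have hr : 1 ≤ 1 + ‖s‖ := by linarith [norm_nonneg s]
    set r := 1 + ‖s‖ with hrdef
    have hr32 : r ≤ r ^ (3/2 : ℝ) := by
      nth_rw 1 [← Real.rpow_one r]
      exact Real.rpow_le_rpow_of_exponent_le hr (by norm_num)
    have h1 := h s hs
    have hsr : s.re ≤ r := (Complex.re_le_norm s).trans (by linarith)
    have h2 : (s.re / p) ^ (s.re / 2) ≤ Real.exp (2 / Real.sqrt p * r ^ (3/2 : ℝ)) := by
      have hpos : 0 < s.re / p := by apply div_pos <;> linarith
      rw [Real.rpow_def_of_pos hpos]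
      apply Real.exp_le_exp.2
      have h3 : Real.log (s.re / p) ≤ 2 * Real.sqrt (s.re / p) := by
        have := Real.log_le_sub_one_of_pos (Real.sqrt_pos.2 hpos)
        rw [Real.log_sqrt hpos.le] at this
        linarith
      have h4 : Real.sqrt (s.re / p) ≤ Real.sqrt r / Real.sqrt p := by
        rw [← Real.sqrt_div (by linarith)]
        apply Real.sqrt_le_sqrt
        gcongr
      have h5 : r ^ (3/2 : ℝ) = r * Real.sqrt r := by
        rw [Real.sqrt_eq_rpow, show (3/2:ℝ) = 1 + 1/2 by norm_num, Real.rpow_add (by linarith), Real.rpow_one]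
      rw [h5]
      have h6 : 0 ≤ Real.sqrt r / Real.sqrt p := by positivity
      calc Real.log (s.re / p) * (s.re / 2) ≤ (2 * (Real.sqrt r / Real.sqrt p)) * (s.re / 2) := by
            gcongr
            · linarith
        _ ≤ (2 * (Real.sqrt r / Real.sqrt p)) * r := by
            gcongr; linarith
        _ = _ := by ring
    set E := Real.exp (2 / Real.sqrt p * r ^ (3/2 : ℝ)) with hE
    have hE1 : 1 ≤ E := Real.one_le_exp (by positivity)
    have h7 : ‖xiF s‖ ≤ r * r * (A + B * E) + 1 := by
      unfold xiF
      refine (norm_sub_le _ _).trans ?_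
      rw [norm_mul, norm_mul, norm_one]
      have : ‖1 - s‖ ≤ r := (norm_sub_le _ _).trans (by simp [hrdef])
      have h8 : ‖s‖ ≤ r := by linarith
      gcongr
      exact h1.trans (by gcongr)
    have h9 : r * r * (A + B * E) + 1 ≤ r * r * ((A + B + 1) * E) := by
      have : A ≤ A * E := le_mul_of_one_le_right hA.le hE1
      have h10 : 1 ≤ r * r := by nlinarith
      have h11 : 1 ≤ r * r * E := by nlinarith
      nlinarith
    have hexp1 : r ≤ Real.exp r := by linarith [Real.add_one_le_exp r]
    have hexp2 : A + B + 1 ≤ Real.exp (A + B) := Real.add_one_le_exp _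
    refine h7.trans (h9.trans ?_)
    calc r * r * ((A + B + 1) * E) ≤ Real.exp r * Real.exp r * (Real.exp (A + B) * E) := by gcongr
      _ = Real.exp (r + r + (A + B) + 2 / Real.sqrt p * r ^ (3/2 : ℝ)) := by
        rw [hE, ← Real.exp_add, ← Real.exp_add, ← Real.exp_add]; congr 1; ring
      _ ≤ _ := by
        apply Real.exp_le_exp.2
        nlinarith [mul_nonneg (add_pos hA hB).le (sub_nonneg.2 (hr.trans hr32))]
  set C := A + B + 4 + 2 / Real.sqrt p with hC
  have hC0 : 0 < C := by positivity
  refine ⟨C * 2 ^ (3/2 : ℝ), by positivity, fun s => ?_⟩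
  have hmon : ∀ z : ℂ, ‖z‖ ≤ 1 + ‖s‖ → C * (1 + ‖z‖) ^ (3/2:ℝ) ≤ C * 2 ^ (3/2:ℝ) * (1 + ‖s‖) ^ (3/2:ℝ) := by
    intro z hz
    rw [mul_assoc, ← Real.mul_rpow (by norm_num) (by positivity)]
    gcongr
    linarith [norm_nonneg s]
  rcases le_or_gt (1/2) s.re with hs | hs
  · exact (main s hs).trans (Real.exp_le_exp.2 (hmon s (by linarith)))
  · rw [← xiF_one_sub]
    refine (main (1 - s) (by simp; linarith)).trans (Real.exp_le_exp.2 (hmon _ ?_))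
    exact (norm_sub_le _ _).trans (by simp)

lemma xiF_eq {s : ℂ} (hs : 0 < s.re) (h1 : s ≠ 1) :
    xiF s = s * (1 - s) * Complex.Gammaℝ s * riemannZeta s := by
  have h0 : s ≠ 0 := by rintro rfl; simp at hs
  have h2 : (1 - s) ≠ 0 := sub_ne_zero.2 (Ne.symm h1)
  rw [riemannZeta_def_of_ne_zero h0, mul_assoc _ (Complex.Gammaℝ s),
    mul_div_cancel₀ _ (Complex.Gammaℝ_ne_zero_of_re_pos hs), completedRiemannZeta_eq, xiF]
  field_simp
  ring

lemma xiF_ne_zero_of_one_le {s : ℂ} (hs : 1 ≤ s.re) : xiF s ≠ 0 := by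
  by_cases h1 : s = 1
  · subst h1; simp [xiF_one]
  · rw [xiF_eq (by linarith) h1]
    have h0 : s ≠ 0 := by rintro rfl; simp at hs; linarith
    exact mul_ne_zero (mul_ne_zero (mul_ne_zero h0 (sub_ne_zero.2 (Ne.symm h1)))
      (Complex.Gammaℝ_ne_zero_of_re_pos (by linarith))) (riemannZeta_ne_zero_of_one_le_re hs)

lemma xiF_re_lt {s : ℂ} (h : xiF s = 0) : 0 < s.re ∧ s.re < 1 := by
  constructor
  · by_contra hc
    have : xiF (1 - s) ≠ 0 := xiF_ne_zero_of_one_le (by simp; linarith)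
    exact this (by rw [xiF_one_sub, h])
  · by_contra hc
    exact xiF_ne_zero_of_one_le (not_lt.1 hc) h

lemma xiF_zero_iff {s : ℂ} : xiF s = 0 ↔ IsNontrivialZero s := by
  constructor
  · intro h
    obtain ⟨h0, h1⟩ := xiF_re_lt h
    refine ⟨?_, h0, h1⟩
    have hs1 : s ≠ 1 := by rintro rfl; simp at h1
    have hs0 : s ≠ 0 := by rintro rfl; simp at h0
    rw [xiF_eq h0 hs1] at h
    have := mul_ne_zero (mul_ne_zero hs0 (sub_ne_zero.2 (Ne.symm hs1))) (Complex.Gammaℝ_ne_zero_of_re_pos h0)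
    exact (mul_eq_zero.1 h).resolve_left this
  · rintro ⟨h, h0, h1⟩
    have hs1 : s ≠ 1 := by rintro rfl; simp at h1
    rw [xiF_eq h0 hs1, h, mul_zero]

/-- multiplicities -/
noncomputable def mX (ρ : ℂ) : ℕ := analyticOrderNatAt xiF ρ

lemma xiF_zero_ne : xiF 0 ≠ 0 := by simp [xiF_zero]

lemma Gammaℝ_diffAt {s : ℂ} (hs : 0 < s.re) : DifferentiableAt ℂ Complex.Gammaℝ s := by
  have := (Complex.differentiable_Gammaℝ_inv s).inv (inv_ne_zero (Complex.Gammaℝ_ne_zero_of_re_pos hs))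
  refine this.congr_of_eventuallyEq (Filter.Eventually.of_forall fun z => ?_)
  simp

lemma mX_eq {ρ : ℂ} (h : IsNontrivialZero ρ) : zetaMult ρ = mX ρ := by
  obtain ⟨_, h0, h1⟩ := h
  have hU : IsOpen {z : ℂ | 0 < z.re ∧ z.re < 1} :=
    (isOpen_lt continuous_const Complex.continuous_re).inter
      (isOpen_lt Complex.continuous_re continuous_const)
  have hmem : {z : ℂ | 0 < z.re ∧ z.re < 1} ∈ 𝓝 ρ := hU.mem_nhds ⟨h0, h1⟩
  have hζ : AnalyticAt ℂ riemannZeta ρ := by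
    have hd : DifferentiableOn ℂ riemannZeta {z : ℂ | 0 < z.re ∧ z.re < 1} := fun z hz =>
      (differentiableAt_riemannZeta (by rintro rfl; simpa using hz.2)).differentiableWithinAt
    exact hd.analyticAt hmem
  have hG : AnalyticAt ℂ (fun z => z * (1 - z) * Complex.Gammaℝ z) ρ := by
    have hd : DifferentiableOn ℂ (fun z => z * (1 - z) * Complex.Gammaℝ z) {z : ℂ | 0 < z.re ∧ z.re < 1} :=
      fun z hz => (DifferentiableAt.mul (by fun_prop) (Gammaℝ_diffAt hz.1)).differentiableWithinAt
    exact hd.analyticAt hmem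
  have hG0 : (fun z => z * (1 - z) * Complex.Gammaℝ z) ρ ≠ 0 := by
    have hs1 : ρ ≠ 1 := by rintro rfl; simp at h1
    have hs0 : ρ ≠ 0 := by rintro rfl; simp at h0
    exact mul_ne_zero (mul_ne_zero hs0 (sub_ne_zero.2 (Ne.symm hs1))) (Complex.Gammaℝ_ne_zero_of_re_pos h0)
  have hord : analyticOrderAt xiF ρ = analyticOrderAt riemannZeta ρ := by
    have : xiF =ᶠ[𝓝 ρ] (fun z => z * (1 - z) * Complex.Gammaℝ z) * riemannZeta := by
      filter_upwards [hmem] with z hz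
      rw [xiF_eq hz.1 (by rintro rfl; simpa using hz.2)]
      rfl
    rw [analyticOrderAt_congr this, analyticOrderAt_mul hG hζ, hG.analyticOrderAt_eq_zero.2 hG0, zero_add]
  have hne := hd_order_ne_top xiF_diff xiF_zero_ne ρ
  have hnat : analyticOrderAt riemannZeta ρ = (mX ρ : ℕ∞) := by
    rw [← hord, mX, Nat.cast_analyticOrderNatAt hne]
  obtain ⟨ha, hb⟩ := (analyticOrderAt_eq_nat_iff_iteratedDeriv_eq_zero hζ).1 hnat
  unfold zetaMult
  apply le_antisymm
  · exact Nat.sInf_le hb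
  · by_contra hc
    push Not at hc
    have hm := Nat.sInf_mem (s := {n : ℕ | iteratedDeriv n riemannZeta ρ ≠ 0}) ⟨_, hb⟩
    exact hm (ha _ hc)

lemma mX_pos {ρ : ℂ} (h : xiF ρ = 0) : 1 ≤ mX ρ := by
  by_contra hc
  have h0 : mX ρ = 0 := by omega
  have h1 : analyticOrderAt xiF ρ = 0 := by
    rw [← Nat.cast_analyticOrderNatAt (hd_order_ne_top xiF_diff xiF_zero_ne ρ)]
    simpa [mX] using h0
  exact ((xiF_diff.analyticAt ρ).analyticOrderAt_eq_zero.1 h1) h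

open ComplexConjugate in
lemma xiF_conj (s : ℂ) : xiF (conj s) = conj (xiF s) := by
  have key : ∀ s : ℂ, 0 < s.re → xiF (conj s) = conj (xiF s) := by
    intro s hs
    by_cases h1 : s = 1
    · subst h1; simp [xiF_one]
    · have h1' : conj s ≠ 1 := by
        intro h; apply h1; have := congrArg conj h; simpa using this
      rw [xiF_eq (by simpa using hs) h1', xiF_eq hs h1, riemannZeta_conj, Complex.Gammaℝ_def, Complex.Gammaℝ_def]
      have e1 : conj s / 2 = conj (s/2) := by simp [Complex.conj_ofNat]
      have e2 : (Real.pi : ℂ) ^ (-conj s / 2) = conj ((Real.pi : ℂ) ^ (-s/2)) := by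
        have h := Complex.conj_cpow (Real.pi : ℂ) (-conj s / 2) (by rw [Complex.arg_ofReal_of_nonneg Real.pi_pos.le]; exact Real.pi_pos.ne)
        have h2 : conj (-conj s / 2) = -s/2 := by simp [Complex.conj_ofNat]
        rw [Complex.conj_ofReal, h2] at h
        rw [h]
      rw [e2, e1, Complex.Gamma_conj]
      simp
  rcases lt_or_ge 0 s.re with h | h
  · exact key s h
  · have := key (1 - s) (by simp; linarith)
    rw [← xiF_one_sub (conj s), ← xiF_one_sub s, ← this]
    simp

open ComplexConjugate in
lemma xiF_refl_zero {ρ : ℂ} (h : xiF ρ = 0) : xiF (1 - conj ρ) = 0 := by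
  rw [xiF_one_sub, xiF_conj, h, map_zero]

open ComplexConjugate in
lemma mX_refl (ρ : ℂ) : mX (1 - conj ρ) = mX ρ := by
  obtain ⟨g, hg, hfg, hgn⟩ := hd_factor xiF_diff xiF_zero_ne {ρ}
  simp only [Finset.prod_singleton, Finset.mem_singleton, forall_eq] at hfg hgn
  set h : ℂ → ℂ := fun w => (-1) ^ (mX ρ) * conj (g (conj (1 - w))) with hh
  have hd : Differentiable ℂ h := by
    intro w
    have h1 : DifferentiableAt ℂ (fun z => conj (g (conj z))) (1 - w) := by
      exact differentiableAt_conj_conj_iff.2 (hg (conj (1 - w)))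
    have h2 : DifferentiableAt ℂ (fun w : ℂ => 1 - w) w := by fun_prop
    have := h1.comp w h2
    exact (differentiableAt_const _).mul this
  have hfac : ∀ w, xiF w = (w - (1 - conj ρ)) ^ (mX ρ) * h w := by
    intro w
    have : xiF w = conj (xiF (conj (1 - w))) := by
      rw [xiF_conj, Complex.conj_conj, xiF_one_sub]
    rw [this, hfg, hh]
    simp only [map_mul, map_pow, map_sub, Complex.conj_conj, map_one]
    rw [← mul_assoc, ← mul_pow]
    congr 2
    ring
  have hnz : h (1 - conj ρ) ≠ 0 := by
    simp only [hh]
    apply mul_ne_zero (pow_ne_zero _ (by norm_num))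
    simpa using hgn
  have : analyticOrderAt xiF (1 - conj ρ) = (mX ρ : ℕ∞) := by
    rw [(xiF_diff.analyticAt _).analyticOrderAt_eq_natCast]
    exact ⟨h, hd.analyticAt _, hnz, Filter.Eventually.of_forall fun w => by simpa using hfac w⟩
  unfold mX at this ⊢
  rw [analyticOrderNatAt, this]
  rfl

/-- finiteness of zeros in balls -/
lemma xiF_zeros_finite (R : ℝ) : {z : ℂ | xiF z = 0 ∧ ‖z‖ ≤ R}.Finite := by
  have ha : AnalyticOnNhd ℂ xiF univ := fun z _ => xiF_diff.analyticAt z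
  by_contra hinf
  have hc : IsCompact (Metric.closedBall (0:ℂ) R) := isCompact_closedBall 0 R
  obtain ⟨z, hz, hacc⟩ := (show Set.Infinite {z : ℂ | xiF z = 0 ∧ ‖z‖ ≤ R} from hinf).exists_accPt_of_subset_isCompact hc
    (fun z hz => by simpa using hz.2)
  have hfreq : ∃ᶠ w in 𝓝[≠] z, xiF w = 0 := by
    rw [accPt_iff_frequently_nhdsNE] at hacc
    exact hacc.mono fun w hw => hw.1
  have := ha.eqOn_zero_of_preconnected_of_frequently_eq_zero isPreconnected_univ (mem_univ z) hfreq
  exact xiF_zero_ne (this (mem_univ 0))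

/-- zeros in a ball -/
noncomputable def ZB (R : ℝ) : Finset ℂ := (xiF_zeros_finite R).toFinset

lemma mem_ZB {R : ℝ} {z : ℂ} : z ∈ ZB R ↔ xiF z = 0 ∧ ‖z‖ ≤ R := by simp [ZB]

/-- Partial fractions. -/
lemma xiF_partial_fractions {s s' : ℂ} (hs : xiF s ≠ 0) (hs' : xiF s' ≠ 0) :
    Tendsto (fun R : ℝ => ∑ ρ ∈ ZB R, (mX ρ : ℂ) * (1 / (s - ρ) - 1 / (s' - ρ))) atTop
      (𝓝 (logDeriv xiF s - logDeriv xiF s')) := by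
  obtain ⟨C, hC, hg⟩ := xiF_growth
  rw [tendsto_iff_norm_sub_tendsto_zero]
  refine squeeze_zero' (g := fun R : ℝ => 256 * (C * (1 + 2 * R) ^ (3/2:ℝ)) / (2 * R) ^ 2 * ‖s - s'‖)
    (Eventually.of_forall fun _ => norm_nonneg _) ?_ ?_
  · filter_upwards [eventually_gt_atTop (8 * ‖s‖), eventually_gt_atTop (8 * ‖s'‖), eventually_gt_atTop 0] with R h1 h2 h3
    rw [norm_sub_rev]
    refine hd_landau xiF_diff xiF_zero_ne (R := 2 * R) (M := C * (1 + 2 * R) ^ (3/2:ℝ)) (by linarith) (by positivity) ?_ ?_ ?_ (by linarith) (by linarith) hs hs'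
    · intro z hz
      rw [xiF_zero, norm_neg, norm_one, mul_one]
      refine (hg z).trans (Real.exp_le_exp.2 ?_)
      gcongr
    · intro z hz hz0
      exact mem_ZB.2 ⟨hz0, by linarith⟩
    · intro ρ hρ
      linarith [(mem_ZB.1 hρ).2]
  · have h1 : Tendsto (fun R : ℝ => (256 * C * 3 ^ (3/2:ℝ) / 4 * ‖s - s'‖) * R ^ (-(1/2) : ℝ)) atTop (𝓝 ((256 * C * 3 ^ (3/2:ℝ) / 4 * ‖s - s'‖) * 0)) :=
      (tendsto_rpow_neg_atTop (by norm_num)).const_mul _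
    rw [mul_zero] at h1
    refine squeeze_zero' ?_ ?_ h1
    · filter_upwards [eventually_gt_atTop 0] with R hR
      positivity
    · filter_upwards [eventually_gt_atTop 1] with R hR
      have h2 : (1 + 2 * R) ^ (3/2:ℝ) ≤ 3 ^ (3/2:ℝ) * R ^ (3/2:ℝ) := by
        rw [← Real.mul_rpow (by norm_num) (by linarith)]
        gcongr
        linarith
      have h3 : R ^ (3/2:ℝ) = R ^ 2 * R ^ (-(1/2) : ℝ) := by
        rw [← Real.rpow_natCast R 2, ← Real.rpow_add (by linarith)]; norm_num
      calc 256 * (C * (1 + 2 * R) ^ (3/2:ℝ)) / (2 * R) ^ 2 * ‖s - s'‖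
          ≤ 256 * (C * (3 ^ (3/2:ℝ) * R ^ (3/2:ℝ))) / (2 * R) ^ 2 * ‖s - s'‖ := by gcongr
        _ = _ := by rw [h3]; field_simp; ring

/-- log derivative of xi -/
lemma xiF_logDeriv {z : ℂ} (hz : 1 < z.re) :
    logDeriv xiF z = 1 / (z - 1) - Real.log Real.pi / 2 + Complex.digamma (z / 2 + 1) / 2
      + logDeriv riemannZeta z := by
  have hz0 : z ≠ 0 := by rintro rfl; simp at hz; linarith
  have hz1 : z ≠ 1 := by rintro rfl; simp at hz
  have hU : {w : ℂ | 1 < w.re} ∈ 𝓝 z :=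
    (isOpen_lt continuous_const Complex.continuous_re).mem_nhds hz
  have he : xiF =ᶠ[𝓝 z] fun w => (w * (1 - w) * ((Real.pi : ℂ) ^ (-w/2) * Complex.Gamma (w/2))) * riemannZeta w := by
    filter_upwards [hU] with w hw
    have hw : 1 < w.re := hw
    rw [xiF_eq (by linarith) (by rintro rfl; simp at hw), Complex.Gammaℝ_def]
  have hne : ∀ m : ℕ, z/2 ≠ -m := by
    intro m h
    have := congrArg Complex.re h
    simp at this
    have : (0:ℝ) ≤ m := Nat.cast_nonneg m
    linarith
  have hΓd : DifferentiableAt ℂ (fun w : ℂ => Complex.Gamma (w/2)) z := by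
    have := (Complex.differentiableAt_Gamma (z/2) hne)
    exact this.comp z (by fun_prop)
  have hΓ0 : Complex.Gamma (z/2) ≠ 0 := Complex.Gamma_ne_zero hne
  have hπ : (Real.pi : ℂ) ≠ 0 := by exact_mod_cast Real.pi_ne_zero
  have hπd : HasDerivAt (fun w : ℂ => (Real.pi : ℂ) ^ (-w/2)) ((Real.pi : ℂ) ^ (-z/2) * Complex.log Real.pi * (-1/2)) z := by
    have h1 : HasDerivAt (fun w : ℂ => -w/2) (-1/2) z := ((hasDerivAt_id z).neg.div_const 2)
    exact h1.const_cpow (Or.inl hπ)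
  have hπ0 : (Real.pi : ℂ) ^ (-z/2) ≠ 0 := by simp [Complex.cpow_eq_zero_iff, hπ]
  have hζ0 : riemannZeta z ≠ 0 := riemannZeta_ne_zero_of_one_le_re hz.le
  have h1z : 1 - z ≠ 0 := sub_ne_zero.2 (Ne.symm hz1)
  rw [(logDeriv_congr_nhds he).eq_of_nhds,
    logDeriv_mul (f := fun w => w * (1 - w) * ((Real.pi : ℂ) ^ (-w/2) * Complex.Gamma (w/2))) z
      (mul_ne_zero (mul_ne_zero hz0 h1z) (mul_ne_zero hπ0 hΓ0)) hζ0
      (DifferentiableAt.mul (by fun_prop) (hπd.differentiableAt.mul hΓd)) (differentiableAt_riemannZeta hz1),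
    logDeriv_mul (f := fun w => w * (1 - w)) (g := fun w => (Real.pi : ℂ) ^ (-w/2) * Complex.Gamma (w/2)) z (mul_ne_zero hz0 h1z) (mul_ne_zero hπ0 hΓ0) (by fun_prop) (hπd.differentiableAt.mul hΓd),
    logDeriv_mul (f := fun w : ℂ => (Real.pi : ℂ) ^ (-w/2)) (g := fun w => Complex.Gamma (w/2)) z hπ0 hΓ0 hπd.differentiableAt hΓd,
    logDeriv_mul (f := fun w : ℂ => w) (g := fun w => 1 - w) z hz0 h1z (by fun_prop) (by fun_prop)]
  congr 1
  have e1 : logDeriv (fun w : ℂ => (Real.pi : ℂ) ^ (-w/2)) z = -(Real.log Real.pi / 2) := by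
    rw [logDeriv_apply, hπd.deriv, Complex.ofReal_log Real.pi_pos.le]
    field_simp
  have e2 : logDeriv (fun w : ℂ => Complex.Gamma (w/2)) z = Complex.digamma (z/2) / 2 := by
    have := logDeriv_comp (f := Complex.Gamma) (g := fun w : ℂ => w/2) (x := z) (Complex.differentiableAt_Gamma (z/2) hne) (by fun_prop)
    rw [show (fun w : ℂ => Complex.Gamma (w/2)) = Complex.Gamma ∘ (fun w : ℂ => w/2) from rfl, this, Complex.digamma_def]
    simp [div_eq_mul_inv]
  have e3 : logDeriv (fun w : ℂ => 1 - w) z = 1 / (z - 1) := by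
    rw [logDeriv_apply, deriv_const_sub, deriv_id'']
    rw [← neg_sub z 1, div_neg, neg_div, neg_neg]
  rw [e1, e2, e3, logDeriv_id', Complex.digamma_apply_add_one _ hne]
  field_simp
  ring

noncomputable def rdig (x : ℝ) : ℝ := deriv (fun y => Real.log (Real.Gamma y)) x

lemma rdig_ofReal {x : ℝ} (hx : 0 < x) : Complex.digamma (x : ℂ) = (rdig x : ℂ) := by
  have hne : ∀ m : ℕ, (x : ℂ) ≠ -m := by
    intro m h
    have := congrArg Complex.re h
    simp at this
    have : (0:ℝ) ≤ m := Nat.cast_nonneg m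
    linarith
  have hd := (Complex.differentiableAt_Gamma (x:ℂ) hne).hasDerivAt
  have h1 : HasDerivAt (fun y : ℝ => ((Real.Gamma y : ℝ) : ℂ)) (deriv Complex.Gamma x) x := by
    have := hd.comp_ofReal
    simpa [Complex.Gamma_ofReal] using this
  have hr : DifferentiableAt ℝ Real.Gamma x := Real.differentiableAt_Gamma (fun m h => by
    have : (0:ℝ) ≤ m := Nat.cast_nonneg m
    linarith)
  have h2 : HasDerivAt (fun y : ℝ => ((Real.Gamma y : ℝ) : ℂ)) ((deriv Real.Gamma x : ℝ) : ℂ) x :=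
    hr.hasDerivAt.ofReal_comp
  have h3 := h1.unique h2
  rw [Complex.digamma_def, logDeriv_apply, h3, Complex.Gamma_ofReal, rdig,
    (hr.hasDerivAt.log (Real.Gamma_pos_of_pos hx).ne').deriv]
  push_cast; rfl

lemma rdig_succ {x : ℝ} (hx : 0 < x) : rdig (x + 1) = rdig x + 1 / x := by
  have hne : ∀ m : ℕ, (x : ℂ) ≠ -m := by
    intro m h
    have := congrArg Complex.re h
    simp at this
    have : (0:ℝ) ≤ m := Nat.cast_nonneg m
    linarith
  have := Complex.digamma_apply_add_one (x:ℂ) hne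
  rw [rdig_ofReal hx, show (x:ℂ) + 1 = ((x+1 : ℝ):ℂ) by push_cast; ring, rdig_ofReal (by linarith)] at this
  rw [one_div]
  exact_mod_cast this

lemma rdig_add_nat {x : ℝ} (hx : 0 < x) (N : ℕ) :
    rdig (x + N) = rdig x + ∑ k ∈ Finset.range N, 1 / (x + k) := by
  induction N with
  | zero => simp
  | succ n ih =>
    rw [Finset.sum_range_succ, ← add_assoc, ← ih, ← rdig_succ (by positivity)]
    push_cast; ring_nf

lemma rdig_mono : MonotoneOn rdig (Ioi 0) := by
  have hc := Real.convexOn_log_Gamma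
  refine ConvexOn.monotoneOn_deriv hc ?_
  intro x hx
  have hx : 0 < x := hx
  have hr : DifferentiableAt ℝ Real.Gamma x := Real.differentiableAt_Gamma (fun m h => by
    have : (0:ℝ) ≤ m := Nat.cast_nonneg m
    linarith)
  exact hr.log (Real.Gamma_pos_of_pos hx).ne'

lemma rdig_tendsto {x : ℝ} (hx : 0 < x) :
    Tendsto (fun N : ℕ => ∑ k ∈ Finset.range N, (1 / ((k:ℝ) + 1) - 1 / (x + k))) atTop
      (𝓝 (rdig x - rdig 1)) := by
  have h0 : Tendsto (fun N : ℕ => rdig (x + N) - rdig (1 + N)) atTop (𝓝 0) := by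
    obtain ⟨M, hM⟩ := exists_nat_ge (max x 1)
    have hMx : x ≤ M := (le_max_left _ _).trans hM
    have hM1 : 1 ≤ (M:ℝ) := (le_max_right _ _).trans hM
    have hlim : Tendsto (fun N : ℕ => (M : ℝ) / N) atTop (𝓝 0) := tendsto_const_div_atTop_nhds_zero_nat _
    refine squeeze_zero_norm' ?_ hlim
    filter_upwards [eventually_gt_atTop 0] with N hN
    have hN : (0:ℝ) < N := by exact_mod_cast hN
    have h1 : rdig ((N:ℝ) + M) - rdig N ≤ M / N := by
      rw [rdig_add_nat hN, add_sub_cancel_left]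
      calc ∑ k ∈ Finset.range M, 1 / ((N:ℝ) + k) ≤ ∑ k ∈ Finset.range M, 1 / (N:ℝ) := by
            gcongr; simp
        _ = M / N := by simp; ring
    have a1 := rdig_mono (mem_Ioi.2 hN) (mem_Ioi.2 (by linarith : 0 < x + N)) (by linarith)
    have a2 := rdig_mono (mem_Ioi.2 (by linarith : 0 < x + N)) (mem_Ioi.2 (by linarith : 0 < (N:ℝ) + M)) (by linarith)
    have a3 := rdig_mono (mem_Ioi.2 hN) (mem_Ioi.2 (by linarith : 0 < 1 + (N:ℝ))) (by linarith)
    have a4 := rdig_mono (mem_Ioi.2 (by linarith : 0 < 1 + (N:ℝ))) (mem_Ioi.2 (by linarith : 0 < (N:ℝ) + M)) (by linarith)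
    rw [Real.norm_eq_abs, abs_le]
    constructor <;> linarith
  have h1 : (fun N : ℕ => ∑ k ∈ Finset.range N, (1 / ((k:ℝ) + 1) - 1 / (x + k))) =
      fun N : ℕ => (rdig x - rdig 1) - (rdig (x + N) - rdig (1 + N)) := by
    funext N
    rw [rdig_add_nat hx, rdig_add_nat one_pos, Finset.sum_sub_distrib]
    have : ∀ k ∈ Finset.range N, 1 / ((k:ℝ)+1) = 1 / (1 + (k:ℝ)) := fun k _ => by rw [add_comm]
    rw [Finset.sum_congr rfl this]; ring
  rw [h1]
  simpa using h0.const_sub (rdig x - rdig 1)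

lemma dig_term_bound {z : ℂ} {δ M : ℝ} (hδ : 0 < δ) (hδ1 : δ ≤ 1) (hz : δ ≤ z.re) (hM : ‖z‖ ≤ M) (k : ℕ) :
    ‖1 / ((k:ℂ) + 1) - 1 / (z + k)‖ ≤ (M + 1) / δ * (1 / ((k:ℝ) + 1) ^ 2) := by
  have h1 : ((k:ℂ) + 1) ≠ 0 := by exact_mod_cast Nat.succ_ne_zero k
  have hre : δ * (k + 1) ≤ (z + k).re := by simp; nlinarith [Nat.cast_nonneg (α := ℝ) k]
  have hn : δ * (k + 1) ≤ ‖z + k‖ := hre.trans (Complex.re_le_norm _)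
  have hpos : 0 < δ * ((k:ℝ) + 1) := by positivity
  have h2 : z + k ≠ 0 := by rw [← norm_pos_iff]; linarith
  have : 1 / ((k:ℂ) + 1) - 1 / (z + k) = (z - 1) / (((k:ℂ) + 1) * (z + k)) := by
    field_simp; ring
  rw [this, norm_div, norm_mul]
  have h3 : ‖(k:ℂ) + 1‖ = k + 1 := by
    rw [show (k:ℂ) + 1 = ((k + 1 : ℝ) : ℂ) by push_cast; ring, Complex.norm_real, Real.norm_of_nonneg (by positivity)]
  rw [h3]
  have h4 : ‖z - 1‖ ≤ M + 1 := (norm_sub_le _ _).trans (by simp; linarith)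
  calc ‖z - 1‖ / (((k:ℝ) + 1) * ‖z + k‖) ≤ (M + 1) / (((k:ℝ) + 1) * (δ * (k + 1))) := by
        gcongr
        linarith [norm_nonneg (z - 1)]
    _ = _ := by field_simp

lemma summable_inv_succ_sq : Summable (fun k : ℕ => 1 / ((k:ℝ) + 1) ^ 2) := by
  have := (summable_nat_add_iff 1).2 (Real.summable_one_div_nat_pow.2 (one_lt_two))
  simpa using this

lemma digamma_hasSum {z : ℂ} (hz : 0 < z.re) :
    HasSum (fun k : ℕ => 1 / ((k:ℂ) + 1) - 1 / (z + k)) (Complex.digamma z - Complex.digamma 1) := by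
  have hsum : ∀ w : ℂ, 0 < w.re → Summable (fun k : ℕ => 1 / ((k:ℂ) + 1) - 1 / (w + k)) := by
    intro w hw
    refine Summable.of_norm_bounded (summable_inv_succ_sq.mul_left _)
      (dig_term_bound (δ := min w.re 1) (M := ‖w‖) (lt_min hw one_pos) (min_le_right _ _) (min_le_left _ _) le_rfl)
  set δ := min z.re 1 / 2 with hδ
  have hm : 0 < min z.re 1 := lt_min hz one_pos
  have hδ0 : 0 < δ := by positivity
  have hδz : δ < z.re := by have := min_le_left z.re 1; linarith
  have hδ1 : δ < 1 := by have := min_le_right z.re 1; linarith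
  set M := ‖z‖ + 2 with hM
  set U : Set ℂ := {w | δ < w.re} ∩ Metric.ball 0 M with hU
  have hUo : IsOpen U := (isOpen_lt continuous_const Complex.continuous_re).inter Metric.isOpen_ball
  have hUc : Convex ℝ U := (convex_halfSpace_re_gt δ).inter (convex_ball 0 M)
  have hzU : z ∈ U := ⟨hδz, by simp [hM]⟩
  have h1U : (1:ℂ) ∈ U := ⟨by simpa using hδ1, by simp [hM]; linarith [norm_nonneg z]⟩
  have hF : DifferentiableOn ℂ (fun w : ℂ => ∑' k : ℕ, (1 / ((k:ℂ) + 1) - 1 / (w + k))) U := by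
    refine Complex.differentiableOn_tsum_of_summable_norm (summable_inv_succ_sq.mul_left ((M+1)/δ)) ?_ hUo ?_
    · intro k w hw
      have : w + k ≠ 0 := by
        intro h
        have := congrArg Complex.re h
        have h2 : δ < w.re := hw.1
        simp at this
        linarith [Nat.cast_nonneg (α := ℝ) k]
      have hd : DifferentiableAt ℂ (fun w : ℂ => 1 / ((k:ℂ) + 1) - 1 / (w + k)) w := by fun_prop (disch := assumption)
      exact hd.differentiableWithinAt
    · intro k w hw
      have h2 : δ < w.re := hw.1
      have h3 : ‖w‖ < M := by simpa using hw.2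
      exact dig_term_bound hδ0 hδ1.le h2.le h3.le k
  have hG : DifferentiableOn ℂ (fun w : ℂ => Complex.digamma w - Complex.digamma 1) U := by
    have hΓ : DifferentiableOn ℂ Complex.Gamma U := by
      intro w hw
      refine (Complex.differentiableAt_Gamma w fun m h => ?_).differentiableWithinAt
      have := congrArg Complex.re h
      have h2 : δ < w.re := hw.1
      simp at this
      linarith [Nat.cast_nonneg (α := ℝ) m]
    refine DifferentiableOn.sub_const ?_ _
    have : Complex.digamma = fun w => deriv Complex.Gamma w / Complex.Gamma w := rfl
    rw [this]
    refine (hΓ.deriv hUo).div hΓ fun w hw => Complex.Gamma_ne_zero_of_re_pos ?_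
    have h2 : δ < w.re := hw.1
    linarith
  have hEq := (hF.analyticOnNhd hUo).eqOn_of_preconnected_of_frequently_eq (hG.analyticOnNhd hUo)
    hUc.isPreconnected h1U ?_
  · have := hEq hzU
    simp only at this
    rw [← this]
    exact (hsum z hz).hasSum
  · have hpt : ∀ x : ℝ, 0 < x → ∑' k : ℕ, (1 / ((k:ℂ) + 1) - 1 / ((x:ℂ) + k)) = Complex.digamma x - Complex.digamma 1 := by
      intro x hx
      have h1 := (hsum x (by simpa using hx)).hasSum.tendsto_sum_nat
      have h2 := (Complex.continuous_ofReal.tendsto _).comp (rdig_tendsto hx)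
      have h3 : (Complex.ofReal ∘ fun N : ℕ => ∑ k ∈ Finset.range N, (1 / ((k:ℝ) + 1) - 1 / (x + k))) =
          fun N : ℕ => ∑ k ∈ Finset.range N, (1 / ((k:ℂ) + 1) - 1 / ((x:ℂ) + k)) := by
        funext N; simp
      rw [h3] at h2
      rw [tendsto_nhds_unique h1 h2, rdig_ofReal hx]
      have := rdig_ofReal one_pos
      rw [Complex.ofReal_one] at this
      rw [this]; simp
    have ht : Tendsto (fun n : ℕ => (((1 + 1 / ((n:ℝ) + 1) : ℝ)) : ℂ)) atTop (𝓝[≠] 1) := by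
      rw [tendsto_nhdsWithin_iff]
      constructor
      · have h1 : Tendsto (fun n : ℕ => (1 + 1 / ((n:ℝ) + 1) : ℝ)) atTop (𝓝 (1 + 0)) :=
          tendsto_one_div_add_atTop_nhds_zero_nat.const_add 1
        have h2 := (Complex.continuous_ofReal.tendsto _).comp h1
        simpa [Function.comp_def] using h2
      · refine Eventually.of_forall fun n => ?_
        have h1 : (0:ℝ) < 1 / ((n:ℝ) + 1) := by positivity
        simp only [mem_compl_iff, mem_singleton_iff]
        intro h
        have : (1 + 1 / ((n:ℝ) + 1) : ℝ) = 1 := by exact_mod_cast h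
        linarith
    refine ht.frequently (Frequently.of_forall fun n => ?_)
    exact hpt _ (by positivity)

lemma log_step {w : ℂ} (hw : 0 < w.re) :
    ‖Complex.log (w + 1) - Complex.log w - 1 / w‖ ≤ 1 / w.re ^ 2 := by
  have hpos : ∀ t : ℝ, 0 ≤ t → (w + t) ∈ Complex.slitPlane := by
    intro t ht
    left; simp; linarith
  have hw0 : w ≠ 0 := by rintro rfl; simp at hw
  have hd : ∀ t ∈ Icc (0:ℝ) 1, HasDerivWithinAt (fun t : ℝ => Complex.log (w + t) - t * (1 / w)) (1 / (w + t) - 1 / w) (Icc 0 1) t := by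
    intro t ht
    have h1 : HasDerivAt (fun t : ℝ => w + (t:ℂ)) 1 t := by
      simpa using (Complex.ofRealCLM.hasDerivAt (x := t)).const_add w
    have h2 := h1.clog_real (hpos t ht.1)
    have h3 : HasDerivAt (fun t : ℝ => (t:ℂ) * (1 / w)) (1 * (1/w)) t :=
      (Complex.ofRealCLM.hasDerivAt (x := t)).mul_const (1/w)
    rw [one_mul] at h3
    exact (h2.sub h3).hasDerivWithinAt
  have hb : ∀ t ∈ Ico (0:ℝ) 1, ‖1 / (w + t) - 1 / w‖ ≤ 1 / w.re ^ 2 := by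
    intro t ht
    have hwt : w + t ≠ 0 := Complex.slitPlane_ne_zero (hpos t ht.1)
    have : 1 / (w + t) - 1 / w = - t / ((w + t) * w) := by field_simp; ring
    rw [this, norm_div, norm_neg, norm_mul, Complex.norm_real, Real.norm_of_nonneg ht.1]
    have a1 : w.re ≤ ‖w‖ := Complex.re_le_norm w
    have a2 : w.re ≤ ‖w + t‖ := le_trans (by simp [ht.1]) (Complex.re_le_norm (w + t))
    rw [sq]
    gcongr
    exact ht.2.le
  have := norm_image_sub_le_of_norm_deriv_le_segment_01' hd hb
  rw [sub_right_comm]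
  simpa using this

lemma digamma_log : ∃ C : ℝ, 0 < C ∧ ∀ z : ℂ, 1/2 ≤ z.re → ‖Complex.digamma z - Complex.log z‖ ≤ C := by
  set B := ∑' k : ℕ, 4 * (1 / ((k:ℝ) + 1) ^ 2) with hB
  have hBs := summable_inv_succ_sq.mul_left 4
  have hB0 : 0 ≤ B := tsum_nonneg fun k => by positivity
  have key : ∀ z : ℂ, 1/2 ≤ z.re → ∀ N : ℕ,
      ‖Complex.log (z + N) - Complex.log z - ∑ k ∈ Finset.range N, 1 / (z + k)‖ ≤ B := by
    intro z hz N
    have h1 : ‖Complex.log (z + N) - Complex.log z - ∑ k ∈ Finset.range N, 1 / (z + k)‖ ≤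
        ∑ k ∈ Finset.range N, 4 * (1 / ((k:ℝ) + 1) ^ 2) := by
      have h2 : Complex.log (z + N) - Complex.log z - ∑ k ∈ Finset.range N, 1 / (z + k) =
          ∑ k ∈ Finset.range N, (Complex.log (z + k + 1) - Complex.log (z + k) - 1 / (z + k)) := by
        have := Finset.sum_range_sub (fun k : ℕ => Complex.log (z + k)) N
        rw [Finset.sum_sub_distrib]
        simp only [Nat.cast_add, Nat.cast_one, ← add_assoc, Nat.cast_zero, add_zero] at this
        rw [this]
      rw [h2]
      refine norm_sum_le_of_le _ fun k _ => ?_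
      have hk : (0:ℝ) ≤ k := Nat.cast_nonneg k
      have h3 : (z + k).re = z.re + k := by simp
      refine (log_step (by rw [h3]; linarith)).trans ?_
      rw [h3]
      have h4 : (((k:ℝ) + 1) / 2) ^ 2 ≤ (z.re + k) ^ 2 := by
        gcongr; linarith
      calc 1 / (z.re + k) ^ 2 ≤ 1 / (((k:ℝ) + 1) / 2) ^ 2 := by gcongr
        _ = _ := by field_simp; norm_num
    exact h1.trans (hBs.sum_le_tsum _ fun k _ => by positivity)
  refine ⟨2 * B + ‖Complex.digamma 1‖ + 1, by positivity, fun z hz => ?_⟩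
  have hlim := (digamma_hasSum (z := z) (by linarith)).tendsto_sum_nat
  have hq : Tendsto (fun N : ℕ => Complex.log (z + N) - Complex.log (1 + N)) atTop (𝓝 0) := by
    have h1 : Tendsto (fun N : ℕ => Complex.log ((z - 1) / ((N:ℂ) + 1) + 1)) atTop (𝓝 0) := by
      have h2 : Tendsto (fun N : ℕ => (z - 1) / ((N:ℂ) + 1) + 1) atTop (𝓝 1) := by
        have : Tendsto (fun N : ℕ => (z - 1) * (1 / ((N:ℂ) + 1)) + 1) atTop (𝓝 ((z-1) * 0 + 1)) :=
          (tendsto_one_div_add_atTop_nhds_zero_nat.const_mul (z-1)).add_const 1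
        simpa [div_eq_mul_inv] using this
      have h3 := (continuousAt_clog (x := 1) (by simp)).tendsto.comp h2
      simpa [Function.comp_def] using h3
    refine h1.congr fun N => ?_
    have hN : (0:ℝ) < (N:ℝ) + 1 := by positivity
    have hN' : ((N:ℂ) + 1) ≠ 0 := by exact_mod_cast Nat.succ_ne_zero N
    have hzN : z + N ≠ 0 := by
      intro h
      have := congrArg Complex.re h
      simp at this
      linarith [Nat.cast_nonneg (α := ℝ) N]
    have e : (z - 1) / ((N:ℂ) + 1) + 1 = (z + N) / ((N:ℂ) + 1) := by field_simp; ring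
    have hne : (z - 1) / ((N:ℂ) + 1) + 1 ≠ 0 := by rw [e]; exact div_ne_zero hzN hN'
    have e2 : z + N = (((N:ℝ) + 1 : ℝ) : ℂ) * ((z - 1) / ((N:ℂ) + 1) + 1) := by
      push_cast; field_simp; ring
    have e3 : Complex.log (1 + N) = (Real.log ((N:ℝ) + 1) : ℝ) := by
      rw [Complex.ofReal_log hN.le]; push_cast; rw [add_comm]
    rw [e3]
    conv_rhs => rw [e2]
    rw [Complex.log_ofReal_mul hN hne]; ring
  have hlim2 := ((hlim.sub_const (Complex.log z)).add hq).norm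
  rw [add_zero] at hlim2
  have hle : ‖Complex.digamma z - Complex.digamma 1 - Complex.log z‖ ≤ 2 * B := by
    refine le_of_tendsto hlim2 (Eventually.of_forall fun N => ?_)
    have k1 := key z hz N
    have k2 := key 1 (by norm_num) N
    have hs : ∑ k ∈ Finset.range N, 1 / ((1:ℂ) + k) = ∑ k ∈ Finset.range N, 1 / ((k:ℂ) + 1) :=
      Finset.sum_congr rfl fun k _ => by rw [add_comm]
    rw [hs, Complex.log_one, sub_zero] at k2
    rw [Finset.sum_sub_distrib]
    have e : ∑ k ∈ Finset.range N, 1 / ((k:ℂ) + 1) - ∑ k ∈ Finset.range N, 1 / (z + k) - Complex.log z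
        + (Complex.log (z + N) - Complex.log (1 + N)) =
        (Complex.log (z + N) - Complex.log z - ∑ k ∈ Finset.range N, 1 / (z + k)) -
        (Complex.log (1 + N) - ∑ k ∈ Finset.range N, 1 / ((k:ℂ) + 1)) := by ring
    rw [e]
    refine (norm_sub_le _ _).trans (by linarith)
  calc ‖Complex.digamma z - Complex.log z‖ = ‖(Complex.digamma z - Complex.digamma 1 - Complex.log z) + Complex.digamma 1‖ := by congr 1; ring
    _ ≤ _ := (norm_add_le _ _).trans (by linarith)

/-- nontrivial zeros as a type -/
abbrev Zs : Type := {ρ : ℂ // xiF ρ = 0}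

lemma zeta_logDeriv_eq {z : ℂ} (hz : 1 < z.re) :
    logDeriv riemannZeta z = - LSeries (fun n => ((ArithmeticFunction.vonMangoldt n : ℝ) : ℂ)) z := by
  rw [ArithmeticFunction.LSeries_vonMangoldt_eq_deriv_riemannZeta_div hz, logDeriv_apply]; ring

lemma zeta_logDeriv_bound : ∃ C : ℝ, 0 < C ∧ ∀ z : ℂ, 5/4 ≤ z.re → ‖logDeriv riemannZeta z‖ ≤ C := by
  have hs := (ArithmeticFunction.LSeriesSummable_vonMangoldt (s := ((5/4 : ℝ) : ℂ)) (by simp; norm_num)).norm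
  refine ⟨(∑' n, ‖LSeries.term (fun n => ((ArithmeticFunction.vonMangoldt n : ℝ) : ℂ)) ((5/4 : ℝ) : ℂ) n‖) + 1, by positivity, fun z hz => ?_⟩
  rw [zeta_logDeriv_eq (by linarith), norm_neg]
  unfold LSeries
  have := tsum_of_norm_bounded hs.hasSum (f := fun n => LSeries.term (fun n => ((ArithmeticFunction.vonMangoldt n : ℝ) : ℂ)) z n)
    (fun n => LSeries.norm_term_le_of_re_le_re _ (by simpa using hz) n)
  linarith

open ComplexConjugate in
lemma xiF_logDeriv_conj (s : ℂ) : logDeriv xiF (conj s) = conj (logDeriv xiF s) := by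
  have h : HasDerivAt (conj ∘ xiF ∘ conj) (conj (deriv xiF s)) (conj s) := (xiF_diff s).hasDerivAt.conj_conj
  have e : conj ∘ xiF ∘ conj = xiF := by funext z; simp [xiF_conj]
  rw [e] at h
  rw [logDeriv_apply, logDeriv_apply, h.deriv, xiF_conj, map_div₀]

lemma xiF_logDeriv_one_sub (s : ℂ) : logDeriv xiF (1 - s) = - logDeriv xiF s := by
  have e : (fun z => xiF (1 - z)) = xiF := funext xiF_one_sub
  have h : deriv xiF s = - deriv xiF (1 - s) := by
    have := deriv_comp_const_sub (f := xiF) 1 s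
    rw [e] at this
    exact this
  rw [logDeriv_apply, logDeriv_apply, h, xiF_one_sub]; ring

/-- bound for xi'/xi to the right -/
lemma xiF_logDeriv_bound : ∃ C : ℝ, 0 < C ∧ ∀ z : ℂ, 5/4 ≤ z.re →
    ‖logDeriv xiF z - Complex.log (z/2 + 1) / 2‖ ≤ C := by
  obtain ⟨C1, hC1, h1⟩ := zeta_logDeriv_bound
  obtain ⟨C2, hC2, h2⟩ := digamma_log
  refine ⟨4 + |Real.log Real.pi| + C2 + C1, by positivity, fun z hz => ?_⟩
  rw [xiF_logDeriv (by linarith)]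
  have e : 1 / (z - 1) - Real.log Real.pi / 2 + Complex.digamma (z / 2 + 1) / 2
      + logDeriv riemannZeta z - Complex.log (z/2+1) / 2 = 1 / (z - 1) - Real.log Real.pi / 2
      + (Complex.digamma (z / 2 + 1) - Complex.log (z/2+1)) / 2 + logDeriv riemannZeta z := by ring
  rw [e]
  have a1 : ‖1 / (z - 1)‖ ≤ 4 := by
    rw [norm_div, norm_one]
    have : 1/4 ≤ ‖z - 1‖ := le_trans (by simp; linarith) (Complex.re_le_norm (z - 1))
    rw [div_le_iff₀ (by linarith)]; linarith
  have a2 : ‖(Real.log Real.pi / 2 : ℂ)‖ ≤ |Real.log Real.pi| := by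
    rw [norm_div, Complex.norm_real, Real.norm_eq_abs]
    simp
  have a3 : ‖(Complex.digamma (z / 2 + 1) - Complex.log (z/2+1)) / 2‖ ≤ C2 := by
    rw [norm_div]
    have := h2 (z/2+1) (by simp; linarith)
    simp; linarith
  refine (norm_add_le _ _).trans ?_
  refine add_le_add ((norm_add_le _ _).trans (add_le_add ((norm_sub_le _ _).trans (add_le_add a1 a2)) a3)) (h1 z hz)

lemma norm_log_le {z : ℂ} (hz : 1 ≤ ‖z‖) : ‖Complex.log z‖ ≤ Real.log ‖z‖ + Real.pi := by
  have h := Complex.norm_le_abs_re_add_abs_im (Complex.log z)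
  rw [Complex.log_re, Complex.log_im, abs_of_nonneg (Real.log_nonneg hz)] at h
  linarith [Complex.abs_arg_le_pi z]

lemma re_one_div (z : ℂ) : (1 / z).re = z.re / (z.re ^ 2 + z.im ^ 2) := by
  rw [one_div, Complex.inv_re, Complex.normSq_apply]; congr 1; ring

open ComplexConjugate in
lemma zero_density : ∃ C : ℝ, 0 < C ∧ ∀ (t d : ℝ), 1 ≤ d → ∀ F : Finset ℂ, (∀ ρ ∈ F, xiF ρ = 0) →
    ∑ ρ ∈ F, (mX ρ : ℝ) * (d / (d ^ 2 + (t - ρ.im) ^ 2)) ≤ C * Real.log (d + |t| + 2) := by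
  obtain ⟨C, hC, hb⟩ := xiF_logDeriv_bound
  refine ⟨4 * (C + Real.pi + 1), by positivity, fun t d hd F hF => ?_⟩
  set s : ℂ := ⟨1 + d, t⟩ with hs
  have hsre : s.re = 1 + d := rfl
  have hsim : s.im = t := rfl
  set s' : ℂ := 1 - conj s with hs'
  have hs're : s'.re = -d := by simp [hs', hsre]
  have hs'im : s'.im = t := by simp [hs', hsim]
  have hξs : xiF s ≠ 0 := xiF_ne_zero_of_one_le (by rw [hsre]; linarith)
  have hξs' : xiF s' ≠ 0 := by
    rw [hs', xiF_one_sub, xiF_conj]; simpa using hξs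
  have hpf := xiF_partial_fractions hξs hξs'
  have hdiff : logDeriv xiF s - logDeriv xiF s' = logDeriv xiF s + conj (logDeriv xiF s) := by
    rw [hs', xiF_logDeriv_one_sub, xiF_logDeriv_conj]; ring
  rw [hdiff] at hpf
  have hre := (Complex.continuous_re.tendsto _).comp hpf
  have hre2 : (logDeriv xiF s + conj (logDeriv xiF s)).re = 2 * (logDeriv xiF s).re := by simp; ring
  rw [hre2] at hre
  -- termwise lower bound
  have hterm : ∀ ρ : ℂ, xiF ρ = 0 → (mX ρ : ℝ) * (d / (d ^ 2 + (t - ρ.im) ^ 2)) * (1/2) ≤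
      ((mX ρ : ℂ) * (1 / (s - ρ) - 1 / (s' - ρ))).re := by
    intro ρ hρ
    obtain ⟨h0, h1⟩ := xiF_re_lt hρ
    have e : ((mX ρ : ℂ) * (1 / (s - ρ) - 1 / (s' - ρ))).re = (mX ρ : ℝ) * ((1 / (s - ρ)).re - (1 / (s' - ρ)).re) := by
      rw [← Complex.ofReal_natCast, Complex.re_ofReal_mul, Complex.sub_re]
    rw [e, mul_assoc]
    refine mul_le_mul_of_nonneg_left ?_ (Nat.cast_nonneg _)
    rw [re_one_div, re_one_div, Complex.sub_re, Complex.sub_re, Complex.sub_im, Complex.sub_im, hsre, hsim, hs're, hs'im]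
    have lem : ∀ x y : ℝ, d ≤ x → x ≤ 2 * d → d / (d^2 + y^2) * (1/4) ≤ x / (x^2 + y^2) := by
      intro x y h1 h2
      have hd0 : 0 < d := by linarith
      have hx0 : 0 < x := by linarith
      rw [div_mul_eq_mul_div, div_le_div_iff₀ (by positivity) (by positivity)]
      nlinarith [mul_nonneg (sub_nonneg.2 h1) (sq_nonneg y), mul_nonneg (sub_nonneg.2 h1) (sub_nonneg.2 h2), sq_nonneg y, mul_nonneg (sub_nonneg.2 h2) (by linarith : (0:ℝ) ≤ d), mul_nonneg (by linarith : (0:ℝ) ≤ d) (sq_nonneg y), mul_nonneg (mul_nonneg (sub_nonneg.2 h2) (by linarith : (0:ℝ) ≤ d)) (by linarith : (0:ℝ) ≤ x)]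
    have l1 := lem (1 + d - ρ.re) (t - ρ.im) (by linarith) (by linarith)
    have l2 := lem (d + ρ.re) (t - ρ.im) (by linarith) (by linarith)
    have e2 : (-d - ρ.re) / ((-d - ρ.re) ^ 2 + (t - ρ.im) ^ 2) = - ((d + ρ.re) / ((d + ρ.re) ^ 2 + (t - ρ.im) ^ 2)) := by
      rw [← neg_div]; congr 1 <;> ring
    rw [e2]
    linarith
  have hsum : ∑ ρ ∈ F, (mX ρ : ℝ) * (d / (d ^ 2 + (t - ρ.im) ^ 2)) * (1/2) ≤ 2 * (logDeriv xiF s).re := by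
    refine ge_of_tendsto hre ?_
    filter_upwards [eventually_ge_atTop (∑ ρ ∈ F, ‖ρ‖)] with R hR
    have hsub : F ⊆ ZB R := fun ρ hρ => mem_ZB.2 ⟨hF ρ hρ,
      (Finset.single_le_sum (f := fun ρ : ℂ => ‖ρ‖) (fun i _ => norm_nonneg i) hρ).trans hR⟩
    calc ∑ ρ ∈ F, (mX ρ : ℝ) * (d / (d ^ 2 + (t - ρ.im) ^ 2)) * (1/2)
        ≤ ∑ ρ ∈ ZB R, (mX ρ : ℝ) * (d / (d ^ 2 + (t - ρ.im) ^ 2)) * (1/2) :=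
          Finset.sum_le_sum_of_subset_of_nonneg hsub fun ρ _ _ => by positivity
      _ ≤ ∑ ρ ∈ ZB R, ((mX ρ : ℂ) * (1 / (s - ρ) - 1 / (s' - ρ))).re :=
          Finset.sum_le_sum fun ρ hρ => hterm ρ (mem_ZB.1 hρ).1
      _ = _ := by simp only [Function.comp_apply, Complex.re_sum]
  rw [← Finset.sum_mul] at hsum
  have hX : 1 ≤ Real.log (d + |t| + 2) := by
    rw [Real.le_log_iff_exp_le (by positivity)]
    linarith [Real.exp_one_lt_d9, abs_nonneg t]
  have hn1 : 1 ≤ ‖s/2 + 1‖ := le_trans (by simp [hsre]; linarith) (Complex.re_le_norm (s/2+1))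
  have hn2 : ‖s/2 + 1‖ ≤ d + |t| + 2 := by
    refine (Complex.norm_le_abs_re_add_abs_im _).trans ?_
    have r1 : (s/2+1).re = (1 + d)/2 + 1 := by simp [hsre]
    have r2 : (s/2+1).im = t/2 := by simp [hsim]
    rw [r1, r2, abs_of_nonneg (by positivity), abs_div, abs_two]
    linarith [abs_nonneg t]
  have hfin : (logDeriv xiF s).re ≤ C + (Real.log (d + |t| + 2) + Real.pi) := by
    have := hb s (by rw [hsre]; linarith)
    have h2 := norm_log_le hn1
    have h3 := Real.log_le_log (by linarith) hn2
    have h4 : ‖logDeriv xiF s‖ ≤ C + ‖Complex.log (s/2+1) / 2‖ := by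
      have := norm_le_norm_add_norm_sub' (logDeriv xiF s) (Complex.log (s/2+1)/2)
      linarith
    rw [norm_div] at h4
    have : ‖(2:ℂ)‖ = 2 := by simp
    rw [this] at h4
    have := Complex.re_le_norm (logDeriv xiF s)
    have := norm_nonneg (Complex.log (s/2+1))
    linarith
  nlinarith [Real.pi_pos]

/-- summability with exponent 3/2 -/
lemma summable_zeros : Summable (fun ρ : Zs => (mX ρ : ℝ) * (1 + |(ρ:ℂ).im|) ^ (-(3/2) : ℝ)) := by
  obtain ⟨C, hC, hd⟩ := zero_density
  set r : ℝ := (2:ℝ) ^ (-(1/2) : ℝ) with hr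
  have hr0 : 0 < r := by positivity
  have hr1 : r < 1 := Real.rpow_lt_one_of_one_lt_of_neg one_lt_two (by norm_num)
  have hgs : Summable (fun j : ℕ => 4 * r ^ j * (C * ((j:ℝ) + 3))) := by
    have h1 := summable_pow_mul_geometric_of_norm_lt_one 1 (r := r) (by rw [Real.norm_of_nonneg hr0.le]; exact hr1)
    have h0 := summable_geometric_of_lt_one hr0.le hr1
    have := (h1.mul_left (4 * C)).add (h0.mul_left (12 * C))
    refine this.congr fun j => ?_
    simp; ring
  refine summable_of_sum_le (c := ∑' j : ℕ, 4 * r ^ j * (C * ((j:ℝ) + 3))) (fun ρ => by positivity) fun F => ?_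
  -- maximal j
  have hpt : ∀ ρ : Zs, ∃ j : ℕ, (1 + |(ρ:ℂ).im|) ^ (-(3/2) : ℝ) ≤
      4 * r ^ j * ((2:ℝ) ^ (j+1) / (((2:ℝ)^(j+1)) ^ 2 + (0 - (ρ:ℂ).im) ^ 2)) := by
    intro ρ
    obtain ⟨j, hj1, hj2⟩ := exists_nat_pow_near (x := 1 + |(ρ:ℂ).im|) (y := (2:ℝ)) (by linarith [abs_nonneg (ρ:ℂ).im]) one_lt_two
    refine ⟨j, ?_⟩
    have hp : (0:ℝ) < 2 ^ j := by positivity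
    have h1 : (1 + |(ρ:ℂ).im|) ^ (-(3/2) : ℝ) ≤ ((2:ℝ) ^ j) ^ (-(3/2) : ℝ) :=
      Real.rpow_le_rpow_of_nonpos hp hj1 (by norm_num)
    have h2 : ((2:ℝ) ^ j) ^ (-(3/2) : ℝ) = r ^ j * (1 / 2 ^ j) := by
      have : (-(3/2) : ℝ) = -(1/2) + (-1) := by norm_num
      rw [this, Real.rpow_add hp, Real.rpow_neg_one, show (1:ℝ)/2^j = (2^j)⁻¹ from one_div _, hr, ← Real.rpow_natCast, ← Real.rpow_mul (by norm_num),
        mul_comm (j:ℝ), Real.rpow_mul (by norm_num), Real.rpow_natCast, Real.rpow_natCast]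
    rw [h2] at h1
    refine h1.trans ?_
    rw [mul_assoc, mul_left_comm]
    refine mul_le_mul_of_nonneg_left ?_ (by positivity)
    have h3 : (0 - (ρ:ℂ).im) ^ 2 ≤ ((2:ℝ)^(j+1)) ^ 2 := by
      rw [zero_sub, neg_sq, ← sq_abs]
      gcongr
      linarith
    have h4 : (2:ℝ)^(j+1) = 2 * 2 ^ j := by ring
    rw [h4] at h3 ⊢
    rw [mul_div_assoc', div_le_div_iff₀ hp (by positivity)]
    nlinarith
  choose J hJ using hpt
  set N := F.sup J + 1 with hN
  have hle : ∀ ρ ∈ F, (mX ρ : ℝ) * (1 + |(ρ:ℂ).im|) ^ (-(3/2) : ℝ) ≤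
      ∑ j ∈ Finset.range N, 4 * r ^ j * ((mX ρ : ℝ) * ((2:ℝ) ^ (j+1) / (((2:ℝ)^(j+1)) ^ 2 + (0 - (ρ:ℂ).im) ^ 2))) := by
    intro ρ hρ
    have hmem : J ρ ∈ Finset.range N := Finset.mem_range.2 (Nat.lt_succ_of_le (Finset.le_sup (f := J) hρ))
    refine le_trans ?_ (Finset.single_le_sum (f := fun j : ℕ => 4 * r ^ j * ((mX ρ : ℝ) * ((2:ℝ) ^ (j+1) / (((2:ℝ)^(j+1)) ^ 2 + (0 - (ρ:ℂ).im) ^ 2)))) (fun j _ => by positivity) hmem)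
    have := mul_le_mul_of_nonneg_left (hJ ρ) (Nat.cast_nonneg (α := ℝ) (mX ρ))
    linarith
  refine (Finset.sum_le_sum hle).trans ?_
  rw [Finset.sum_comm]
  refine le_trans ?_ (hgs.sum_le_tsum (Finset.range N) fun j _ => by positivity)
  refine Finset.sum_le_sum fun j _ => ?_
  rw [← Finset.mul_sum]
  refine mul_le_mul_of_nonneg_left ?_ (by positivity)
  have h1 := hd 0 ((2:ℝ)^(j+1)) (one_le_pow₀ one_le_two) (F.map (Function.Embedding.subtype _)) (by
    intro ρ hρ
    simp only [Finset.mem_map, Function.Embedding.subtype_apply] at hρ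
    obtain ⟨a, _, rfl⟩ := hρ
    exact a.2)
  rw [Finset.sum_map] at h1
  simp only [Function.Embedding.subtype_apply] at h1
  refine h1.trans ?_
  gcongr
  rw [abs_zero, add_zero]
  have h5 : (2:ℝ)^(j+1) + 2 ≤ 2 ^ (j + 2) := by
    have : (1:ℝ) ≤ 2 ^ j := one_le_pow₀ one_le_two
    rw [pow_succ, pow_add]; nlinarith
  calc Real.log ((2:ℝ)^(j+1) + 2) ≤ Real.log (2 ^ (j+2)) := Real.log_le_log (by positivity) h5
    _ = (j + 2) * Real.log 2 := by rw [Real.log_pow]; push_cast; ring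
    _ ≤ (j + 2) * 1 := by gcongr; linarith [Real.log_two_lt_d9]
    _ ≤ _ := by linarith

lemma one_add_im_le {z ρ : ℂ} (h : 1/4 ≤ ‖z - ρ‖) : 1 + |ρ.im| ≤ (5 + 4 * ‖z‖) * ‖z - ρ‖ := by
  have h1 : |ρ.im| ≤ ‖z‖ + ‖z - ρ‖ := by
    have h2 : ρ.im = z.im - (z - ρ).im := by simp
    rw [h2]
    refine (abs_sub _ _).trans (add_le_add (Complex.abs_im_le_norm z) (Complex.abs_im_le_norm _))
  nlinarith [norm_nonneg z]

lemma pf_term_bound {z z' ρ : ℂ} (h : 1/4 ≤ ‖z - ρ‖) (h' : 1/4 ≤ ‖z' - ρ‖) :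
    ‖1 / (z - ρ) - 1 / (z' - ρ)‖ ≤ ‖z - z'‖ * ((5 + 4 * ‖z‖) * (5 + 4 * ‖z'‖)) * (1 + |ρ.im|) ^ (-(3/2) : ℝ) := by
  have hz : z - ρ ≠ 0 := by rw [← norm_pos_iff]; linarith
  have hz' : z' - ρ ≠ 0 := by rw [← norm_pos_iff]; linarith
  have e : 1 / (z - ρ) - 1 / (z' - ρ) = - (z - z') / ((z - ρ) * (z' - ρ)) := by field_simp; ring
  rw [e, norm_div, norm_neg, norm_mul]
  have h1 := one_add_im_le h
  have h2 := one_add_im_le h'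
  have hg : 1 ≤ 1 + |ρ.im| := by linarith [abs_nonneg ρ.im]
  have h3 : (1 + |ρ.im|) ^ (-2 : ℝ) ≤ (1 + |ρ.im|) ^ (-(3/2) : ℝ) :=
    Real.rpow_le_rpow_of_exponent_le hg (by norm_num)
  have h4 : (1 + |ρ.im|) ^ (-2 : ℝ) = 1 / (1 + |ρ.im|) ^ 2 := by
    rw [Real.rpow_neg (by linarith), one_div]; norm_num
  rw [h4] at h3
  have h5 : (1 + |ρ.im|) ^ 2 ≤ ((5 + 4 * ‖z‖) * (5 + 4 * ‖z'‖)) * (‖z - ρ‖ * ‖z' - ρ‖) := by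
    calc (1 + |ρ.im|) ^ 2 = (1 + |ρ.im|) * (1 + |ρ.im|) := sq _
      _ ≤ ((5 + 4 * ‖z‖) * ‖z - ρ‖) * ((5 + 4 * ‖z'‖) * ‖z' - ρ‖) := by gcongr
      _ = _ := by ring
  have h6 : 1 / (‖z - ρ‖ * ‖z' - ρ‖) ≤ ((5 + 4 * ‖z‖) * (5 + 4 * ‖z'‖)) * (1 / (1 + |ρ.im|) ^ 2) := by
    rw [mul_one_div, div_le_div_iff₀ (by positivity) (by positivity)]; linarith
  calc ‖z - z'‖ / (‖z - ρ‖ * ‖z' - ρ‖) = ‖z - z'‖ * (1 / (‖z - ρ‖ * ‖z' - ρ‖)) := by ring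
    _ ≤ ‖z - z'‖ * (((5 + 4 * ‖z‖) * (5 + 4 * ‖z'‖)) * (1 / (1 + |ρ.im|) ^ 2)) := by gcongr
    _ ≤ ‖z - z'‖ * (((5 + 4 * ‖z‖) * (5 + 4 * ‖z'‖)) * (1 + |ρ.im|) ^ (-(3/2) : ℝ)) := by gcongr
    _ = _ := by ring

lemma xiF_pf_hasSum {z z' : ℂ} (h : ∀ ρ : Zs, 1/4 ≤ ‖z - ρ‖) (h' : ∀ ρ : Zs, 1/4 ≤ ‖z' - ρ‖) :
    HasSum (fun ρ : Zs => (mX ρ : ℂ) * (1 / (z - ρ) - 1 / (z' - ρ))) (logDeriv xiF z - logDeriv xiF z') := by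
  have hz : xiF z ≠ 0 := fun h0 => by have := h ⟨z, h0⟩; simp at this; linarith
  have hz' : xiF z' ≠ 0 := fun h0 => by have := h' ⟨z', h0⟩; simp at this; linarith
  have hs : Summable (fun ρ : Zs => (mX ρ : ℂ) * (1 / (z - ρ) - 1 / (z' - ρ))) := by
    refine Summable.of_norm_bounded (summable_zeros.mul_left (‖z - z'‖ * ((5 + 4 * ‖z‖) * (5 + 4 * ‖z'‖)))) fun ρ => ?_
    rw [norm_mul, Complex.norm_natCast]
    have := mul_le_mul_of_nonneg_left (pf_term_bound (h ρ) (h' ρ)) (Nat.cast_nonneg (α := ℝ) (mX ρ))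
    linarith
  have hlim := xiF_partial_fractions hz hz'
  set G : ℝ → Finset Zs := fun R => (ZB R).subtype (fun ρ => xiF ρ = 0) with hG
  have hGt : Tendsto G atTop atTop := by
    refine tendsto_atTop_finset_of_monotone ?_ ?_
    · intro R R' hR ρ hρ
      rw [hG, Finset.mem_subtype, mem_ZB] at hρ ⊢
      exact ⟨hρ.1, hρ.2.trans hR⟩
    · intro ρ
      refine ⟨‖(ρ:ℂ)‖, ?_⟩
      rw [hG, Finset.mem_subtype, mem_ZB]
      exact ⟨ρ.2, le_rfl⟩
  have h2 := hs.hasSum.comp hGt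
  have h3 : (fun R => ∑ ρ ∈ G R, (mX ρ : ℂ) * (1 / (z - ρ) - 1 / (z' - ρ))) =
      fun R => ∑ ρ ∈ ZB R, (mX ρ : ℂ) * (1 / (z - ρ) - 1 / (z' - ρ)) := by
    funext R
    exact Finset.sum_subtype_of_mem (f := fun ρ : ℂ => (mX ρ : ℂ) * (1 / (z - ρ) - 1 / (z' - ρ))) (fun ρ hρ => (mem_ZB.1 hρ).1)
  have h4 : Tendsto (fun R => ∑ ρ ∈ G R, (mX ρ : ℂ) * (1 / (z - ρ) - 1 / (z' - ρ))) atTop (𝓝 _) := h2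
  rw [h3] at h4
  rw [tendsto_nhds_unique hlim h4]
  exact hs.hasSum

noncomputable def wv (y : ℝ) : ℂ := 3/4 + y * Complex.I

lemma wv_re (y : ℝ) : (wv y).re = 3/4 := by simp [wv]

structure LTok (F : ℝ → ℂ) (Fh : ℝ → ℂ) : Prop where
  cont : Continuous F
  integ : ∀ y, Integrable (fun u : ℝ => F u * Complex.exp (-(wv y) * u))
  eq : ∀ y, ∫ u : ℝ, F u * Complex.exp (-(wv y) * u) = Fh y

lemma LTok.add {F G Fh Gh} (hF : LTok F Fh) (hG : LTok G Gh) :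
    LTok (fun u => F u + G u) (fun y => Fh y + Gh y) where
  cont := hF.cont.add hG.cont
  integ y := by
    simp only [add_mul]
    exact (hF.integ y).add (hG.integ y)
  eq y := by
    simp only [add_mul]
    rw [integral_add (hF.integ y) (hG.integ y), hF.eq, hG.eq]

lemma LTok.const_mul {F Fh} (c : ℂ) (hF : LTok F Fh) :
    LTok (fun u => c * F u) (fun y => c * Fh y) where
  cont := continuous_const.mul hF.cont
  integ y := by simpa only [mul_assoc] using (hF.integ y).const_mul c
  eq y := by
    simp only [mul_assoc]
    rw [integral_const_mul, hF.eq]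

lemma LTok.congr {F Fh Gh} (hF : LTok F Fh) (h : ∀ y, Fh y = Gh y) : LTok F Gh :=
  ⟨hF.cont, hF.integ, fun y => by rw [hF.eq, h]⟩

lemma LTok.shift {F Fh} (v : ℝ) (hF : LTok F Fh) :
    LTok (fun u => F (u - v)) (fun y => Complex.exp (-(wv y) * v) * Fh y) := by
  have e : ∀ y, (fun u : ℝ => F (u - v) * Complex.exp (-(wv y) * u)) =
      fun u => (fun x : ℝ => Complex.exp (-(wv y) * v) * (F x * Complex.exp (-(wv y) * x))) (u - v) := by
    intro y; funext u
    have : Complex.exp (-(wv y) * u) = Complex.exp (-(wv y) * v) * Complex.exp (-(wv y) * ((u - v : ℝ) : ℂ)) := by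
      rw [← Complex.exp_add]; congr 1; push_cast; ring
    simp only [this]; ring
  refine ⟨hF.cont.comp (continuous_id.sub continuous_const), fun y => ?_, fun y => ?_⟩
  · rw [e y]
    exact ((hF.integ y).const_mul _).comp_sub_right v
  · rw [e y, integral_sub_right_eq_self (fun x : ℝ => Complex.exp (-(wv y) * v) * (F x * Complex.exp (-(wv y) * x))) v, integral_const_mul, hF.eq]

lemma LTok.unique {F G Fh} (hF : LTok F Fh) (hG : LTok G Fh) : F = G := by
  have hD := hF.add (hG.const_mul (-1))
  set D : ℝ → ℂ := fun u => F u + -1 * G u with hDd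
  set f : ℝ → ℂ := fun u => D u * Complex.exp (-(wv 0) * u) with hf
  have hc : Continuous f := hD.cont.mul (by fun_prop)
  have hi : Integrable f := hD.integ 0
  have hft : FourierTransform.fourier f = fun _ : ℝ => (0:ℂ) := by
    funext w
    rw [Real.fourier_real_eq_integral_exp_smul]
    have := hD.eq (2 * Real.pi * w)
    have h2 : Fh (2 * Real.pi * w) + -1 * Fh (2 * Real.pi * w) = 0 := by ring
    rw [h2] at this
    rw [← this]
    congr 1; funext v
    simp only [hf, smul_eq_mul]
    rw [mul_left_comm, ← Complex.exp_add]
    congr 2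
    simp only [wv]; push_cast; ring
  have h0 := hc.fourierInv_fourier_eq hi (by rw [hft]; exact integrable_zero _ _ _)
  rw [hft] at h0
  funext u
  have h1 : f u = 0 := by
    rw [← h0, Real.fourierInv_eq]; simp
  have h2 : D u = 0 := by
    simp only [hf] at h1
    exact (mul_eq_zero.1 h1).resolve_right (Complex.exp_ne_zero _)
  simp only [hDd] at h2
  linear_combination h2

lemma integrable_exp_abs (v : ℝ) : Integrable (fun u : ℝ => Real.exp (-|u - v| / 4)) := by
  have h : Integrable (fun u : ℝ => Real.exp (-|u| / 4)) := by
    rw [← integrableOn_univ, ← Iic_union_Ioi (a := (0:ℝ))]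
    refine IntegrableOn.union ?_ ?_
    · refine (integrableOn_exp_mul_Iic (a := 1/4) (by norm_num) 0).congr_fun (fun u hu => ?_) measurableSet_Iic
      simp only [mem_Iic] at hu
      simp only [abs_of_nonpos hu]; congr 1; ring
    · refine (integrableOn_exp_mul_Ioi (a := -1/4) (by norm_num) 0).congr_fun (fun u hu => ?_) measurableSet_Ioi
      simp only [mem_Ioi] at hu
      simp only [abs_of_pos hu]; congr 1; ring
  exact h.comp_sub_right v

lemma LTok.tsum {ι : Type*} [Countable ι] {F : ι → ℝ → ℂ} {Fh : ι → ℝ → ℂ} {S : ℝ → ℂ} (A : ι → ℝ) (v : ι → ℝ)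
    (hA : Summable A) (hF : ∀ i, LTok (F i) (Fh i))
    (hb : ∀ i (u : ℝ), ‖F i u‖ * Real.exp (-(3/4) * u) ≤ A i * Real.exp (-|u - v i| / 4))
    (hS : ∀ y, HasSum (fun i => Fh i y) (S y)) : LTok (fun u => ∑' i, F i u) S := by
  have hA0 : ∀ i, 0 ≤ A i := fun i => by
    have := (by positivity : 0 ≤ ‖F i 0‖ * Real.exp (-(3/4) * 0)).trans (hb i 0)
    exact nonneg_of_mul_nonneg_left this (Real.exp_pos _)
  have hn : ∀ y (u : ℝ), ‖Complex.exp (-(wv y) * u)‖ = Real.exp (-(3/4) * u) := by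
    intro y u
    rw [Complex.norm_exp]; congr 1
    rw [Complex.mul_re, Complex.neg_re, wv_re]; simp
  have hnb : ∀ y i (u : ℝ), ‖F i u * Complex.exp (-(wv y) * u)‖ ≤ A i * Real.exp (-|u - v i| / 4) := by
    intro y i u; rw [norm_mul, hn]; exact hb i u
  have he1 : ∀ i (u : ℝ), A i * Real.exp (-|u - v i| / 4) ≤ A i := fun i u =>
    mul_le_of_le_one_right (hA0 i) (Real.exp_le_one_iff.2 (by have := abs_nonneg (u - v i); linarith))
  set I0 := ∫ u : ℝ, Real.exp (-|u| / 4) with hI0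
  have hint : ∀ y, Summable fun i => ∫ u, ‖F i u * Complex.exp (-(wv y) * u)‖ := by
    intro y
    refine Summable.of_nonneg_of_le (fun i => integral_nonneg fun u => norm_nonneg _) (fun i => ?_) (hA.mul_right I0)
    calc ∫ u, ‖F i u * Complex.exp (-(wv y) * u)‖ ≤ ∫ u, A i * Real.exp (-|u - v i| / 4) :=
          integral_mono ((hF i).integ y).norm ((integrable_exp_abs (v i)).const_mul _) (hnb y i)
      _ = A i * I0 := by
          rw [integral_const_mul, integral_sub_right_eq_self (fun u : ℝ => Real.exp (-|u| / 4)) (v i)]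
  have hts : ∀ y (u : ℝ), (∑' i, F i u) * Complex.exp (-(wv y) * u) = ∑' i, F i u * Complex.exp (-(wv y) * u) :=
    fun y u => tsum_mul_right.symm
  have hcy : Continuous fun u : ℝ => ∑' i, F i u * Complex.exp (-(wv 0) * u) :=
    continuous_tsum (fun i => (hF i).cont.mul (by fun_prop)) hA fun i u => (hnb 0 i u).trans (he1 i u)
  have hcont : Continuous fun u : ℝ => ∑' i, F i u := by
    have h2 : Continuous fun u : ℝ => (∑' i, F i u * Complex.exp (-(wv 0) * u)) * Complex.exp ((wv 0) * u) :=
      hcy.mul (by fun_prop)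
    convert h2 using 2 with u
    rw [← hts, mul_assoc, ← Complex.exp_add]; simp
  refine ⟨hcont, fun y => ?_, fun y => ?_⟩
  · have hc : Continuous fun u : ℝ => (∑' i, F i u) * Complex.exp (-(wv y) * u) := hcont.mul (by fun_prop)
    refine ⟨hc.aestronglyMeasurable, ?_⟩
    simp only [hts, HasFiniteIntegral]
    refine lt_of_le_of_lt (lintegral_mono fun u => enorm_tsum_le_tsum_enorm) ?_
    rw [lintegral_tsum fun i => ((hF i).integ y).1.enorm]
    simp only [← ofReal_integral_norm_eq_lintegral_enorm ((hF _).integ y)]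
    exact (hint y).tsum_ofReal_lt_top
  · simp only [hts]
    have h := hasSum_integral_of_summable_integral_norm (fun i => (hF i).integ y) (hint y)
    simp only [(hF _).eq] at h
    exact h.unique (hS y)

noncomputable def kf (p q : ℂ) (u : ℝ) : ℂ := if u ≤ 0 then Complex.exp (q * u) else Complex.exp (p * u)

lemma kf_ok {p q : ℂ} (hp : p.re < 3/4) (hq : 3/4 < q.re) :
    LTok (kf p q) (fun y => 1 / (wv y - p) + 1 / (q - wv y)) := by
  have hc : Continuous (kf p q) := by
    unfold kf
    refine Continuous.if_le (by fun_prop) (by fun_prop) continuous_id continuous_const ?_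
    intro u hu; simp [hu]
  have e1 : ∀ y, EqOn (fun u : ℝ => Complex.exp ((q - wv y) * u)) (fun u : ℝ => kf p q u * Complex.exp (-(wv y) * u)) (Iic 0) := by
    intro y u hu
    simp only [mem_Iic] at hu
    simp only [kf, if_pos hu]
    rw [← Complex.exp_add]; congr 1; ring
  have e2 : ∀ y, EqOn (fun u : ℝ => Complex.exp ((p - wv y) * u)) (fun u : ℝ => kf p q u * Complex.exp (-(wv y) * u)) (Ioi 0) := by
    intro y u hu
    simp only [mem_Ioi] at hu
    simp only [kf, if_neg (not_le.2 hu)]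
    rw [← Complex.exp_add]; congr 1; ring
  have r1 : ∀ y, 0 < (q - wv y).re := fun y => by rw [Complex.sub_re, wv_re]; linarith
  have r2 : ∀ y, (p - wv y).re < 0 := fun y => by rw [Complex.sub_re, wv_re]; linarith
  have i1 : ∀ y, IntegrableOn (fun u : ℝ => kf p q u * Complex.exp (-(wv y) * u)) (Iic 0) := fun y =>
    (integrableOn_exp_mul_complex_Iic (r1 y) 0).congr_fun (e1 y) measurableSet_Iic
  have i2 : ∀ y, IntegrableOn (fun u : ℝ => kf p q u * Complex.exp (-(wv y) * u)) (Ioi 0) := fun y =>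
    (integrableOn_exp_mul_complex_Ioi (r2 y) 0).congr_fun (e2 y) measurableSet_Ioi
  refine ⟨hc, fun y => ?_, fun y => ?_⟩
  · rw [← integrableOn_univ, ← Iic_union_Ioi (a := (0:ℝ))]
    exact (i1 y).union (i2 y)
  · rw [← intervalIntegral.integral_Iic_add_Ioi (i1 y) (i2 y), ← setIntegral_congr_fun measurableSet_Iic (e1 y),
      ← setIntegral_congr_fun measurableSet_Ioi (e2 y), integral_exp_mul_complex_Iic (r1 y), integral_exp_mul_complex_Ioi (r2 y)]
    have : p - wv y ≠ 0 := fun h => by have := r2 y; rw [h] at this; simp at this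
    have : wv y - p ≠ 0 := fun h => by have := r2 y; rw [← neg_sub, h] at this; simp at this
    have : q - wv y ≠ 0 := fun h => by have := r1 y; rw [h] at this; simp at this
    simp only [Complex.ofReal_zero, mul_zero, Complex.exp_zero]
    field_simp
    ring

lemma kf_bound {p q : ℂ} (hp : p.re ≤ 1/2) (hq : 1 ≤ q.re) (u : ℝ) :
    ‖kf p q u‖ * Real.exp (-(3/4) * u) ≤ Real.exp (-|u - 0| / 4) := by
  unfold kf
  rw [sub_zero]
  split_ifs with h
  · rw [Complex.norm_exp, ← Real.exp_add, abs_of_nonpos h]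
    refine Real.exp_le_exp.2 ?_
    simp; nlinarith
  · rw [Complex.norm_exp, ← Real.exp_add, abs_of_pos (not_le.1 h)]
    refine Real.exp_le_exp.2 ?_
    simp; nlinarith

noncomputable def fa (a : ℂ) (u : ℝ) : ℂ := 2 / (1 - a ^ 2) * kf a 1 u

noncomputable def sl (t : ℝ) : ℂ := 1/2 + t * Complex.I

lemma sl_re (t : ℝ) : (sl t).re = 1/2 := by simp [sl]
lemma sl_im (t : ℝ) : (sl t).im = t := by simp [sl]

lemma one_sub_sq_lower {a : ℂ} (h : |a.re| ≤ 1/2) : 3/4 * (1 + a.im ^ 2) ≤ ‖1 - a ^ 2‖ := by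
  refine le_trans ?_ (Complex.re_le_norm _)
  have : (1 - a ^ 2).re = 1 - a.re ^ 2 + a.im ^ 2 := by
    rw [Complex.sub_re, sq, Complex.mul_re, Complex.one_re]; ring
  rw [this]
  have := abs_le.1 h
  nlinarith

lemma one_sub_sq_ne {a : ℂ} (h : |a.re| ≤ 1/2) : 1 - a ^ 2 ≠ 0 := by
  rw [← norm_pos_iff]
  have := one_sub_sq_lower h
  nlinarith [sq_nonneg a.im]

lemma fa_ok {a : ℂ} (ha : a.re < 3/4) (h : 1 - a ^ 2 ≠ 0) :
    LTok (fa a) (fun y => 2 / (1 - wv y ^ 2) * (1 / (wv y - a) + 1 / (1 + a))) := by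
  refine ((kf_ok ha (q := 1) (by norm_num)).const_mul (2 / (1 - a^2))).congr fun y => ?_
  have h1 : wv y - a ≠ 0 := fun h => by have := congrArg Complex.re h; simp [wv_re] at this; linarith
  have h2 : 1 - wv y ≠ 0 := fun h => by have := congrArg Complex.re h; simp [wv_re] at this; linarith
  have h3 : 1 + wv y ≠ 0 := fun h => by have := congrArg Complex.re h; simp [wv_re] at this; linarith
  have e1 : 1 - a ^ 2 = (1 - a) * (1 + a) := by ring
  have e2 : 1 - wv y ^ 2 = (1 - wv y) * (1 + wv y) := by ring
  rw [e1] at h ⊢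
  rw [e2]
  have h4 := left_ne_zero_of_mul h
  have h5 := right_ne_zero_of_mul h
  field_simp
  ring

lemma fa_bound {a : ℂ} (hp : a.re ≤ 1/2) (u : ℝ) :
    ‖fa a u‖ * Real.exp (-(3/4) * u) ≤ ‖2 / (1 - a ^ 2)‖ * Real.exp (-|u - 0| / 4) := by
  unfold fa
  rw [norm_mul, mul_assoc]
  exact mul_le_mul_of_nonneg_left (kf_bound hp (by norm_num) u) (norm_nonneg _)

lemma kf_norm_le {p q : ℂ} {u : ℝ} (hu : 0 ≤ u) : ‖kf p q u‖ ≤ Real.exp (p.re * u) := by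
  unfold kf
  split_ifs with h
  · have : u = 0 := le_antisymm h hu
    simp [this]
  · rw [Complex.norm_exp]; simp

instance : Countable Zs := by
  have h := summable_zeros.countable_support
  have : Function.support (fun ρ : Zs => (mX ρ : ℝ) * (1 + |(ρ:ℂ).im|) ^ (-(3/2) : ℝ)) = univ := by
    ext ρ
    have h1 := mX_pos ρ.2
    have h1' : (mX ρ : ℝ) ≠ 0 := by exact_mod_cast Nat.pos_iff_ne_zero.1 h1
    have h2 : 0 < (1 + |(ρ:ℂ).im|) ^ (-(3/2) : ℝ) := by positivity
    simp only [Function.mem_support, mem_univ, iff_true]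
    exact mul_ne_zero h1' h2.ne'
  rw [this] at h
  exact countable_univ_iff.1 h

lemma sum_zero_t : ∃ C : ℝ, 0 < C ∧ ∀ t : ℝ, Summable (fun ρ : Zs => (mX ρ : ℝ) * (1 / (1 + (t - (ρ:ℂ).im) ^ 2))) ∧
    ∑' ρ : Zs, (mX ρ : ℝ) * (1 / (1 + (t - (ρ:ℂ).im) ^ 2)) ≤ C * Real.log (|t| + 3) := by
  obtain ⟨C, hC, h⟩ := zero_density
  refine ⟨C, hC, fun t => ?_⟩
  have hF : ∀ F : Finset Zs, ∑ ρ ∈ F, (mX ρ : ℝ) * (1 / (1 + (t - (ρ:ℂ).im) ^ 2)) ≤ C * Real.log (|t| + 3) := by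
    intro F
    have h1 := h t 1 le_rfl (F.map (Function.Embedding.subtype _)) (by
      intro ρ hρ
      simp only [Finset.mem_map, Function.Embedding.subtype_apply] at hρ
      obtain ⟨a, _, rfl⟩ := hρ
      exact a.2)
    rw [Finset.sum_map] at h1
    simp only [Function.Embedding.subtype_apply, one_pow] at h1
    rwa [show 1 + |t| + 2 = |t| + 3 by ring] at h1
  have hs := summable_of_sum_le (fun ρ : Zs => by positivity : ∀ ρ : Zs, 0 ≤ (mX ρ : ℝ) * (1 / (1 + (t - (ρ:ℂ).im) ^ 2))) hF
  exact ⟨hs, hs.tsum_le_of_sum_le hF⟩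

lemma zs_re (ρ : Zs) (t : ℝ) : |((ρ:ℂ) - sl t).re| ≤ 1/2 := by
  obtain ⟨h0, h1⟩ := xiF_re_lt ρ.2
  rw [Complex.sub_re, sl_re, abs_le]; constructor <;> linarith

lemma zs_coef_bound (ρ : Zs) (t : ℝ) : ‖2 / (1 - ((ρ:ℂ) - sl t) ^ 2)‖ ≤ 8/3 * (1 / (1 + (t - (ρ:ℂ).im) ^ 2)) := by
  have h := one_sub_sq_lower (zs_re ρ t)
  have e : ((ρ:ℂ) - sl t).im ^ 2 = (t - (ρ:ℂ).im) ^ 2 := by rw [Complex.sub_im, sl_im]; ring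
  rw [e] at h
  have : 0 < 1 + (t - (ρ:ℂ).im) ^ 2 := by positivity
  rw [norm_div, Complex.norm_ofNat, div_le_iff₀ (by linarith)]
  calc (2:ℝ) = 8/3 * (1 / (1 + (t - (ρ:ℂ).im) ^ 2)) * (3/4 * (1 + (t - (ρ:ℂ).im) ^ 2)) := by field_simp; norm_num
    _ ≤ _ := by gcongr

noncomputable def ZL (u t : ℝ) : ℂ := ∑' ρ : Zs, (mX ρ : ℂ) * fa ((ρ:ℂ) - sl t) u

lemma ZL_ok (t : ℝ) : LTok (fun u => ZL u t)
    (fun y => 2 / (1 - wv y ^ 2) * (logDeriv xiF (sl t + wv y) + logDeriv xiF (2 - sl t))) := by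
  obtain ⟨C, hC, h⟩ := sum_zero_t
  refine LTok.tsum (A := fun ρ : Zs => 8/3 * ((mX ρ : ℝ) * (1 / (1 + (t - (ρ:ℂ).im) ^ 2)))) (v := fun _ => 0)
    ((h t).1.mul_left _) (fun ρ => (fa_ok ?_ (one_sub_sq_ne (zs_re ρ t))).const_mul _) ?_ ?_
  · have := (abs_le.1 (zs_re ρ t)).2; linarith
  · intro ρ u
    rw [norm_mul, Complex.norm_natCast, mul_assoc]
    have h1 := fa_bound (abs_le.1 (zs_re ρ t)).2 u
    calc (mX ρ : ℝ) * (‖fa ((ρ:ℂ) - sl t) u‖ * Real.exp (-(3/4) * u))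
        ≤ (mX ρ : ℝ) * (8/3 * (1 / (1 + (t - (ρ:ℂ).im) ^ 2)) * Real.exp (-|u - 0| / 4)) := by
          refine mul_le_mul_of_nonneg_left (h1.trans ?_) (Nat.cast_nonneg _)
          exact mul_le_mul_of_nonneg_right (zs_coef_bound ρ t) (Real.exp_pos _).le
      _ = _ := by ring
  · intro y
    have h1 := xiF_pf_hasSum (z := sl t + wv y) (z' := sl t - 1) (fun ρ => ?_) (fun ρ => ?_)
    · have h2 : logDeriv xiF (sl t - 1) = - logDeriv xiF (2 - sl t) := by
        rw [← xiF_logDeriv_one_sub]; congr 1; ring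
      rw [h2, sub_neg_eq_add] at h1
      refine (h1.mul_left (2 / (1 - wv y ^ 2))).congr_fun fun ρ => ?_
      have e1 : sl t + wv y - ρ = wv y - (ρ - sl t) := by ring
      have e2 : sl t - 1 - (ρ:ℂ) = - (1 + (ρ - sl t)) := by ring
      rw [e1, e2, one_div (-_), inv_neg, one_div (1 + _)]
      ring
    · refine le_trans ?_ (Complex.re_le_norm _)
      obtain ⟨h0, h1⟩ := xiF_re_lt ρ.2
      rw [Complex.sub_re, Complex.add_re, sl_re, wv_re]; linarith
    · rw [← norm_neg]
      refine le_trans ?_ (Complex.re_le_norm _)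
      obtain ⟨h0, h1⟩ := xiF_re_lt ρ.2
      rw [Complex.neg_re, Complex.sub_re, Complex.sub_re, sl_re, Complex.one_re]; linarith

/-- trivial zeros -/
noncomputable def aT (t : ℝ) (k : ℕ) : ℂ := -(sl t + 2 * k + 2)

lemma aT_re (t : ℝ) (k : ℕ) : (aT t k).re = -(5/2 + 2 * k) := by
  simp [aT, sl_re]; ring

lemma aT_lower (t : ℝ) (k : ℕ) : ((k:ℝ) + 1) ^ 2 ≤ ‖1 - (aT t k) ^ 2‖ := by
  have e : 1 - aT t k ^ 2 = (1 - aT t k) * (1 + aT t k) := by ring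
  have hk : (0:ℝ) ≤ k := Nat.cast_nonneg k
  have h1 : (k:ℝ) + 1 ≤ ‖1 - aT t k‖ := le_trans (by rw [Complex.sub_re, aT_re, Complex.one_re]; linarith) (Complex.re_le_norm _)
  have h2 : (k:ℝ) + 1 ≤ ‖1 + aT t k‖ := by
    rw [← norm_neg]
    exact le_trans (by rw [Complex.neg_re, Complex.add_re, aT_re, Complex.one_re]; linarith) (Complex.re_le_norm _)
  rw [e, norm_mul, sq]
  gcongr

lemma aT_coef (t : ℝ) (k : ℕ) : ‖2 / (1 - aT t k ^ 2)‖ ≤ 2 * (1 / ((k:ℝ)+1)^2) := by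
  rw [norm_div, Complex.norm_ofNat, mul_one_div]
  have := aT_lower t k
  gcongr

lemma summ_sq : Summable (fun k : ℕ => 2 * (1 / ((k:ℝ)+1)^2)) := by
  have := (summable_nat_add_iff 1).2 (Real.summable_one_div_nat_pow.2 (one_lt_two : 1 < 2))
  refine (this.congr fun k => ?_).mul_left 2
  push_cast; rfl

noncomputable def TL (u t : ℝ) : ℂ := ∑' k : ℕ, fa (aT t k) u

lemma TL_ok (t : ℝ) : LTok (fun u => TL u t)
    (fun y => 2 / (1 - wv y ^ 2) * ((Complex.digamma ((sl t + 1)/2) - Complex.digamma ((sl t + wv y)/2 + 1)) / 2)) := by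
  refine LTok.tsum (A := fun k => 2 * (1 / ((k:ℝ)+1)^2)) (v := fun _ => 0) summ_sq (fun k => fa_ok ?_ ?_) ?_ ?_
  · rw [aT_re]; have : (0:ℝ) ≤ k := Nat.cast_nonneg k
    linarith
  · rw [← norm_pos_iff]; exact lt_of_lt_of_le (by positivity) (aT_lower t k)
  · intro k u
    refine (fa_bound ?_ u).trans ?_
    · rw [aT_re]; have : (0:ℝ) ≤ k := Nat.cast_nonneg k
      linarith
    · gcongr; exact aT_coef t k
  · intro y
    have h1 := digamma_hasSum (z := (sl t + 1)/2) (by simp [sl_re]; norm_num)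
    have h2 := digamma_hasSum (z := (sl t + wv y)/2 + 1) (by simp [sl_re, wv_re]; norm_num)
    have h3 := ((h1.sub h2).div_const 2).mul_left (2 / (1 - wv y ^ 2))
    rw [sub_sub_sub_cancel_right] at h3
    refine h3.congr_fun fun k => ?_
    have e1 : wv y - aT t k = 2 * ((sl t + wv y)/2 + 1 + k) := by simp only [aT]; ring
    have e2 : 1 + aT t k = -(2 * ((sl t + 1)/2 + k)) := by simp only [aT]; ring
    rw [e1, e2, one_div (-_), inv_neg, mul_inv, one_div (2 * _), mul_inv]
    simp only [one_div]
    ring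

open ArithmeticFunction in
noncomputable def PL (u t : ℝ) : ℂ := ∑' n : ℕ, LSeries.term (fun n => (vonMangoldt n : ℂ)) (sl t) n * kf (-1) 1 (u - Real.log n)

lemma term_split (f : ℕ → ℂ) (s w : ℂ) (n : ℕ) :
    LSeries.term f (s + w) n = LSeries.term f s n * Complex.exp (-w * Real.log n) := by
  rcases eq_or_ne n 0 with rfl | hn
  · simp
  · rw [LSeries.term_of_ne_zero hn, LSeries.term_of_ne_zero hn, Complex.cpow_add _ _ (by exact_mod_cast hn),
      Complex.cpow_def_of_ne_zero (by exact_mod_cast hn) w, neg_mul, Complex.exp_neg, Complex.natCast_log, mul_comm w]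
    field_simp

open ArithmeticFunction in
lemma PL_ok (t : ℝ) : LTok (fun u => PL u t)
    (fun y => 2 / (1 - wv y ^ 2) * (- logDeriv riemannZeta (sl t + wv y))) := by
  have hsum : ∀ z : ℂ, z.re = 5/4 → Summable (LSeries.term (fun n => (vonMangoldt n : ℂ)) z) := fun z hz =>
    LSeriesSummable_vonMangoldt (by rw [hz]; norm_num)
  refine LTok.tsum (A := fun n => ‖LSeries.term (fun n => (vonMangoldt n : ℂ)) (sl t + wv 0) n‖) (v := fun n => Real.log n)
    (hsum _ (by rw [Complex.add_re, sl_re, wv_re]; norm_num)).norm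
    (fun n => ((kf_ok (p := -1) (q := 1) (by norm_num) (by norm_num)).shift (Real.log n)).const_mul _) ?_ ?_
  · intro n u
    rw [term_split, norm_mul, norm_mul, mul_assoc, mul_assoc]
    refine mul_le_mul_of_nonneg_left ?_ (norm_nonneg _)
    have h1 := kf_bound (p := -1) (q := 1) (by norm_num) (by norm_num) (u - Real.log n)
    rw [sub_zero] at h1
    have h2 : ‖Complex.exp (-wv 0 * (Real.log n : ℝ))‖ = Real.exp (-(3/4) * Real.log n) := by
      rw [Complex.norm_exp]; congr 1
      rw [Complex.mul_re, Complex.neg_re, wv_re, Complex.ofReal_re, Complex.ofReal_im]; ring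
    rw [h2]
    calc ‖kf (-1) 1 (u - Real.log n)‖ * Real.exp (-(3/4) * u)
        = Real.exp (-(3/4) * Real.log n) * (‖kf (-1) 1 (u - Real.log n)‖ * Real.exp (-(3/4) * (u - Real.log n))) := by
          rw [mul_left_comm, ← Real.exp_add]; congr 2; ring
      _ ≤ _ := by gcongr
  · intro y
    have hre : (sl t + wv y).re = 5/4 := by rw [Complex.add_re, sl_re, wv_re]; norm_num
    have h1 := (hsum (sl t + wv y) hre).hasSum.mul_left (2 / (1 - wv y ^ 2))
    rw [zeta_logDeriv_eq (by rw [hre]; norm_num), neg_neg]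
    refine HasSum.congr_fun h1 fun n => ?_
    rw [term_split]
    have h2 : 1 - wv y ≠ 0 := fun h => by have := congrArg Complex.re h; simp [wv_re] at this; linarith
    have h3 : 1 + wv y ≠ 0 := fun h => by have := congrArg Complex.re h; simp [wv_re] at this; linarith
    have e2 : 1 - wv y ^ 2 = (1 - wv y) * (1 + wv y) := by ring
    have e3 : wv y - -1 = 1 + wv y := by ring
    rw [e2, e3]
    field_simp
    ring

lemma explicit (t u : ℝ) : ZL u t = - PL u t + fa (1 - sl t) u - TL u t +
    (logDeriv xiF (2 - sl t) - Real.log Real.pi / 2 + Complex.digamma ((sl t + 1)/2) / 2 - 1 / (2 - sl t)) * kf (-1) 1 u := by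
  have hre : (1 - sl t).re = 1/2 := by rw [Complex.sub_re, sl_re, Complex.one_re]; norm_num
  have h1 := (((PL_ok t).const_mul (-1)).add (fa_ok (a := 1 - sl t) (by rw [hre]; norm_num)
    (one_sub_sq_ne (by rw [hre]; norm_num)))).add ((TL_ok t).const_mul (-1))
  have h2 := h1.add ((kf_ok (p := -1) (q := 1) (by norm_num) (by norm_num)).const_mul
    (logDeriv xiF (2 - sl t) - Real.log Real.pi / 2 + Complex.digamma ((sl t + 1)/2) / 2 - 1 / (2 - sl t)))
  have h3 := (ZL_ok t).unique (h2.congr fun y => ?_)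
  · have := congrFun h3 u
    rw [this]; ring
  · rw [xiF_logDeriv (z := sl t + wv y) (by rw [Complex.add_re, sl_re, wv_re]; norm_num)]
    have h2 : 1 - wv y ≠ 0 := fun h => by have := congrArg Complex.re h; simp [wv_re] at this; linarith
    have h3 : 1 + wv y ≠ 0 := fun h => by have := congrArg Complex.re h; simp [wv_re] at this; linarith
    have e2 : 1 / (wv y - -1) + 1 / (1 - wv y) = 2 / (1 - wv y ^ 2) := by
      have e2 : 1 - wv y ^ 2 = (1 - wv y) * (1 + wv y) := by ring
      have e3 : wv y - -1 = 1 + wv y := by ring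
      rw [e2, e3]
      field_simp
      ring
    rw [e2]
    have e4 : wv y - (1 - sl t) = sl t + wv y - 1 := by ring
    have e5 : 1 + (1 - sl t) = 2 - sl t := by ring
    rw [e4, e5]
    ring

lemma log_near {z : ℂ} {T : ℝ} (hT : 0 < T) (h1 : T / 4 ≤ ‖z‖) (h2 : ‖z‖ ≤ 4 * T) :
    ‖Complex.log z - Real.log T‖ ≤ 2 + Real.pi := by
  have hz : 0 < ‖z‖ := by linarith
  have h := Complex.norm_le_abs_re_add_abs_im (Complex.log z - Real.log T)
  rw [Complex.sub_re, Complex.sub_im, Complex.log_re, Complex.log_im, Complex.ofReal_re, Complex.ofReal_im, sub_zero] at h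
  have h3 : |Real.log ‖z‖ - Real.log T| ≤ 2 := by
    have l4 : Real.log 4 ≤ 2 := by
      rw [show (4:ℝ) = 2 ^ 2 by norm_num, Real.log_pow]; push_cast; linarith [Real.log_two_lt_d9]
    have a1 := Real.log_le_log (by positivity) h1
    have a2 := Real.log_le_log hz h2
    rw [Real.log_div hT.ne' (by norm_num)] at a1
    rw [Real.log_mul (by norm_num) hT.ne'] at a2
    rw [abs_le]; constructor <;> linarith
  linarith [Complex.abs_arg_le_pi z]

lemma L_approx : ∃ C : ℝ, 0 < C ∧ ∀ T : ℝ, 4 ≤ T → ∀ t ∈ Icc T (2 * T), ∀ u ∈ Icc 0 (Real.log T),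
    ‖ZL u t + PL u t - Real.log T * Real.exp (-u)‖ ≤ C := by
  obtain ⟨C1, hC1, h1⟩ := xiF_logDeriv_bound
  obtain ⟨C2, hC20, h2⟩ := digamma_log
  set S2 := ∑' k : ℕ, 2 * (1 / ((k:ℝ)+1)^2) with hS2
  have hS20 : 0 ≤ S2 := tsum_nonneg fun k => by positivity
  refine ⟨3 + S2 + (C1 + (2 + Real.pi) + |Real.log Real.pi| + C2 + 1), by positivity, fun T hT t ht u hu => ?_⟩
  have hT0 : 0 < T := by linarith
  obtain ⟨ht1, ht2⟩ := ht
  obtain ⟨hu0, hu1⟩ := hu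
  have hexp : Real.exp u ≤ T := by
    rw [← Real.exp_log hT0]; exact Real.exp_le_exp.2 hu1
  have hk : kf (-1) 1 u = Real.exp (-u) := by
    unfold kf
    split_ifs with h
    · have : u = 0 := le_antisymm h hu0
      simp [this]
    · push_cast; congr 1; ring
  rw [explicit, hk]
  set κ := logDeriv xiF (2 - sl t) - Real.log Real.pi / 2 + Complex.digamma ((sl t + 1)/2) / 2 - 1 / (2 - sl t) with hκ
  have e : -PL u t + fa (1 - sl t) u - TL u t + κ * Real.exp (-u) + PL u t - Real.log T * Real.exp (-u)
    = fa (1 - sl t) u - TL u t + (κ - Real.log T) * Real.exp (-u) := by push_cast; ring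
  rw [e]
  have b1 : ‖fa (1 - sl t) u‖ ≤ 3 := by
    have hre : (1 - sl t).re = 1/2 := by rw [Complex.sub_re, sl_re, Complex.one_re]; norm_num
    have him : (1 - sl t).im = -t := by rw [Complex.sub_im, sl_im, Complex.one_im]; ring
    have hl := one_sub_sq_lower (a := 1 - sl t) (by rw [hre]; norm_num)
    rw [him] at hl
    unfold fa
    rw [norm_mul, norm_div, Complex.norm_ofNat]
    have hkk := kf_norm_le (p := 1 - sl t) (q := 1) hu0
    have : Real.exp ((1 - sl t).re * u) ≤ T := le_trans (Real.exp_le_exp.2 (by rw [hre]; linarith)) hexp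
    have hpos : 0 < 3 / 4 * (1 + (-t)^2) := by positivity
    rw [div_mul_eq_mul_div, div_le_iff₀ (by linarith)]
    nlinarith
  have b2 : ‖TL u t‖ ≤ S2 := by
    unfold TL
    refine tsum_of_norm_bounded summ_sq.hasSum fun k => ?_
    unfold fa
    rw [norm_mul]
    have hkk := kf_norm_le (p := aT t k) (q := 1) hu0
    have : Real.exp ((aT t k).re * u) ≤ 1 := by
      rw [Real.exp_le_one_iff, aT_re]
      have : (0:ℝ) ≤ k := Nat.cast_nonneg k
      nlinarith
    exact (mul_le_of_le_one_right (norm_nonneg _) (hkk.trans this)).trans (aT_coef t k)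
  have b3 : ‖κ - Real.log T‖ ≤ C1 + (2 + Real.pi) + |Real.log Real.pi| + C2 + 1 := by
    have r1 : (2 - sl t).re = 3/2 := by rw [Complex.sub_re, sl_re]; norm_num
    have a1 := h1 (2 - sl t) (by rw [r1]; norm_num)
    have a2 := h2 ((sl t + 1)/2) (by simp [sl_re]; norm_num)
    have a3 : ‖Complex.log ((2 - sl t)/2 + 1) - Real.log T‖ ≤ 2 + Real.pi := by
      refine log_near hT0 ?_ ?_
      · refine le_trans ?_ (Complex.abs_im_le_norm _)
        have : ((2 - sl t)/2 + 1).im = -t/2 := by simp [sl_im]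
        rw [this, abs_div, abs_neg, abs_of_nonneg (by linarith), abs_two]; linarith
      · refine (Complex.norm_le_abs_re_add_abs_im _).trans ?_
        have i1 : ((2 - sl t)/2 + 1).im = -t/2 := by simp [sl_im]
        have i2 : ((2 - sl t)/2 + 1).re = 7/4 := by simp [sl_re]; norm_num
        rw [i1, i2, abs_div (-t), abs_neg, abs_of_nonneg (by linarith : 0 ≤ t), abs_two, abs_of_nonneg (by norm_num)]; linarith
    have a4 : ‖Complex.log ((sl t + 1)/2) - Real.log T‖ ≤ 2 + Real.pi := by
      have i1 : ((sl t + 1)/2).im = t/2 := by simp [sl_im]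
      have i2 : ((sl t + 1)/2).re = 3/4 := by simp [sl_re]; norm_num
      refine log_near hT0 ?_ ?_
      · refine le_trans ?_ (Complex.abs_im_le_norm _)
        rw [i1, abs_div, abs_of_nonneg (by linarith), abs_two]; linarith
      · refine (Complex.norm_le_abs_re_add_abs_im _).trans ?_
        rw [i1, i2, abs_div t, abs_of_nonneg (by linarith : 0 ≤ t), abs_two, abs_of_nonneg (by norm_num)]; linarith
    have a5 : ‖1 / (2 - sl t)‖ ≤ 1 := by
      rw [norm_div, norm_one]
      have : 1 ≤ ‖2 - sl t‖ := le_trans (by rw [r1]; norm_num) (Complex.re_le_norm _)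
      rw [div_le_iff₀ (by linarith)]; linarith
    have a6 : ‖(Real.log Real.pi / 2 : ℂ)‖ ≤ |Real.log Real.pi| := by
      rw [norm_div, Complex.norm_real, Real.norm_eq_abs]
      simp
    have e2 : κ - Real.log T = (logDeriv xiF (2 - sl t) - Complex.log ((2 - sl t)/2+1)/2)
       + ((Complex.log ((2 - sl t)/2 + 1) - Real.log T) + (Complex.log ((sl t + 1)/2) - Real.log T)) / 2
       - Real.log Real.pi / 2 + (Complex.digamma ((sl t + 1)/2) - Complex.log ((sl t + 1)/2)) / 2 - 1 / (2 - sl t) := by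
      rw [hκ]; ring
    rw [e2]
    have a7 : ‖((Complex.log ((2 - sl t)/2 + 1) - Real.log T) + (Complex.log ((sl t + 1)/2) - Real.log T)) / 2‖ ≤ 2 + Real.pi := by
      rw [norm_div, Complex.norm_ofNat]
      have := norm_add_le (Complex.log ((2 - sl t)/2 + 1) - Real.log T) (Complex.log ((sl t + 1)/2) - Real.log T)
      linarith
    have a8 : ‖(Complex.digamma ((sl t + 1)/2) - Complex.log ((sl t + 1)/2)) / 2‖ ≤ C2 := by
      rw [norm_div, Complex.norm_ofNat]; linarith
    refine (norm_sub_le _ _).trans (add_le_add ((norm_add_le _ _).trans (add_le_add ((norm_sub_le _ _).trans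
      (add_le_add ((norm_add_le _ _).trans (add_le_add a1 a7)) a6)) a8)) a5)
  have b4 : ‖(κ - Real.log T) * (Real.exp (-u) : ℂ)‖ ≤ C1 + (2 + Real.pi) + |Real.log Real.pi| + C2 + 1 := by
    rw [norm_mul, Complex.norm_real, Real.norm_of_nonneg (Real.exp_pos _).le]
    refine (mul_le_of_le_one_right (norm_nonneg _) ?_).trans b3
    rw [Real.exp_le_one_iff]; linarith
  exact (norm_add_le _ _).trans (add_le_add ((norm_sub_le _ _).trans (add_le_add b1 b2)) b4)

lemma kf_int {p q : ℂ} (hp : p.re < 0) (hq : 0 < q.re) :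
    Continuous (kf p q) ∧ Integrable (kf p q) ∧ ∫ u, kf p q u = 1 / q - 1 / p := by
  have h := kf_ok (p := p + wv 0) (q := q + wv 0) (by rw [Complex.add_re, wv_re]; linarith)
    (by rw [Complex.add_re, wv_re]; linarith)
  have e : ∀ u : ℝ, kf (p + wv 0) (q + wv 0) u * Complex.exp (-(wv 0) * u) = kf p q u := by
    intro u
    unfold kf
    split_ifs <;> rw [← Complex.exp_add] <;> congr 1 <;> ring
  have h1 := h.integ 0
  have h2 := h.eq 0
  simp only [e] at h1 h2
  refine ⟨?_, h1, ?_⟩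
  · have : Continuous fun u : ℝ => kf (p + wv 0) (q + wv 0) u * Complex.exp (-(wv 0) * u) := h.cont.mul (by fun_prop)
    simpa only [e] using this
  · rw [h2]
    rw [show wv 0 - (p + wv 0) = -p by ring, show q + wv 0 - wv 0 = q by ring, one_div (-p), inv_neg]
    ring

lemma fourier_kf {x : ℂ} (hx : |x.re| ≤ 1/2) (ξ : ℝ) :
    FourierTransform.fourier (kf (x-1) (x+1)) ξ = 2 / (1 - (x - (2 * Real.pi * ξ : ℝ) * Complex.I) ^ 2) := by
  rw [Real.fourier_real_eq_integral_exp_smul]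
  set X := x - (2 * Real.pi * ξ : ℝ) * Complex.I with hX
  have hXr : X.re = x.re := by simp [hX]
  have e : ∀ v : ℝ, Complex.exp (((-2 * Real.pi * v * ξ : ℝ) : ℂ) * Complex.I) • kf (x-1) (x+1) v = kf (X-1) (X+1) v := by
    intro v
    unfold kf
    split_ifs <;> rw [smul_eq_mul, ← Complex.exp_add] <;> congr 1 <;> rw [hX] <;> push_cast <;> ring
  simp only [e]
  have hb := abs_le.1 hx
  rw [(kf_int (p := X-1) (q := X+1) (by simp [hXr]; linarith) (by simp [hXr]; linarith)).2.2]
  have h1 : X - 1 ≠ 0 := fun h => by have := congrArg Complex.re h; simp [hXr] at this; linarith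
  have h2 : X + 1 ≠ 0 := fun h => by have := congrArg Complex.re h; simp [hXr] at this; linarith
  have h3 : 1 - X ^ 2 = -((X - 1) * (X + 1)) := by ring
  rw [h3]
  field_simp
  ring

lemma fourierInv_kf {x : ℂ} (hx : |x.re| ≤ 1/2) (ξ : ℝ) :
    FourierTransformInv.fourierInv (kf (x-1) (x+1)) ξ = 2 / (1 - (x + (2 * Real.pi * ξ : ℝ) * Complex.I) ^ 2) := by
  rw [Real.fourierInv_eq_fourier_neg, fourier_kf hx]
  congr 3; push_cast; ring

lemma integrable_kern {x : ℂ} (hx : |x.re| ≤ 1/2) :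
    Continuous (fun t : ℝ => 2 / (1 - (x + t * Complex.I) ^ 2)) ∧ Integrable (fun t : ℝ => 2 / (1 - (x + t * Complex.I) ^ 2)) ∧
    ∀ t : ℝ, ‖2 / (1 - (x + t * Complex.I) ^ 2)‖ ≤ 8/3 * (1 + (x.im + t)^2)⁻¹ := by
  have hre : ∀ t : ℝ, (x + t * Complex.I).re = x.re := fun t => by simp
  have him : ∀ t : ℝ, (x + t * Complex.I).im = x.im + t := fun t => by simp
  have hne : ∀ t : ℝ, 1 - (x + t * Complex.I) ^ 2 ≠ 0 := fun t => one_sub_sq_ne (by rw [hre]; exact hx)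
  have hc : Continuous (fun t : ℝ => 2 / (1 - (x + t * Complex.I) ^ 2)) :=
    Continuous.div continuous_const (by fun_prop) hne
  have hb : ∀ t : ℝ, ‖2 / (1 - (x + t * Complex.I) ^ 2)‖ ≤ 8/3 * (1 + (x.im + t)^2)⁻¹ := by
    intro t
    have h := one_sub_sq_lower (a := x + t * Complex.I) (by rw [hre]; exact hx)
    rw [him] at h
    have hp : 0 < 1 + (x.im + t)^2 := by positivity
    rw [norm_div, Complex.norm_ofNat, div_le_iff₀ (by linarith)]
    calc (2:ℝ) = 8/3 * (1 + (x.im + t)^2)⁻¹ * (3/4 * (1 + (x.im + t)^2)) := by field_simp; norm_num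
      _ ≤ _ := by gcongr
  refine ⟨hc, ?_, hb⟩
  have h2 : Integrable fun t : ℝ => 8/3 * (1 + (x.im + t)^2)⁻¹ :=
    (integrable_inv_one_add_sq.comp_add_left x.im).const_mul _
  exact h2.mono' hc.aestronglyMeasurable (ae_of_all _ hb)

lemma plancherel {x y : ℂ} (hx : |x.re| ≤ 1/2) (hy : |y.re| ≤ 1/2) :
    ∫ t : ℝ, 2 / (1 - (x - t * Complex.I) ^ 2) * (2 / (1 - (y + t * Complex.I) ^ 2)) = 2 * Real.pi * (4 / (4 - (x + y)^2)) := by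
  have hbx := abs_le.1 hx
  have hby := abs_le.1 hy
  have kx := kf_int (p := x-1) (q := x+1) (by simp; linarith) (by simp; linarith)
  have ky := kf_int (p := y-1) (q := y+1) (by simp; linarith) (by simp; linarith)
  have hG : Integrable (FourierTransformInv.fourierInv (kf (y-1) (y+1)) : ℝ → ℂ) := by
    have := (integrable_kern hy).2.1.comp_mul_left' (R := 2 * Real.pi) (by positivity)
    refine this.congr (ae_of_all _ fun ξ => ?_)
    simp only [fourierInv_kf hy]
  have hF : Integrable (FourierTransform.fourier (kf (y-1) (y+1)) : ℝ → ℂ) := by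
    have := hG.comp_neg
    refine this.congr (ae_of_all _ fun ξ => ?_)
    simp only [Real.fourierInv_eq_fourier_neg, neg_neg]
  have hflip : ∫ ξ : ℝ, FourierTransform.fourier (kf (x-1) (x+1)) ξ * FourierTransformInv.fourierInv (kf (y-1) (y+1)) ξ
      = ∫ v : ℝ, kf (x-1) (x+1) v * kf (y-1) (y+1) v := by
    have h := VectorFourier.integral_fourierIntegral_smul_eq_flip (L := innerₗ ℝ) (μ := volume) (ν := volume)
      (f := kf (x-1) (x+1)) (g := FourierTransformInv.fourierInv (kf (y-1) (y+1))) Real.continuous_fourierChar continuous_inner kx.2.1 hG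
    rw [flip_innerₗ] at h
    have h2 : ∀ v : ℝ, VectorFourier.fourierIntegral Real.fourierChar volume (innerₗ ℝ) (FourierTransformInv.fourierInv (kf (y-1) (y+1))) v
       = kf (y-1) (y+1) v := fun v => congrFun (ky.1.fourier_fourierInv_eq ky.2.1 hF) v
    simp only [h2, smul_eq_mul] at h
    exact h
  have hprod : ∀ v : ℝ, kf (x-1) (x+1) v * kf (y-1) (y+1) v = kf (x + y - 2) (x + y + 2) v := by
    intro v
    unfold kf
    split_ifs <;> rw [← Complex.exp_add] <;> congr 1 <;> ring
  simp only [hprod] at hflip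
  rw [(kf_int (p := x+y-2) (q := x+y+2) (by simp; linarith) (by simp; linarith)).2.2] at hflip
  simp only [fourier_kf hx, fourierInv_kf hy] at hflip
  have hs := Measure.integral_comp_mul_left (fun t : ℝ => 2 / (1 - (x - t * Complex.I) ^ 2) * (2 / (1 - (y + t * Complex.I) ^ 2))) (2 * Real.pi)
  rw [hs, abs_of_pos (by positivity), Complex.real_smul] at hflip
  have h1 : x + y - 2 ≠ 0 := fun h => by have := congrArg Complex.re h; simp at this; linarith
  have h2 : x + y + 2 ≠ 0 := fun h => by have := congrArg Complex.re h; simp at this; linarith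
  have h3 : 4 - (x + y) ^ 2 = -((x + y - 2) * (x + y + 2)) := by ring
  have h4 : (4:ℂ) / (4 - (x + y) ^ 2) = 1 / (x + y + 2) - 1 / (x + y - 2) := by
    rw [h3]; field_simp; ring
  rw [h4, ← hflip]
  have hpi : (Real.pi : ℂ) ≠ 0 := by exact_mod_cast Real.pi_ne_zero
  rw [← mul_assoc]
  have e : (2:ℂ) * Real.pi * (((2 * Real.pi)⁻¹ : ℝ) : ℂ) = 1 := by
    push_cast; field_simp
  rw [e, one_mul]

lemma plancherel_integrable {x y : ℂ} (hx : |x.re| ≤ 1/2) (hy : |y.re| ≤ 1/2) :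
    Integrable fun t : ℝ => 2 / (1 - (x - t * Complex.I) ^ 2) * (2 / (1 - (y + t * Complex.I) ^ 2)) := by
  have h1 := (integrable_kern hx).2.1.comp_neg
  have h1' : Integrable fun t : ℝ => 2 / (1 - (x - t * Complex.I) ^ 2) := by
    refine h1.congr (ae_of_all _ fun t => ?_)
    simp only; push_cast; congr 3; ring
  refine h1'.mul_bdd (c := 8/3) (integrable_kern hy).1.aestronglyMeasurable (ae_of_all _ fun t => ?_)
  refine ((integrable_kern hy).2.2 t).trans ?_
  have : (1 + (y.im + t)^2)⁻¹ ≤ 1 := inv_le_one_of_one_le₀ (by nlinarith [sq_nonneg (y.im + t)])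
  linarith

lemma band_finite (T : ℝ) : (zeroBand T).Finite := by
  refine (xiF_zeros_finite (1 + 2 * |T|)).subset fun ρ hρ => ?_
  obtain ⟨h, h1, h2⟩ := hρ
  refine ⟨xiF_zero_iff.2 h, (Complex.norm_le_abs_re_add_abs_im _).trans ?_⟩
  have a1 : |ρ.re| ≤ 1 := abs_le.2 ⟨by linarith [h.2.1], by linarith [h.2.2]⟩
  have a2 : |ρ.im| ≤ 2 * |T| := by
    have := neg_abs_le T
    have := le_abs_self T
    rw [abs_le]; constructor <;> linarith [abs_nonneg T]
  linarith

noncomputable def BF (T : ℝ) : Finset ℂ := (band_finite T).toFinset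

lemma mem_BF {T : ℝ} {ρ : ℂ} : ρ ∈ BF T ↔ xiF ρ = 0 ∧ T < ρ.im ∧ ρ.im ≤ 2 * T := by
  simp [BF, zeroBand, xiF_zero_iff]

noncomputable def LB (T u t : ℝ) : ℂ := ∑ ρ ∈ BF T, (mX ρ : ℂ) * fa (ρ - sl t) u

noncomputable def NB (T u : ℝ) : ℝ := ∫ t : ℝ, ‖LB T u t‖ ^ 2

noncomputable def QB (T u : ℝ) : ℂ := ∑ ρ ∈ BF T, ∑ ρ' ∈ BF T, (mX ρ : ℂ) * (mX ρ' : ℂ) *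
  Complex.exp ((ρ - ρ') * u) * Wweight (ρ - ρ')

lemma fa_eq {a : ℂ} {u : ℝ} (hu : 0 ≤ u) : fa a u = 2 / (1 - a^2) * Complex.exp (a * u) := by
  unfold fa kf
  split_ifs with h
  · have : u = 0 := le_antisymm h hu
    simp [this]
  · rfl

open ComplexConjugate in
lemma QB_symm (T u : ℝ) : QB T u = ∑ ρ ∈ BF T, ∑ ρ' ∈ BF T, (mX ρ : ℂ) * (mX ρ' : ℂ) *
  Complex.exp ((ρ + conj ρ' - 1) * u) * Wweight (ρ + conj ρ' - 1) := by
  unfold QB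
  refine Finset.sum_congr rfl fun ρ _ => ?_
  refine Finset.sum_nbij' (fun z => 1 - conj z) (fun z => 1 - conj z) ?_ ?_ ?_ ?_ ?_
  · intro z hz
    rw [mem_BF] at hz ⊢
    exact ⟨xiF_refl_zero hz.1, by simpa using hz.2⟩
  · intro z hz
    rw [mem_BF] at hz ⊢
    exact ⟨xiF_refl_zero hz.1, by simpa using hz.2⟩
  · intro z _; simp
  · intro z _; simp
  · intro z _
    rw [mX_refl]
    have : ρ + conj (1 - conj z) - 1 = ρ - z := by simp; ring
    rw [this]

open ComplexConjugate in
lemma NB_eq {T u : ℝ} (hu : 0 ≤ u) : ((NB T u : ℝ) : ℂ) = 2 * Real.pi * QB T u ∧ Integrable (fun t => ‖LB T u t‖ ^ 2) := by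
  have hr : ∀ ρ ∈ BF T, |(ρ - 1/2).re| ≤ 1/2 := fun ρ hρ => by
    obtain ⟨h0, h1⟩ := xiF_re_lt (mem_BF.1 hρ).1
    have : (ρ - 1/2).re = ρ.re - 1/2 := by simp
    rw [this, abs_le]; constructor <;> linarith
  have hr' : ∀ ρ ∈ BF T, |(conj ρ - 1/2).re| ≤ 1/2 := fun ρ hρ => by
    have := hr ρ hρ
    simpa using this
  set K : ℂ → ℂ → ℝ → ℂ := fun ρ ρ' t => 2 / (1 - ((ρ - 1/2) - t * Complex.I) ^ 2) * (2 / (1 - ((conj ρ' - 1/2) + t * Complex.I) ^ 2)) with hK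
  have hpt : ∀ t : ℝ, ((‖LB T u t‖ ^ 2 : ℝ) : ℂ) = ∑ ρ ∈ BF T, ∑ ρ' ∈ BF T, (mX ρ : ℂ) * (mX ρ' : ℂ) *
      Complex.exp ((ρ + conj ρ' - 1) * u) * K ρ ρ' t := by
    intro t
    push_cast
    rw [← Complex.mul_conj']
    unfold LB
    rw [map_sum, Finset.sum_mul_sum]
    refine Finset.sum_congr rfl fun ρ _ => Finset.sum_congr rfl fun ρ' _ => ?_
    rw [fa_eq hu, fa_eq hu]
    simp only [map_mul, map_div₀, map_sub, map_pow, map_one, ← Complex.exp_conj, Complex.conj_ofReal, map_natCast, hK, map_ofNat]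
    have e1 : conj (sl t) = 1/2 - t * Complex.I := by simp [sl, map_ofNat]; ring
    rw [e1]
    have e2 : Complex.exp ((ρ + conj ρ' - 1) * u) = Complex.exp ((ρ - sl t) * u) * Complex.exp ((conj ρ' - (1/2 - t * Complex.I)) * u) := by
      rw [← Complex.exp_add]; congr 1; simp only [sl]; ring
    have e3 : ρ - 1/2 - t * Complex.I = ρ - sl t := by simp only [sl]; ring
    have e4 : conj ρ' - 1/2 + t * Complex.I = conj ρ' - (1/2 - t * Complex.I) := by ring
    rw [e2, e3, e4]
    ring
  have hint : ∀ ρ ∈ BF T, ∀ ρ' ∈ BF T, Integrable (fun t : ℝ => (mX ρ : ℂ) * (mX ρ' : ℂ) *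
      Complex.exp ((ρ + conj ρ' - 1) * u) * K ρ ρ' t) := fun ρ hρ ρ' hρ' =>
    (plancherel_integrable (hr ρ hρ) (hr' ρ' hρ')).const_mul _
  have hI : Integrable (fun t : ℝ => ((‖LB T u t‖ ^ 2 : ℝ) : ℂ)) := by
    simp only [hpt]
    exact integrable_finsetSum _ fun ρ hρ => integrable_finsetSum _ fun ρ' hρ' => hint ρ hρ ρ' hρ'
  refine ⟨?_, hI.re⟩
  unfold NB
  rw [← integral_complex_ofReal]
  simp only [hpt]
  rw [integral_finsetSum _ fun ρ hρ => integrable_finsetSum _ fun ρ' hρ' => hint ρ hρ ρ' hρ', QB_symm, Finset.mul_sum]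
  refine Finset.sum_congr rfl fun ρ hρ => ?_
  rw [integral_finsetSum _ fun ρ' hρ' => hint ρ hρ ρ' hρ', Finset.mul_sum]
  refine Finset.sum_congr rfl fun ρ' hρ' => ?_
  rw [integral_const_mul, plancherel (hr ρ hρ) (hr' ρ' hρ')]
  have e5 : ρ - 1/2 + (conj ρ' - 1/2) = ρ + conj ρ' - 1 := by ring
  rw [e5, Wweight]
  ring

noncomputable def gb (b α : ℝ) : ℝ := (1 - α) / Real.cosh (b * α)

lemma gb_cont (b : ℝ) : Continuous (gb b) := by
  unfold gb
  exact Continuous.div (by fun_prop) (by fun_prop) fun α => (Real.cosh_pos _).ne'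

lemma QB_cont (T : ℝ) : Continuous (QB T) := by unfold QB; fun_prop

lemma QB_even (T u : ℝ) : QB T (-u) = QB T u := by
  unfold QB
  rw [Finset.sum_comm]
  refine Finset.sum_congr rfl fun ρ _ => Finset.sum_congr rfl fun ρ' _ => ?_
  have e1 : (ρ' - ρ) * ((-u : ℝ) : ℂ) = (ρ - ρ') * u := by push_cast; ring
  have e2 : Wweight (ρ' - ρ) = Wweight (ρ - ρ') := by unfold Wweight; congr 2; ring
  rw [e1, e2]; ring

lemma NB_cont (T : ℝ) : ContinuousOn (NB T) (Ici 0) := by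
  have h : ContinuousOn (fun u => (2 * Real.pi * QB T u).re) (Ici 0) :=
    (Complex.continuous_re.comp (continuous_const.mul (QB_cont T))).continuousOn
  refine h.congr fun u hu => ?_
  show NB T u = (2 * Real.pi * QB T u : ℂ).re
  rw [← (NB_eq hu).1, Complex.ofReal_re]

lemma S_eq (b T : ℝ) (hT : 1 ≤ T) : (∑ᶠ ρ ∈ zeroBand T, ∑ᶠ ρ' ∈ zeroBand T,
        (zetaMult ρ : ℂ) * (zetaMult ρ' : ℂ) *
          Kb b (-Complex.I * (ρ - ρ') * Real.log T) * Wweight (ρ - ρ'))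
      = (((1 / (2 * Real.pi ^ 2)) * ∫ α in (0:ℝ)..1, gb b α * NB T (α * Real.log T) : ℝ) : ℂ) := by
  set L := Real.log T with hL
  have hL0 : 0 ≤ L := Real.log_nonneg hT
  set G : ℝ → ℂ := fun α => ((jF α / Real.cosh (b * α) : ℝ) : ℂ) with hG
  have hGc : Continuous G := by
    have : Continuous fun α : ℝ => jF α / Real.cosh (b * α) :=
      Continuous.div (by unfold jF; fun_prop) (by fun_prop) fun α => (Real.cosh_pos _).ne'
    exact Complex.continuous_ofReal.comp this
  have hin : ∀ ρ : ℂ, ∑ᶠ ρ' ∈ zeroBand T,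
        (zetaMult ρ : ℂ) * (zetaMult ρ' : ℂ) *
          Kb b (-Complex.I * (ρ - ρ') * L) * Wweight (ρ - ρ') = ∑ ρ' ∈ BF T, (zetaMult ρ : ℂ) * (zetaMult ρ' : ℂ) *
          Kb b (-Complex.I * (ρ - ρ') * L) * Wweight (ρ - ρ') := fun ρ => finsum_mem_eq_finite_toFinset_sum _ (band_finite T)
  simp only [hin]
  rw [finsum_mem_eq_finite_toFinset_sum _ (band_finite T)]
  have hm : ∀ ρ ∈ BF T, zetaMult ρ = mX ρ := fun ρ hρ => mX_eq (xiF_zero_iff.1 (mem_BF.1 hρ).1)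
  have hK : ∀ z : ℂ, Kb b (-Complex.I * z * L) = (1 / (2 * Real.pi)) * ∫ α in (-1 : ℝ)..1, G α * Complex.exp (z * ((α * L : ℝ) : ℂ)) := by
    intro z
    unfold Kb
    congr 1
    refine intervalIntegral.integral_congr fun α _ => ?_
    simp only [hG]
    congr 2
    push_cast
    linear_combination (-z * L * α) * Complex.I_mul_I
  have h1 : ∑ ρ ∈ (band_finite T).toFinset, ∑ ρ' ∈ BF T, (zetaMult ρ : ℂ) * (zetaMult ρ' : ℂ) *
          Kb b (-Complex.I * (ρ - ρ') * L) * Wweight (ρ - ρ') = (1 / (2 * Real.pi)) * ∫ α in (-1 : ℝ)..1, G α * QB T (α * L) := by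
    have e : ∀ α : ℝ, G α * QB T (α * L) = ∑ ρ ∈ BF T, ∑ ρ' ∈ BF T, ((mX ρ : ℂ) * (mX ρ' : ℂ) * Wweight (ρ - ρ')) *
        (G α * Complex.exp ((ρ - ρ') * ((α * L : ℝ) : ℂ))) := by
      intro α
      unfold QB
      rw [Finset.mul_sum]
      refine Finset.sum_congr rfl fun ρ _ => ?_
      rw [Finset.mul_sum]
      exact Finset.sum_congr rfl fun ρ' _ => by ring
    have hii : ∀ z : ℂ, ∀ c : ℂ, IntervalIntegrable (fun α : ℝ => c * (G α * Complex.exp (z * ((α * L : ℝ) : ℂ)))) volume (-1) 1 :=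
      fun z c => Continuous.intervalIntegrable (by fun_prop) _ _
    simp only [e]
    rw [intervalIntegral.integral_finsetSum (fun ρ _ => Continuous.intervalIntegrable (by fun_prop) _ _), Finset.mul_sum]
    refine Finset.sum_congr rfl fun ρ hρ => ?_
    rw [intervalIntegral.integral_finsetSum (fun ρ' _ => hii _ _), Finset.mul_sum]
    refine Finset.sum_congr rfl fun ρ' hρ' => ?_
    rw [intervalIntegral.integral_const_mul, hK, hm ρ hρ, hm ρ' hρ']
    ring
  rw [h1]
  have hi : ∀ a c : ℝ, IntervalIntegrable (fun α : ℝ => G α * QB T (α * L)) volume a c := fun a c =>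
    Continuous.intervalIntegrable (hGc.mul ((QB_cont T).comp (by fun_prop))) _ _
  have h2 : ∫ α in (-1 : ℝ)..1, G α * QB T (α * L) = 2 * ∫ α in (0 : ℝ)..1, G α * QB T (α * L) := by
    rw [← intervalIntegral.integral_add_adjacent_intervals (hi (-1) 0) (hi 0 1)]
    have := intervalIntegral.integral_comp_neg (a := 0) (b := 1) (fun α : ℝ => G α * QB T (α * L))
    rw [neg_zero] at this
    rw [← this, two_mul]
    congr 1
    refine intervalIntegral.integral_congr fun α _ => ?_
    simp only [hG, jF, abs_neg, mul_neg, Real.cosh_neg, neg_mul, QB_even]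
  have h3 : ∫ α in (0 : ℝ)..1, G α * QB T (α * L) = ∫ α in (0 : ℝ)..1, ((1 / (2 * Real.pi) * (gb b α * NB T (α * L)) : ℝ) : ℂ) := by
    refine intervalIntegral.integral_congr fun α hα => ?_
    rw [uIcc_of_le zero_le_one] at hα
    have h4 := (NB_eq (T := T) (u := α * L) (mul_nonneg hα.1 hL0)).1
    push_cast
    rw [h4]
    have h5 : G α = (gb b α : ℂ) := by
      simp only [hG, gb, jF]
      rw [abs_of_nonneg hα.1, max_eq_left (by linarith [hα.2])]
    rw [h5]
    have hpi : (Real.pi : ℂ) ≠ 0 := by exact_mod_cast Real.pi_ne_zero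
    field_simp
  rw [h2, h3, intervalIntegral.integral_ofReal, intervalIntegral.integral_const_mul]
  generalize (∫ α in (0:ℝ)..1, gb b α * NB T (α*L)) = J
  push_cast
  have hpi : (Real.pi : ℂ) ≠ 0 := by exact_mod_cast Real.pi_ne_zero
  field_simp

open ArithmeticFunction (vonMangoldt)

lemma dyad (f w : ℕ → ℝ) (hf : ∀ n, 0 ≤ f n) (N : ℕ → ℕ) (hN : Monotone N) (c0 c : ℝ)
    (h0 : ∑ n ∈ Finset.Ioc 0 (N 0), f n * w n ≤ c0)
    (hK : ∀ K, ∃ wk, 0 ≤ wk ∧ (∀ n, N K < n → w n ≤ wk) ∧ wk * ∑ n ∈ Finset.Ioc 0 (N (K+1)), f n ≤ c * (1/2)^K) (K : ℕ) :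
    ∑ n ∈ Finset.Ioc 0 (N K), f n * w n ≤ c0 + 2 * c - 2 * c * (1/2)^K := by
  induction K with
  | zero => simpa using h0
  | succ K ih =>
    obtain ⟨wk, hw0, hw, hb⟩ := hK K
    rw [← Finset.sum_Ioc_consecutive _ (Nat.zero_le _) (hN (Nat.le_succ K))]
    have h1 : ∑ n ∈ Finset.Ioc (N K) (N (K+1)), f n * w n ≤ wk * ∑ n ∈ Finset.Ioc 0 (N (K+1)), f n := by
      rw [Finset.mul_sum]
      calc _ ≤ ∑ n ∈ Finset.Ioc (N K) (N (K+1)), wk * f n := by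
            refine Finset.sum_le_sum fun n hn => ?_
            rw [mul_comm]
            exact mul_le_mul_of_nonneg_right (hw n (Finset.mem_Ioc.1 hn).1) (hf n)
        _ ≤ _ := by
            refine Finset.sum_le_sum_of_subset_of_nonneg (Finset.Ioc_subset_Ioc_left (Nat.zero_le _)) fun n _ _ => mul_nonneg hw0 (hf n)
    have : (1/2 : ℝ)^(K+1) = (1/2)^K * (1/2) := pow_succ _ _
    rw [this]
    change _ + ∑ n ∈ Finset.Ioc (N K) (N (K+1)), f n * w n ≤ _
    linarith

/-- Chebyshev-type weighted sum. -/
lemma cheb_H : ∃ C > 0, ∀ u : ℝ, 0 ≤ u → ∀ N : ℕ,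
    ∑ n ∈ Finset.range N, vonMangoldt n * Real.exp (-(3/2) * max 0 (Real.log n - u)) ≤ C * Real.exp u := by
  set c := Real.log 4 + 4 with hc
  have hc0 : 0 < c := by have := Real.log_pos (show (1:ℝ) < 4 by norm_num); linarith
  refine ⟨9 * c, by positivity, fun u hu N => ?_⟩
  have hpsi : ∀ x : ℝ, 0 ≤ x → ∑ n ∈ Finset.Ioc 0 ⌊x⌋₊, vonMangoldt n ≤ c * x := fun x hx => Chebyshev.psi_le_const_mul_self hx
  have hf : ∀ n, 0 ≤ vonMangoldt n := fun n => ArithmeticFunction.vonMangoldt_nonneg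
  have key := dyad (fun n => vonMangoldt n) (fun n => Real.exp (-(3/2) * max 0 (Real.log n - u))) hf
    (fun K => ⌊4^K * Real.exp u⌋₊) (fun a b hab => Nat.floor_mono (by gcongr; norm_num)) (c * Real.exp u) (4 * c * Real.exp u)
    (by
      refine le_trans (Finset.sum_le_sum fun n _ => ?_) (hpsi (4^0 * Real.exp u) (by positivity) |>.trans (by simp))
      refine mul_le_of_le_one_right (hf n) ?_
      rw [Real.exp_le_one_iff]
      have := le_max_left 0 (Real.log n - u); linarith)
    (fun K => by
      refine ⟨(1/8)^K, by positivity, fun n hn => ?_, ?_⟩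
      · have h1 := (Nat.floor_lt (by positivity)).1 hn
        have hl : K * Real.log 4 + u ≤ Real.log n := by
          have := Real.log_le_log (by positivity) h1.le
          rwa [Real.log_mul (by positivity) (by positivity), Real.log_exp, Real.log_pow] at this
        have e8 : ((1/8 : ℝ))^K = Real.exp (-(3/2) * (K * Real.log 4)) := by
          rw [show (-(3/2) * (K * Real.log 4) : ℝ) = K * (-(3/2) * Real.log 4) by ring, Real.exp_nat_mul]
          congr 1
          rw [show (4:ℝ) = 2^2 by norm_num, Real.log_pow, show (-(3/2) * (((2:ℕ):ℝ) * Real.log 2) : ℝ) = - Real.log (2^3) by rw [Real.log_pow]; push_cast; ring,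
            Real.exp_neg, Real.exp_log (by norm_num)]
          norm_num
        rw [e8]
        apply Real.exp_le_exp.2
        have := le_max_right 0 (Real.log n - u); linarith
      · have := hpsi (4^(K+1) * Real.exp u) (by positivity)
        calc _ ≤ (1/8 : ℝ)^K * (c * (4^(K+1) * Real.exp u)) := by gcongr
          _ = _ := by
            have : (1/2 : ℝ)^K = (1/8)^K * 4^K := by rw [← mul_pow]; norm_num
            rw [this, pow_succ]; ring) N
  have hN : (N : ℝ) ≤ 4^N * Real.exp u := by
    have h1 : (N:ℝ) ≤ 4^N := by exact_mod_cast (Nat.lt_pow_self (by norm_num)).le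
    have h2 := Real.one_le_exp hu
    have h3 : (0:ℝ) < 4^N := by positivity
    nlinarith
  have hsub : ∑ n ∈ Finset.range N, vonMangoldt n * Real.exp (-(3/2) * max 0 (Real.log n - u)) ≤
     ∑ n ∈ Finset.Ioc 0 ⌊4^N * Real.exp u⌋₊, vonMangoldt n * Real.exp (-(3/2) * max 0 (Real.log n - u)) := by
    rw [← Finset.sum_filter_add_sum_filter_not (Finset.range N) (fun n => n ≠ 0)]
    have : ∑ n ∈ (Finset.range N).filter (fun n => ¬ n ≠ 0), vonMangoldt n * Real.exp (-(3/2) * max 0 (Real.log n - u)) = 0 := by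
      refine Finset.sum_eq_zero fun n hn => ?_
      have : n = 0 := by simpa using (Finset.mem_filter.1 hn).2
      simp [this]
    rw [this, add_zero]
    refine Finset.sum_le_sum_of_subset_of_nonneg (fun n hn => ?_) fun n _ _ => mul_nonneg (hf n) (Real.exp_pos _).le
    rw [Finset.mem_filter, Finset.mem_range] at hn
    rw [Finset.mem_Ioc]
    refine ⟨Nat.pos_of_ne_zero hn.2, Nat.le_floor (le_trans ?_ hN)⟩
    exact_mod_cast hn.1.le
  have h5 : 0 ≤ 2 * (4 * c * Real.exp u) * (1/2)^N := by positivity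
  linarith

lemma mertens : ∃ C > 0, ∀ N : ℕ, 1 ≤ N →
    |∑ n ∈ Finset.Ioc 0 N, vonMangoldt n / n - Real.log N| ≤ C := by
  set c := Real.log 4 + 4 with hc
  have hc0 : 0 < c := by have := Real.log_pos (show (1:ℝ) < 4 by norm_num); linarith
  refine ⟨c + 1, by positivity, fun N hN => ?_⟩
  have hNp : (0:ℝ) < N := by exact_mod_cast hN
  have hpsi : ∑ n ∈ Finset.Ioc 0 N, vonMangoldt n ≤ c * N := by
    have := Chebyshev.psi_le_const_mul_self (x := N) (by positivity)
    rwa [Chebyshev.psi, Nat.floor_natCast] at this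
  have h1 : ∑ n ∈ Finset.Ioc 0 N, Real.log n = ∑ n ∈ Finset.Ioc 0 N, vonMangoldt n * ((N / n : ℕ) : ℝ) := by
    rw [← ArithmeticFunction.sum_Ioc_mul_zeta_eq_sum, ArithmeticFunction.vonMangoldt_mul_zeta]
    rfl
  have h2 : ∀ N : ℕ, ∑ n ∈ Finset.Ioc 0 N, Real.log n = Real.log N.factorial := by
    intro N
    induction N with
    | zero => simp
    | succ k ih =>
      rw [← Finset.sum_Ioc_consecutive _ (Nat.zero_le k) (Nat.le_succ k), ih, Nat.factorial_succ]
      simp only [Nat.succ_eq_add_one, Nat.Ioc_succ_singleton, Finset.sum_singleton]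
      push_cast
      rw [Real.log_mul (by positivity) (by positivity)]; ring
  have h3 : N * Real.log N - N ≤ Real.log N.factorial := by
    have := Stirling.le_log_factorial_stirling (n := N) (by omega)
    have h4 : 0 ≤ Real.log N := Real.log_nonneg (by exact_mod_cast hN)
    have h5 : 0 ≤ Real.log (2 * Real.pi) := Real.log_nonneg (by nlinarith [Real.pi_gt_three])
    linarith
  have h4 : Real.log N.factorial ≤ N * Real.log N := by
    rw [← Real.log_pow]
    exact Real.log_le_log (by positivity) (by exact_mod_cast Nat.factorial_le_pow N)
  rw [h2] at h1
  set M := ∑ n ∈ Finset.Ioc 0 N, vonMangoldt n / n with hM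
  have h5 : ∑ n ∈ Finset.Ioc 0 N, vonMangoldt n * ((N / n : ℕ) : ℝ) ≤ N * M := by
    rw [hM, Finset.mul_sum]
    refine Finset.sum_le_sum fun n hn => ?_
    have : ((N / n : ℕ) : ℝ) ≤ N / n := Nat.cast_div_le
    calc _ ≤ vonMangoldt n * (N / n : ℝ) := mul_le_mul_of_nonneg_left this ArithmeticFunction.vonMangoldt_nonneg
      _ = _ := by ring
  have h6 : N * M - ∑ n ∈ Finset.Ioc 0 N, vonMangoldt n ≤ ∑ n ∈ Finset.Ioc 0 N, vonMangoldt n * ((N / n : ℕ) : ℝ) := by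
    rw [hM, Finset.mul_sum, ← Finset.sum_sub_distrib]
    refine Finset.sum_le_sum fun n hn => ?_
    have : (N / n : ℝ) - 1 ≤ ((N / n : ℕ) : ℝ) := by
      have h := Nat.lt_floor_add_one ((N:ℝ) / n)
      rw [Nat.floor_div_eq_div] at h
      linarith
    calc _ = vonMangoldt n * ((N / n : ℝ) - 1) := by ring
      _ ≤ _ := mul_le_mul_of_nonneg_left this ArithmeticFunction.vonMangoldt_nonneg
  have h7 : N * (M - Real.log N) ≤ N * (c + 1) := by nlinarith
  have h8 : N * (-(c+1)) ≤ N * (M - Real.log N) := by nlinarith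
  exact abs_le.2 ⟨le_of_mul_le_mul_left h8 hNp, le_of_mul_le_mul_left h7 hNp⟩

lemma primepow_sum : ∃ C > 0, ∀ N : ℕ,
    ∑ n ∈ Finset.Ioc 0 N, (if n.Prime then 0 else vonMangoldt n) * (1 / n : ℝ) ≤ C := by
  obtain ⟨C0, hC0⟩ := Chebyshev.psi_sub_theta_le_mul_sqrt
  set C := |C0| + 1
  have hC : ∀ x : ℕ, ∑ n ∈ Finset.Ioc 0 x, (if n.Prime then 0 else vonMangoldt n) ≤ C * Real.sqrt x := by
    intro x
    have := hC0 x
    rw [Chebyshev.psi_sub_theta_eq_sum_not_prime, Nat.floor_natCast, Finset.sum_filter] at this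
    calc _ = ∑ n ∈ Finset.Ioc 0 x, (if ¬ n.Prime then vonMangoldt n else 0) := by
          refine Finset.sum_congr rfl fun n _ => ?_
          split_ifs <;> rfl
      _ ≤ C0 * Real.sqrt x := this
      _ ≤ _ := by gcongr; have := le_abs_self C0; simp only [C]; linarith
  have hCp : 0 < C := by positivity
  have hf : ∀ n : ℕ, 0 ≤ (if n.Prime then 0 else vonMangoldt n) := fun n => by
    split_ifs; exacts [le_rfl, ArithmeticFunction.vonMangoldt_nonneg]
  refine ⟨C + 2 * (2 * C), by positivity, fun N => ?_⟩
  have key := dyad (fun n => if n.Prime then 0 else vonMangoldt n) (fun n => 1 / n) hf (fun K => 4^K)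
    (fun a b h => Nat.pow_le_pow_right (by norm_num) h) C (2 * C)
    (by rw [pow_zero, show Finset.Ioc 0 1 = {1} from rfl]; simpa using hCp.le)
    (fun K => ⟨1/4^K, by positivity, fun n hn => by
        apply one_div_le_one_div_of_le (by positivity); exact_mod_cast hn.le, by
        have := hC (4^(K+1))
        have e : Real.sqrt ((4^(K+1) : ℕ) : ℝ) = 2^(K+1) := by
          rw [Real.sqrt_eq_iff_mul_self_eq (by positivity) (by positivity)]
          push_cast
          rw [← mul_pow]; norm_num
        rw [e] at this
        calc _ ≤ (1/4^K : ℝ) * (C * 2^(K+1)) := by gcongr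
          _ = _ := by
            have : (1/4^K : ℝ) = (1/2)^K * (1/2)^K := by rw [← mul_pow, ← one_div_pow]; norm_num
            rw [this, pow_succ, one_div_pow]; field_simp⟩) N
  have h1 : ∑ n ∈ Finset.Ioc 0 N, (if n.Prime then 0 else vonMangoldt n) * (1 / n : ℝ) ≤
     ∑ n ∈ Finset.Ioc (0:ℕ) (4^N : ℕ), (if n.Prime then 0 else vonMangoldt n) * (1 / n : ℝ) := by
    refine Finset.sum_le_sum_of_subset_of_nonneg (Finset.Ioc_subset_Ioc_right (Nat.lt_pow_self (by norm_num)).le) fun n _ _ => mul_nonneg (hf n) (by positivity)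
  have h5 : 0 ≤ 2 * (2 * C) * (1/2)^N := by positivity
  linarith

lemma D_asymp : ∃ C > 0, ∀ N : ℕ, 1 ≤ N →
    |∑ n ∈ Finset.Ioc 0 N, vonMangoldt n ^ 2 / n - Real.log N ^ 2 / 2| ≤ C * Real.log N := by
  obtain ⟨C1, hC1, hM⟩ := mertens
  obtain ⟨C2, hC2, hP⟩ := primepow_sum
  refine ⟨(C1 + 1) + C1 + C2, by positivity, fun N hN => ?_⟩
  set M : ℕ → ℝ := fun N => ∑ n ∈ Finset.Ioc 0 N, vonMangoldt n / n with hMd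
  set F : ℕ → ℝ := fun N => ∑ n ∈ Finset.Ioc 0 N, vonMangoldt n * Real.log n / n with hFd
  have hstep : ∀ f : ℕ → ℝ, ∀ k : ℕ, ∑ n ∈ Finset.Ioc 0 (k+1), f n = ∑ n ∈ Finset.Ioc 0 k, f n + f (k+1) := by
    intro f k
    rw [← Finset.sum_Ioc_consecutive _ (Nat.zero_le k) (Nat.le_succ k)]
    simp
  have hQ : ∀ k : ℕ, 1 ≤ k → |F k - Real.log k * M k + Real.log k ^ 2 / 2| ≤ (C1 + 1) * Real.log k := by
    intro k hk
    induction k, hk using Nat.le_induction with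
    | base => simp [hFd]
    | succ k hk ih =>
      have hF : F (k+1) = F k + vonMangoldt (k+1) * Real.log ((k+1 : ℕ):ℝ) / ((k+1 : ℕ):ℝ) := hstep _ k
      have hMs : M (k+1) = M k + vonMangoldt (k+1) / ((k+1 : ℕ):ℝ) := hstep _ k
      have hMk : |M k - Real.log k| ≤ C1 := hM k hk
      have hkp : (1:ℝ) ≤ k := by exact_mod_cast hk
      have hd0 : 0 ≤ Real.log ((k+1 : ℕ):ℝ) - Real.log k := by
        rw [sub_nonneg]; apply Real.log_le_log (by linarith); push_cast; linarith
      have hd1 : Real.log ((k+1 : ℕ):ℝ) - Real.log k ≤ 1 := by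
        rw [← Real.log_div (by positivity) (by positivity)]
        have h1 : ((k+1:ℕ):ℝ) / k ≤ 2 := by rw [div_le_iff₀ (by linarith)]; push_cast; linarith
        have h2 := Real.log_le_sub_one_of_pos (show 0 < ((k+1:ℕ):ℝ) / k by positivity)
        linarith
      rw [hF, hMs]
      set l' := Real.log ((k+1 : ℕ):ℝ)
      set l := Real.log (k:ℝ)
      have e : F k + vonMangoldt (k+1) * l' / ((k+1 : ℕ):ℝ) - l' * (M k + vonMangoldt (k+1) / ((k+1 : ℕ):ℝ)) + l' ^ 2 / 2
        = (F k - l * M k + l ^ 2 / 2) + (l' - l) * ((l' - l) / 2 - (M k - l)) := by ring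
      rw [e]
      have h3 : |(l' - l) * ((l' - l) / 2 - (M k - l))| ≤ (l' - l) * (C1 + 1) := by
        rw [abs_mul, abs_of_nonneg hd0]
        refine mul_le_mul_of_nonneg_left ?_ hd0
        rw [abs_le] at hMk ⊢
        constructor <;> linarith [hMk.1, hMk.2]
      calc _ ≤ _ := abs_add_le _ _
        _ ≤ (C1 + 1) * l + (l' - l) * (C1 + 1) := add_le_add ih h3
        _ = _ := by ring
  have hlog : 0 ≤ Real.log N := Real.log_nonneg (by exact_mod_cast hN)
  have h1 := hQ N hN
  have h2 : |M N - Real.log N| ≤ C1 := hM N hN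
  have h3 : 0 ≤ F N - ∑ n ∈ Finset.Ioc 0 N, vonMangoldt n ^ 2 / n := by
    rw [hFd, ← Finset.sum_sub_distrib]
    refine Finset.sum_nonneg fun n _ => ?_
    rw [← sub_div]
    apply div_nonneg _ (by positivity)
    have := ArithmeticFunction.vonMangoldt_le_log (n := n)
    have := ArithmeticFunction.vonMangoldt_nonneg (n := n)
    nlinarith
  have h4 : F N - ∑ n ∈ Finset.Ioc 0 N, vonMangoldt n ^ 2 / n ≤ C2 * Real.log N := by
    refine le_trans ?_ (mul_le_mul_of_nonneg_right (hP N) hlog)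
    rw [hFd, ← Finset.sum_sub_distrib, Finset.sum_mul]
    refine Finset.sum_le_sum fun n hn => ?_
    rw [Finset.mem_Ioc] at hn
    split_ifs with hp
    · rw [ArithmeticFunction.vonMangoldt_apply_prime hp]
      apply le_of_eq; ring
    · have h5 := ArithmeticFunction.vonMangoldt_nonneg (n := n)
      have h6 : Real.log n ≤ Real.log N := Real.log_le_log (by exact_mod_cast hn.1) (by exact_mod_cast hn.2)
      rw [← sub_div, mul_one_div, div_mul_eq_mul_div]
      gcongr
      nlinarith [mul_le_mul_of_nonneg_left h6 h5, sq_nonneg (vonMangoldt n)]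
  have h5 : |Real.log N * (M N - Real.log N)| ≤ Real.log N * C1 := by
    rw [abs_mul, abs_of_nonneg hlog]; gcongr
  rw [abs_le] at h1 h5 ⊢
  constructor <;> nlinarith [h1.1, h1.2, h5.1, h5.2]


noncomputable def an (u : ℝ) (n : ℕ) : ℝ := vonMangoldt n / Real.sqrt n * Real.exp (-|u - Real.log n|)

lemma an_nonneg (u : ℝ) (n : ℕ) : 0 ≤ an u n :=
  mul_nonneg (div_nonneg ArithmeticFunction.vonMangoldt_nonneg (Real.sqrt_nonneg _)) (Real.exp_pos _).le

lemma an_zero (u : ℝ) : an u 0 = 0 := by simp [an]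

lemma sqrt_exp {n : ℕ} (hn : n ≠ 0) : Real.sqrt n = Real.exp (Real.log n / 2) := by
  have : (0:ℝ) < n := by positivity
  rw [← Real.log_sqrt this.le, Real.exp_log (by positivity)]

lemma an_sq (u : ℝ) (n : ℕ) : an u n ^ 2 = vonMangoldt n ^ 2 / n * Real.exp (-2 * |u - Real.log n|) := by
  unfold an
  rw [mul_pow, div_pow, Real.sq_sqrt (by positivity), ← Real.exp_nat_mul]
  congr 2; push_cast; ring

lemma an_le (u : ℝ) (n : ℕ) : an u n ≤ Real.exp (-u/2) * (vonMangoldt n * Real.exp (-(3/2) * max 0 (Real.log n - u))) := by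
  rcases eq_or_ne n 0 with rfl | hn
  · simp [an]
  have h0 : 0 ≤ vonMangoldt n := ArithmeticFunction.vonMangoldt_nonneg
  unfold an
  rw [sqrt_exp hn, div_eq_mul_inv, ← Real.exp_neg, mul_assoc, ← Real.exp_add, mul_left_comm, ← Real.exp_add]
  refine mul_le_mul_of_nonneg_left (Real.exp_le_exp.2 ?_) h0
  rcases le_total u (Real.log n) with h | h
  · rw [abs_of_nonpos (by linarith), max_eq_right (by linarith)]; linarith
  · rw [abs_of_nonneg (by linarith), max_eq_left (by linarith)]; linarith

lemma an_sum : ∃ C > 0, ∀ u : ℝ, 0 ≤ u → ∀ N : ℕ, ∑ n ∈ Finset.range N, an u n ≤ C * Real.exp (u/2) := by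
  obtain ⟨C, hC, h⟩ := cheb_H
  refine ⟨C, hC, fun u hu N => ?_⟩
  calc _ ≤ ∑ n ∈ Finset.range N, Real.exp (-u/2) * (vonMangoldt n * Real.exp (-(3/2) * max 0 (Real.log n - u))) :=
        Finset.sum_le_sum fun n _ => an_le u n
    _ = Real.exp (-u/2) * ∑ n ∈ Finset.range N, (vonMangoldt n * Real.exp (-(3/2) * max 0 (Real.log n - u))) := by rw [Finset.mul_sum]
    _ ≤ Real.exp (-u/2) * (C * Real.exp u) := by gcongr; exact h u hu N
    _ = _ := by rw [mul_left_comm, ← Real.exp_add]; ring_nf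

lemma log_le_aux {u : ℝ} (hu : 0 ≤ u) (n : ℕ) : 1 + Real.log n ≤ (1 + u) * (1 + max 0 (Real.log n - u)) := by
  have h1 := le_max_right 0 (Real.log n - u)
  have h2 := le_max_left 0 (Real.log n - u)
  nlinarith [mul_nonneg hu h2]

lemma an_sq_sum_w : ∃ C > 0, ∀ u : ℝ, 0 ≤ u → ∀ N : ℕ, ∑ n ∈ Finset.range N, an u n ^ 2 * n * (1 + Real.log n) ≤ C * (1 + u)^2 * Real.exp u := by
  obtain ⟨C, hC, h⟩ := cheb_H
  refine ⟨16 * C, by positivity, fun u hu N => ?_⟩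
  calc _ ≤ ∑ n ∈ Finset.range N, 16 * (1+u)^2 * (vonMangoldt n * Real.exp (-(3/2) * max 0 (Real.log n - u))) := by
        refine Finset.sum_le_sum fun n _ => ?_
        rcases eq_or_ne n 0 with rfl | hn
        · simp
        have hn0 : (n:ℝ) ≠ 0 := by positivity
        have h0 : 0 ≤ vonMangoldt n := ArithmeticFunction.vonMangoldt_nonneg
        have hl : vonMangoldt n ≤ 1 + Real.log n := by have := ArithmeticFunction.vonMangoldt_le_log (n := n); linarith
        have hl0 : 0 ≤ 1 + Real.log n := h0.trans hl
        set v := max 0 (Real.log n - u) with hv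
        have hv0 : 0 ≤ v := le_max_left _ _
        have h2 : Real.exp (-2 * |u - Real.log n|) ≤ Real.exp (-2 * v) := by
          apply Real.exp_le_exp.2
          have : v ≤ |u - Real.log n| := max_le (abs_nonneg _) (by rw [abs_sub_comm]; exact le_abs_self _)
          linarith
        have h3 : (1 + Real.log n)^2 ≤ (1+u)^2 * (1 + v)^2 := by
          rw [← mul_pow]; exact pow_le_pow_left₀ hl0 (log_le_aux hu n) 2
        have h4 : (1 + v)^2 ≤ 16 * Real.exp (v/2) := by
          have : 1 + v ≤ 4 * Real.exp (v/4) := by have := Real.add_one_le_exp (v/4); linarith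
          calc _ ≤ (4 * Real.exp (v/4))^2 := pow_le_pow_left₀ (by positivity) this 2
            _ = _ := by rw [mul_pow, ← Real.exp_nat_mul]; push_cast; ring_nf
        rw [an_sq]
        calc _ = vonMangoldt n * (vonMangoldt n * (1 + Real.log n)) * Real.exp (-2 * |u - Real.log n|) := by field_simp
          _ ≤ vonMangoldt n * ((1 + Real.log n) * (1 + Real.log n)) * Real.exp (-2 * v) := by gcongr
          _ ≤ vonMangoldt n * ((1+u)^2 * (16 * Real.exp (v/2))) * Real.exp (-2 * v) := by
              have h5 : (1 + Real.log n) * (1 + Real.log n) ≤ (1+u)^2 * (16 * Real.exp (v/2)) := by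
                rw [← sq]
                exact h3.trans (mul_le_mul_of_nonneg_left h4 (by positivity))
              exact mul_le_mul_of_nonneg_right (mul_le_mul_of_nonneg_left h5 h0) (Real.exp_pos _).le
          _ = 16 * (1+u)^2 * (vonMangoldt n * (Real.exp (v/2) * Real.exp (-2 * v))) := by ring
          _ = _ := by rw [← Real.exp_add]; ring_nf
    _ = 16 * (1+u)^2 * ∑ n ∈ Finset.range N, (vonMangoldt n * Real.exp (-(3/2) * max 0 (Real.log n - u))) := by rw [Finset.mul_sum]
    _ ≤ 16 * (1+u)^2 * (C * Real.exp u) := by gcongr; exact h u hu N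
    _ = _ := by ring

lemma an_sq_sum : ∃ C > 0, ∀ u : ℝ, 0 ≤ u → ∀ N : ℕ, ∑ n ∈ Finset.range N, an u n ^ 2 ≤ C * (1 + u) := by
  obtain ⟨C, hC, h⟩ := cheb_H
  refine ⟨C, by positivity, fun u hu N => ?_⟩
  calc _ ≤ ∑ n ∈ Finset.range N, (1+u) * Real.exp (-u) * (vonMangoldt n * Real.exp (-(3/2) * max 0 (Real.log n - u))) := by
        refine Finset.sum_le_sum fun n _ => ?_
        rcases eq_or_ne n 0 with rfl | hn
        · simp [an]
        have hnp : (0:ℝ) < n := by positivity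
        have h0 : 0 ≤ vonMangoldt n := ArithmeticFunction.vonMangoldt_nonneg
        have hl : vonMangoldt n ≤ 1 + Real.log n := by have := ArithmeticFunction.vonMangoldt_le_log (n := n); linarith
        have hl2 := hl.trans (log_le_aux hu n)
        set v := max 0 (Real.log n - u) with hv
        have hv0 : 0 ≤ v := le_max_left _ _
        have hv1 : 1 + v ≤ Real.exp v := by have := Real.add_one_le_exp v; linarith
        have h2 : (n:ℝ)⁻¹ * Real.exp (-2 * |u - Real.log n|) ≤ Real.exp (-u) * Real.exp (-3*v) := by
          rw [← Real.exp_log hnp, ← Real.exp_neg, ← Real.exp_add, ← Real.exp_add, Real.log_exp]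
          apply Real.exp_le_exp.2
          rw [hv]
          rcases le_total u (Real.log n) with h | h
          · rw [abs_of_nonpos (by linarith), max_eq_right (by linarith)]; linarith
          · rw [abs_of_nonneg (by linarith), max_eq_left (by linarith)]; linarith
        rw [an_sq]
        calc _ = vonMangoldt n * vonMangoldt n * ((n:ℝ)⁻¹ * Real.exp (-2 * |u - Real.log n|)) := by ring
          _ ≤ vonMangoldt n * ((1+u) * Real.exp v) * (Real.exp (-u) * Real.exp (-3*v)) := by
              gcongr
              exact hl2.trans (by gcongr)
          _ = (1+u) * Real.exp (-u) * (vonMangoldt n * Real.exp (v + -3*v)) := by rw [Real.exp_add]; ring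
          _ ≤ _ := by
              gcongr
              linarith
    _ = (1+u) * Real.exp (-u) * ∑ n ∈ Finset.range N, (vonMangoldt n * Real.exp (-(3/2) * max 0 (Real.log n - u))) := by rw [Finset.mul_sum]
    _ ≤ (1+u) * Real.exp (-u) * (C * Real.exp u) := by gcongr; exact h u hu N
    _ = C * (1+u) * (Real.exp (-u) * Real.exp u) := by ring
    _ = _ := by rw [← Real.exp_add]; simp

lemma an_summable {u : ℝ} (hu : 0 ≤ u) : Summable (an u) := by
  obtain ⟨C, hC, h⟩ := an_sum
  exact summable_of_sum_range_le (an_nonneg u) (h u hu)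

lemma an_sq_summable {u : ℝ} (hu : 0 ≤ u) : Summable (fun n => an u n ^ 2) := by
  obtain ⟨C, hC, h⟩ := an_sq_sum
  exact summable_of_sum_range_le (fun n => sq_nonneg _) (h u hu)

lemma kf_eq (v : ℝ) : kf (-1) 1 v = (Real.exp (-|v|) : ℂ) := by
  unfold kf
  split_ifs with h
  · rw [abs_of_nonpos h]; push_cast; ring_nf
  · rw [abs_of_pos (not_le.1 h)]; push_cast; ring_nf

noncomputable def pt (u t : ℝ) (n : ℕ) : ℂ := (an u n : ℂ) * Complex.exp (-(t * Real.log n : ℝ) * Complex.I)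

lemma pt_norm (u t : ℝ) (n : ℕ) : ‖pt u t n‖ = an u n := by
  unfold pt
  rw [norm_mul, Complex.norm_real, Real.norm_of_nonneg (an_nonneg u n), ← Complex.ofReal_neg, Complex.norm_exp_ofReal_mul_I, mul_one]

lemma PL_eq (u t : ℝ) : PL u t = ∑' n, pt u t n := by
  unfold PL
  refine tsum_congr fun n => ?_
  rcases eq_or_ne n 0 with rfl | hn
  · simp [pt, an]
  have hn0 : (n:ℂ) ≠ 0 := by exact_mod_cast hn
  rw [LSeries.term_of_ne_zero hn, kf_eq, pt, an, sqrt_exp hn, Complex.cpow_def_of_ne_zero hn0, ← Complex.natCast_log]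
  have : Complex.exp (Real.log n * sl t) = Complex.exp (Real.log n / 2) * Complex.exp ((t * Real.log n : ℝ) * Complex.I) := by
    rw [← Complex.exp_add]; congr 1; unfold sl; push_cast; ring
  rw [this, neg_mul, Complex.exp_neg]
  push_cast
  field_simp

lemma harm_bound {n : ℕ} (hn : n ≠ 0) : ∑ m ∈ Finset.range (2*n), 1 / |(m:ℝ) - n| ≤ 2 * (1 + Real.log n) := by
  have hh := harmonic_le_one_add_log n
  have e1 : ((harmonic n : ℚ) : ℝ) = ∑ i ∈ Finset.range n, 1 / ((i:ℝ) + 1) := by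
    unfold harmonic; push_cast; simp
  rw [e1] at hh
  rw [two_mul, Finset.sum_range_add]
  have h1 : ∑ m ∈ Finset.range n, 1 / |(m:ℝ) - n| = ∑ i ∈ Finset.range n, 1 / ((i:ℝ) + 1) := by
    rw [← Finset.sum_range_reflect]
    refine Finset.sum_congr rfl fun j hj => ?_
    have hj := Finset.mem_range.1 hj
    rw [Nat.cast_sub (by omega), Nat.cast_sub (by omega), abs_of_nonpos (by push_cast; linarith [(Nat.cast_nonneg j : (0:ℝ) ≤ j)])]
    push_cast; ring_nf
  have h2 : ∑ m ∈ Finset.range n, 1 / |((n + m : ℕ):ℝ) - n| ≤ ∑ i ∈ Finset.range n, 1 / ((i:ℝ) + 1) := by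
    obtain ⟨k, rfl⟩ := Nat.exists_eq_succ_of_ne_zero hn
    rw [Finset.sum_range_succ', Finset.sum_range_succ _ k]
    have : (0:ℝ) ≤ 1 / (k + 1) := by positivity
    refine add_le_add (Finset.sum_le_sum fun i _ => ?_) (by simpa using this)
    push_cast
    rw [abs_of_nonneg (by linarith [(Nat.cast_nonneg i : (0:ℝ) ≤ i)])]
    apply le_of_eq; ring_nf
  linarith

lemma pair_bound_aux {m n : ℕ} (hn : n ≠ 0) (h : n < m) {x y : ℝ} (hx : 0 ≤ x) (hy : 0 ≤ y) :
    x * y * (1 / |Real.log m - Real.log n|) ≤ 2 * (x * y) + (if m < 2*n then y^2 * n * (1 / |(m:ℝ)-n|) else 0)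
      + (if n < 2*m then x^2 * m * (1 / |(n:ℝ)-m|) else 0) := by
  have hnp : (0:ℝ) < n := by positivity
  have hmn : (n:ℝ) < m := by exact_mod_cast h
  have hmp : (0:ℝ) < m := hnp.trans hmn
  have hd : ((m:ℝ) - n)/m ≤ Real.log m - Real.log n := by
    rw [← Real.log_div hmp.ne' hnp.ne']
    have := Real.one_sub_inv_le_log_of_pos (show 0 < (m:ℝ)/n by positivity)
    rw [inv_div] at this
    rw [sub_div, div_self hmp.ne']; exact this
  have hdp : 0 < ((m:ℝ) - n)/m := div_pos (by linarith) hmp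
  rw [abs_of_pos (hdp.trans_le hd), abs_of_pos (by linarith : 0 < (m:ℝ)-n), abs_of_neg (by linarith : (n:ℝ)-m < 0)]
  have h1 : 1 / (Real.log m - Real.log n) ≤ m / (m - n) := by
    have := one_div_le_one_div_of_le hdp hd
    rwa [one_div_div] at this
  have hxy : 0 ≤ x * y := mul_nonneg hx hy
  have hdm : 0 < (m:ℝ) - n := by linarith
  rw [if_pos (by omega : n < 2*m)]
  have e : -((n:ℝ)-m) = m - n := by ring
  rw [e]
  refine (mul_le_mul_of_nonneg_left h1 hxy).trans ?_
  split_ifs with h2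
  · have h2' : (m:ℝ) < 2*n := by exact_mod_cast h2
    have : x * y * m ≤ y^2 * n + x^2 * m := by nlinarith [mul_nonneg (sq_nonneg (x-y)) hmp.le, sq_nonneg y, sq_nonneg x, mul_nonneg (sq_nonneg x) hmp.le, mul_nonneg (sq_nonneg y) (by linarith : 0 ≤ 2*(n:ℝ)-m)]
    calc x * y * (m/(m-n)) = (x*y*m) * (1/((m:ℝ)-n)) := by ring
      _ ≤ (y^2 * n + x^2 * m) * (1/((m:ℝ)-n)) := by gcongr
      _ ≤ _ := by linarith
  · have h2' : 2*(n:ℝ) ≤ m := by exact_mod_cast not_lt.1 h2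
    have : (m:ℝ)/(m-n) ≤ 2 := by rw [div_le_iff₀ hdm]; linarith
    have h3 : 0 ≤ x^2 * m * (1/((m:ℝ)-n)) := by positivity
    nlinarith [mul_le_mul_of_nonneg_left this hxy]

lemma pair_bound {m n : ℕ} (hm : m ≠ 0) (hn : n ≠ 0) (h : m ≠ n) {x y : ℝ} (hx : 0 ≤ x) (hy : 0 ≤ y) :
    x * y * (1 / |Real.log m - Real.log n|) ≤ 2 * (x * y) + (if m < 2*n then y^2 * n * (1 / |(m:ℝ)-n|) else 0)
      + (if n < 2*m then x^2 * m * (1 / |(n:ℝ)-m|) else 0) := by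
  rcases lt_or_gt_of_ne h with h | h
  · have := pair_bound_aux hm h hy hx
    rw [abs_sub_comm (Real.log n), mul_comm y x] at this
    linarith
  · exact pair_bound_aux hn h hx hy


lemma cos_int (T δ : ℝ) (h : δ ≠ 0) : |∫ t in T..(2*T), Real.cos (t * δ)| ≤ 2 * (1 / |δ|) := by
  rw [intervalIntegral.integral_comp_mul_right _ h, integral_cos, smul_eq_mul, abs_mul, abs_inv, mul_comm, one_div]
  gcongr
  have h1 := Real.abs_sin_le_one (2*T*δ)
  have h2 := Real.abs_sin_le_one (T*δ)
  have := abs_sub (Real.sin (2*T*δ)) (Real.sin (T*δ))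
  linarith

lemma pt_re (u t : ℝ) (n : ℕ) : (pt u t n).re = an u n * Real.cos (t * Real.log n) := by
  unfold pt
  rw [Complex.re_ofReal_mul, ← Complex.ofReal_neg, Complex.exp_ofReal_mul_I_re, Real.cos_neg]

lemma pt_im (u t : ℝ) (n : ℕ) : (pt u t n).im = -(an u n * Real.sin (t * Real.log n)) := by
  unfold pt
  rw [Complex.im_ofReal_mul, ← Complex.ofReal_neg, Complex.exp_ofReal_mul_I_im, Real.sin_neg, mul_neg]

lemma pt_sq (u t : ℝ) (N : ℕ) : ‖∑ n ∈ Finset.range N, pt u t n‖^2 =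
    ∑ m ∈ Finset.range N, ∑ n ∈ Finset.range N, an u m * an u n * Real.cos (t * (Real.log m - Real.log n)) := by
  rw [← Complex.normSq_eq_norm_sq, Complex.normSq_apply, Complex.re_sum, Complex.im_sum]
  simp only [pt_re, pt_im]
  rw [Finset.sum_neg_distrib, neg_mul_neg, Finset.sum_mul_sum, Finset.sum_mul_sum, ← Finset.sum_add_distrib]
  refine Finset.sum_congr rfl fun m _ => ?_
  rw [← Finset.sum_add_distrib]
  refine Finset.sum_congr rfl fun n _ => ?_
  rw [mul_sub, Real.cos_sub]; ring

lemma pt_cont (u : ℝ) (n : ℕ) : Continuous (fun t => pt u t n) := by unfold pt; fun_prop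

lemma ms_finite : ∃ C > 0, ∀ u : ℝ, 0 ≤ u → ∀ T : ℝ, 0 ≤ T → ∀ N : ℕ,
    |(∫ t in T..(2*T), ‖∑ n ∈ Finset.range N, pt u t n‖^2) - T * ∑ n ∈ Finset.range N, an u n ^ 2| ≤ C * (1+u)^2 * Real.exp u := by
  obtain ⟨C1, hC1, h1⟩ := an_sum
  obtain ⟨C2, hC2, h2⟩ := an_sq_sum_w
  refine ⟨4 * C1^2 + 8 * C2, by positivity, fun u hu T hT N => ?_⟩
  set R := Finset.range N
  set A : ℕ → ℕ → ℝ := fun m n => if m < 2*n then an u n^2 * n * (1 / |(m:ℝ)-n|) else 0 with hA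
  have hA0 : ∀ m n, 0 ≤ A m n := fun m n => by simp only [hA]; split_ifs <;> positivity
  have e1 : (∫ t in T..(2*T), ‖∑ n ∈ R, pt u t n‖^2) = ∑ m ∈ R, ∑ n ∈ R, an u m * an u n * ∫ t in T..(2*T), Real.cos (t * (Real.log m - Real.log n)) := by
    simp only [R, pt_sq]
    rw [intervalIntegral.integral_finsetSum (fun m _ => Continuous.intervalIntegrable (by fun_prop) _ _)]
    refine Finset.sum_congr rfl fun m _ => ?_
    rw [intervalIntegral.integral_finsetSum (fun n _ => Continuous.intervalIntegrable (by fun_prop) _ _)]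
    exact Finset.sum_congr rfl fun n _ => intervalIntegral.integral_const_mul _ _
  have e2 : T * ∑ n ∈ R, an u n ^ 2 = ∑ m ∈ R, ∑ n ∈ R, an u m * an u n * (if m = n then T else 0) := by
    rw [Finset.mul_sum]
    refine Finset.sum_congr rfl fun m hm => ?_
    simp only [mul_ite, mul_zero]
    rw [Finset.sum_ite_eq, if_pos hm]; ring
  have hterm : ∀ m n : ℕ, |an u m * an u n * (∫ t in T..(2*T), Real.cos (t * (Real.log m - Real.log n))) - an u m * an u n * (if m = n then T else 0)|
      ≤ 4 * (an u m * an u n) + 2 * A m n + 2 * A n m := by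
    intro m n
    have ham := an_nonneg u m
    have han := an_nonneg u n
    have hr : 0 ≤ 4 * (an u m * an u n) + 2 * A m n + 2 * A n m := by have := hA0 m n; have := hA0 n m; positivity
    rcases eq_or_ne m n with rfl | hmn
    · have : ∫ t in T..(2*T), Real.cos (t * (Real.log m - Real.log m)) = T := by simp; ring
      rw [this, if_pos rfl, sub_self, abs_zero]; exact hr
    rcases eq_or_ne m 0 with rfl | hm
    · rw [an_zero] at hr ⊢; simpa using hr
    rcases eq_or_ne n 0 with rfl | hn
    · rw [an_zero] at hr ⊢; simpa using hr
    rw [if_neg hmn, mul_zero, sub_zero, abs_mul, abs_of_nonneg (mul_nonneg ham han)]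
    have hδ : Real.log m - Real.log n ≠ 0 := by
      rw [sub_ne_zero]
      intro h
      exact hmn (by exact_mod_cast Real.log_injOn_pos (mem_Ioi.2 (by positivity)) (mem_Ioi.2 (by positivity)) h)
    have h3 := mul_le_mul_of_nonneg_left (cos_int T _ hδ) (mul_nonneg ham han)
    have h4 := pair_bound hm hn hmn ham han
    change _ ≤ 2 * _ + A m n + A n m at h4
    linarith
  have hAs : ∑ m ∈ R, ∑ n ∈ R, A n m ≤ 2 * (C2 * (1+u)^2 * Real.exp u) := by
    refine le_trans ?_ (mul_le_mul_of_nonneg_left (h2 u hu N) zero_le_two)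
    rw [Finset.mul_sum]
    refine Finset.sum_le_sum fun m hm => ?_
    rcases eq_or_ne m 0 with rfl | hm0
    · simp [hA]
    calc ∑ n ∈ R, A n m = ∑ n ∈ R.filter (fun n => n < 2*m), an u m^2 * m * (1 / |(n:ℝ)-m|) := by
          rw [Finset.sum_filter]
      _ ≤ ∑ n ∈ Finset.range (2*m), an u m^2 * m * (1 / |(n:ℝ)-m|) := by
          refine Finset.sum_le_sum_of_subset_of_nonneg (fun n hn => ?_) fun n _ _ => by positivity
          exact Finset.mem_range.2 (Finset.mem_filter.1 hn).2
      _ = an u m^2 * m * ∑ n ∈ Finset.range (2*m), (1 / |(n:ℝ)-m|) := by rw [Finset.mul_sum]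
      _ ≤ an u m^2 * m * (2 * (1 + Real.log m)) := mul_le_mul_of_nonneg_left (harm_bound hm0) (by positivity)
      _ = _ := by ring
  have hAs' : ∑ m ∈ R, ∑ n ∈ R, A m n ≤ 2 * (C2 * (1+u)^2 * Real.exp u) := by rw [Finset.sum_comm]; exact hAs
  have hs : ∑ m ∈ R, ∑ n ∈ R, an u m * an u n ≤ C1^2 * Real.exp u := by
    rw [← Finset.sum_mul_sum]
    have h3 := h1 u hu N
    have h4 : 0 ≤ ∑ n ∈ R, an u n := Finset.sum_nonneg fun n _ => an_nonneg u n
    calc _ ≤ (C1 * Real.exp (u/2)) * (C1 * Real.exp (u/2)) := mul_le_mul h3 h3 h4 (by positivity)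
      _ = C1^2 * (Real.exp (u/2) * Real.exp (u/2)) := by ring
      _ = _ := by rw [← Real.exp_add, add_halves]
  rw [e1, e2, ← Finset.sum_sub_distrib]
  calc _ ≤ ∑ m ∈ R, ∑ n ∈ R, (4 * (an u m * an u n) + 2 * A m n + 2 * A n m) := by
        refine (Finset.abs_sum_le_sum_abs _ _).trans (Finset.sum_le_sum fun m _ => ?_)
        rw [← Finset.sum_sub_distrib]
        exact (Finset.abs_sum_le_sum_abs _ _).trans (Finset.sum_le_sum fun n _ => hterm m n)
    _ = 4 * (∑ m ∈ R, ∑ n ∈ R, an u m * an u n) + 2 * (∑ m ∈ R, ∑ n ∈ R, A m n) + 2 * (∑ m ∈ R, ∑ n ∈ R, A n m) := by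
        simp only [Finset.sum_add_distrib, Finset.mul_sum]
    _ ≤ 4 * (C1^2 * Real.exp u) + 8 * (C2 * (1+u)^2 * Real.exp u) := by linarith
    _ ≤ _ := by
        have : (1:ℝ) ≤ (1+u)^2 := by nlinarith
        have h5 : C1^2 * Real.exp u * 1 ≤ C1^2 * Real.exp u * (1+u)^2 := by gcongr
        nlinarith

noncomputable def SS (u : ℝ) : ℝ := ∑' n, an u n ^ 2

lemma PL_bound : ∃ C > 0, ∀ u : ℝ, 0 ≤ u → ∀ t, ‖PL u t‖ ≤ C * Real.exp (u/2) := by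
  obtain ⟨C1, hC1, h1⟩ := an_sum
  refine ⟨C1, hC1, fun u hu t => ?_⟩
  rw [PL_eq]
  have := tsum_of_norm_bounded (an_summable hu).hasSum (fun n => (pt_norm u t n).le)
  exact this.trans (Real.tsum_le_of_sum_range_le (an_nonneg u) (h1 u hu))

lemma PL_tendsto {u : ℝ} (hu : 0 ≤ u) (t : ℝ) : Tendsto (fun N => ∑ n ∈ Finset.range N, pt u t n) atTop (𝓝 (PL u t)) := by
  rw [PL_eq]
  exact (Summable.of_norm (by simpa only [pt_norm] using an_summable hu)).hasSum.tendsto_sum_nat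

lemma PL_cont {u : ℝ} (hu : 0 ≤ u) : Continuous (PL u) := by
  have : PL u = fun t => ∑' n, pt u t n := funext fun t => PL_eq u t
  rw [this]
  exact continuous_tsum (pt_cont u) (an_summable hu) (fun n t => (pt_norm u t n).le)

lemma pt_partial_le {u : ℝ} (hu : 0 ≤ u) (t : ℝ) (N : ℕ) : ‖∑ n ∈ Finset.range N, pt u t n‖ ≤ ∑' n, an u n := by
  refine (norm_sum_le _ _).trans ?_
  simp only [pt_norm]
  exact (an_summable hu).sum_le_tsum _ (fun n _ => an_nonneg u n)

lemma PL_ms : ∃ C > 0, ∀ u : ℝ, 0 ≤ u → ∀ T : ℝ, 0 ≤ T →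
    |(∫ t in T..(2*T), ‖PL u t‖^2) - T * SS u| ≤ C * (1+u)^2 * Real.exp u := by
  obtain ⟨C, hC, h⟩ := ms_finite
  refine ⟨C, hC, fun u hu T hT => ?_⟩
  have ht : Tendsto (fun N => |(∫ t in T..(2*T), ‖∑ n ∈ Finset.range N, pt u t n‖^2) - T * ∑ n ∈ Finset.range N, an u n ^ 2|) atTop
      (𝓝 |(∫ t in T..(2*T), ‖PL u t‖^2) - T * SS u|) := by
    refine Tendsto.abs (Tendsto.sub ?_ ((an_sq_summable hu).hasSum.tendsto_sum_nat.const_mul T))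
    refine intervalIntegral.tendsto_integral_filter_of_dominated_convergence (fun _ => (∑' n, an u n)^2) ?_ ?_ ?_ ?_
    · refine Eventually.of_forall fun N => Continuous.aestronglyMeasurable ?_
      have := fun n => pt_cont u n
      fun_prop
    · refine Eventually.of_forall fun N => ae_of_all _ fun t _ => ?_
      rw [norm_pow, norm_norm]
      exact pow_le_pow_left₀ (norm_nonneg _) (pt_partial_le hu t N) 2
    · exact intervalIntegrable_const
    · exact ae_of_all _ fun t _ => ((PL_tendsto hu t).norm.pow 2)
  exact le_of_tendsto ht (Eventually.of_forall fun N => h u hu T hT N)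

lemma PL_mean : ∃ C > 0, ∀ u : ℝ, 0 ≤ u → ∀ T : ℝ, 0 ≤ T →
    |∫ t in T..(2*T), (PL u t).re| ≤ C * Real.exp (u/2) := by
  obtain ⟨C1, hC1, h1⟩ := an_sum
  have hl2 : 0 < Real.log 2 := Real.log_pos (by norm_num)
  refine ⟨2 * (1 / Real.log 2) * C1, by positivity, fun u hu T hT => ?_⟩
  have ht : Tendsto (fun N => |(∫ t in T..(2*T), (∑ n ∈ Finset.range N, pt u t n).re)|) atTop
      (𝓝 |(∫ t in T..(2*T), (PL u t).re)|) := by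
    refine Tendsto.abs ?_
    refine intervalIntegral.tendsto_integral_filter_of_dominated_convergence (fun _ => (∑' n, an u n)) ?_ ?_ ?_ ?_
    · refine Eventually.of_forall fun N => Continuous.aestronglyMeasurable ?_
      have := fun n => pt_cont u n
      fun_prop
    · refine Eventually.of_forall fun N => ae_of_all _ fun t _ => ?_
      exact (Complex.abs_re_le_norm _).trans (pt_partial_le hu t N)
    · exact intervalIntegrable_const
    · exact ae_of_all _ fun t _ => (Complex.continuous_re.tendsto _).comp (PL_tendsto hu t)
  refine le_of_tendsto ht (Eventually.of_forall fun N => ?_)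
  simp only [Complex.re_sum, pt_re]
  rw [intervalIntegral.integral_finsetSum (fun m _ => Continuous.intervalIntegrable (by fun_prop) _ _)]
  calc _ ≤ ∑ n ∈ Finset.range N, 2 * (1 / Real.log 2) * an u n := by
        refine (Finset.abs_sum_le_sum_abs _ _).trans (Finset.sum_le_sum fun n _ => ?_)
        rw [intervalIntegral.integral_const_mul, abs_mul, abs_of_nonneg (an_nonneg u n), mul_comm]
        rcases Nat.lt_or_ge n 2 with hn | hn
        · have : an u n = 0 := by interval_cases n <;> simp [an]
          simp [this]
        · refine mul_le_mul_of_nonneg_right ?_ (an_nonneg u n)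
          have hlog : Real.log 2 ≤ Real.log n := Real.log_le_log (by norm_num) (by exact_mod_cast hn)
          refine (cos_int T _ (hl2.trans_le hlog).ne').trans ?_
          rw [abs_of_pos (hl2.trans_le hlog)]
          gcongr
    _ = 2 * (1 / Real.log 2) * ∑ n ∈ Finset.range N, an u n := by rw [Finset.mul_sum]
    _ ≤ 2 * (1 / Real.log 2) * (C1 * Real.exp (u/2)) := by gcongr; exact h1 u hu N
    _ = _ := by ring


lemma SS_bound : ∃ C > 0, ∀ u : ℝ, 0 ≤ u → SS u ≤ C * (1+u) := by
  obtain ⟨C1, hC1, h1⟩ := an_sq_sum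
  exact ⟨C1, hC1, fun u hu => Real.tsum_le_of_sum_range_le (fun n => sq_nonneg _) (h1 u hu)⟩

lemma SS_nonneg (u : ℝ) : 0 ≤ SS u := tsum_nonneg fun n => sq_nonneg _

lemma an_sq_le {u R : ℝ} (hu : |u| ≤ R) (n : ℕ) : an u n ^ 2 ≤ Real.exp (2*R) * an 0 n ^ 2 := by
  rw [an_sq, an_sq, mul_left_comm, ← Real.exp_add]
  refine mul_le_mul_of_nonneg_left (Real.exp_le_exp.2 ?_) (by positivity)
  have h1 : |0 - Real.log n| ≤ |u - Real.log n| + |u| := by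
    have := abs_sub (u - Real.log n) u
    rwa [show u - Real.log n - u = 0 - Real.log n by ring] at this
  linarith

lemma SS_cont : Continuous SS := by
  rw [continuous_iff_continuousAt]
  intro u
  have h : ContinuousOn SS (Icc (-(|u|+1)) (|u|+1)) := by
    refine continuousOn_tsum (u := fun n => Real.exp (2*(|u|+1)) * an 0 n ^ 2) (fun n => ?_) ((an_sq_summable le_rfl).mul_left _) fun n x hx => ?_
    · unfold an; fun_prop
    · rw [Real.norm_of_nonneg (sq_nonneg _)]
      exact an_sq_le (abs_le.2 hx) n
  refine h.continuousAt (Icc_mem_nhds ?_ ?_)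
  · linarith [neg_abs_le u]
  · linarith [le_abs_self u]

lemma exp_int_aux (k a p q : ℝ) (hk : k ≠ 0) : ∫ u in p..q, Real.exp (k * (u - a)) = (Real.exp (k*(q-a)) - Real.exp (k*(p-a)))/k := by
  rw [intervalIntegral.integral_comp_sub_right (fun u => Real.exp (k*u)) a, intervalIntegral.integral_comp_mul_left _ hk, integral_exp, smul_eq_mul]
  ring

lemma e_bound {y v : ℝ} (hy : 0 ≤ y) (hv : 0 ≤ v) :
    |(∫ u in (0:ℝ)..y, Real.exp (-2 * |u - v|)) - (if v ≤ y then 1 else 0)| ≤ Real.exp (-2 * |0 - v|) / 2 + Real.exp (-2 * |y - v|) / 2 := by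
  have hc : ∀ p q : ℝ, IntervalIntegrable (fun u => Real.exp (-2 * |u - v|)) volume p q := fun p q => Continuous.intervalIntegrable (by fun_prop) _ _
  have hl : ∀ p q : ℝ, p ≤ q → q ≤ v → ∫ u in p..q, Real.exp (-2 * |u - v|) = (Real.exp (2*(q-v)) - Real.exp (2*(p-v)))/2 := by
    intro p q hp hq
    rw [← exp_int_aux 2 v p q (by norm_num)]
    refine intervalIntegral.integral_congr fun u hu => ?_
    rw [uIcc_of_le hp] at hu
    rw [abs_of_nonpos (by linarith [hu.2])]; ring_nf
  have hr : ∀ p q : ℝ, p ≤ q → v ≤ p → ∫ u in p..q, Real.exp (-2 * |u - v|) = (Real.exp (-2*(q-v)) - Real.exp (-2*(p-v)))/(-2) := by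
    intro p q hp hq
    rw [← exp_int_aux (-2) v p q (by norm_num)]
    refine intervalIntegral.integral_congr fun u hu => ?_
    rw [uIcc_of_le hp] at hu
    rw [abs_of_nonneg (by linarith [hu.1])]
  rw [abs_of_nonpos (by linarith : 0 - v ≤ 0)]
  split_ifs with h
  · rw [← intervalIntegral.integral_add_adjacent_intervals (hc 0 v) (hc v y), hl 0 v hv le_rfl, hr v y h le_rfl, abs_of_nonneg (by linarith : 0 ≤ y - v)]
    have e1 : Real.exp (2*(v-v)) = 1 := by simp
    have e2 : Real.exp (-2*(v-v)) = 1 := by simp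
    have e3 : Real.exp (-2 * -(0-v)) = Real.exp (2*(0-v)) := by ring_nf
    rw [e1, e2, e3]
    have p1 := Real.exp_pos (2*(0-v))
    have p2 := Real.exp_pos (-2*(y-v))
    rw [abs_le]; constructor <;> linarith
  · rw [hl 0 y hy (by linarith), abs_of_nonpos (by linarith : y - v ≤ 0)]
    have e3 : Real.exp (-2 * -(0-v)) = Real.exp (2*(0-v)) := by ring_nf
    have e4 : Real.exp (-2 * -(y-v)) = Real.exp (2*(y-v)) := by ring_nf
    rw [e3, e4]
    have p1 := Real.exp_pos (2*(0-v))
    have p2 := Real.exp_pos (2*(y-v))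
    rw [abs_le]; constructor <;> linarith

lemma SS_int : ∃ C > 0, ∀ y : ℝ, 0 ≤ y → |(∫ u in (0:ℝ)..y, SS u) - y^2/2| ≤ C * (1+y) := by
  obtain ⟨C1, hC1, h1⟩ := SS_bound
  obtain ⟨C2, hC2, h2⟩ := D_asymp
  refine ⟨C1 + C2 + 1, by positivity, fun y hy => ?_⟩
  set c : ℕ → ℝ := fun n => vonMangoldt n ^ 2 / n with hc
  have hc0 : ∀ n, 0 ≤ c n := fun n => by positivity
  have ha : ∀ u n, an u n ^ 2 = c n * Real.exp (-2 * |u - Real.log n|) := fun u n => an_sq u n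
  have hI : HasSum (fun n => c n * ∫ u in (0:ℝ)..y, Real.exp (-2 * |u - Real.log n|)) (∫ u in (0:ℝ)..y, SS u) := by
    have := intervalIntegral.hasSum_integral_of_dominated_convergence (μ := volume) (a := 0) (b := y) (F := fun (n:ℕ) u => an u n ^ 2) (f := SS)
      (fun n _ => Real.exp (2*y) * an 0 n ^ 2) (fun n => Continuous.aestronglyMeasurable (by unfold an; fun_prop))
      (fun n => ae_of_all _ fun u hu => by
        rw [uIoc_of_le hy] at hu
        rw [Real.norm_of_nonneg (sq_nonneg _)]
        exact an_sq_le (abs_le.2 ⟨by linarith [hu.1], hu.2⟩) n)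
      (ae_of_all _ fun u _ => (an_sq_summable le_rfl).mul_left _)
      intervalIntegrable_const
      (ae_of_all _ fun u hu => by
        rw [uIoc_of_le hy] at hu
        exact (an_sq_summable hu.1.le).hasSum)
    simpa only [ha, intervalIntegral.integral_const_mul] using this
  set N := ⌊Real.exp y⌋₊ with hN
  have hN1 : 1 ≤ N := Nat.le_floor (by simpa using Real.one_le_exp hy)
  have hD : HasSum (fun n : ℕ => c n * (if Real.log n ≤ y then 1 else 0)) (∑ n ∈ Finset.Ioc 0 N, c n) := by
    have := hasSum_sum_of_ne_finset_zero (L := SummationFilter.unconditional ℕ) (f := fun n : ℕ => c n * (if Real.log n ≤ y then (1:ℝ) else 0)) (s := Finset.Ioc 0 N) (fun n hn => by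
      rcases Nat.eq_zero_or_pos n with rfl | hp
      · simp [hc]
      · rw [Finset.mem_Ioc, not_and] at hn
        have := (Nat.floor_lt (Real.exp_pos y).le).1 (not_le.1 (hn hp))
        rw [if_neg, mul_zero]
        rw [not_le, Real.lt_log_iff_exp_lt (by positivity)]
        exact this)
    convert this using 1
    refine Finset.sum_congr rfl fun n hn => ?_
    rw [Finset.mem_Ioc] at hn
    have := (Nat.le_floor_iff (Real.exp_pos y).le).1 hn.2
    rw [if_pos, mul_one]
    rw [Real.log_le_iff_le_exp (by exact_mod_cast hn.1)]
    exact this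
  have hE : HasSum (fun n => an 0 n ^ 2 / 2 + an y n ^ 2 / 2) (SS 0 / 2 + SS y / 2) :=
    ((an_sq_summable le_rfl).hasSum.div_const 2).add ((an_sq_summable hy).hasSum.div_const 2)
  have h3 : |(∫ u in (0:ℝ)..y, SS u) - ∑ n ∈ Finset.Ioc 0 N, c n| ≤ SS 0 / 2 + SS y / 2 := by
    have hd := hI.sub hD
    rw [← hd.tsum_eq, ← Real.norm_eq_abs]
    refine tsum_of_norm_bounded hE fun n => ?_
    rw [← mul_sub, Real.norm_eq_abs, abs_mul, abs_of_nonneg (hc0 n), ha, ha]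
    calc _ ≤ c n * (Real.exp (-2 * |0 - Real.log n|) / 2 + Real.exp (-2 * |y - Real.log n|) / 2) :=
          mul_le_mul_of_nonneg_left (e_bound hy (Real.log_natCast_nonneg n)) (hc0 n)
      _ = _ := by ring
  have h4 := h2 N hN1
  have hNp : (0:ℝ) < N := by exact_mod_cast hN1
  have hl0 : 0 ≤ Real.log N := Real.log_natCast_nonneg N
  have hl1 : Real.log N ≤ y := by
    rw [Real.log_le_iff_le_exp hNp]; exact Nat.floor_le (Real.exp_pos y).le
  have hl2 : y ≤ Real.log N + 1 := by
    have h5 := Nat.lt_floor_add_one (Real.exp y)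
    have h6 : Real.exp y ≤ N * Real.exp 1 := by
      have : (1:ℝ) ≤ N := by exact_mod_cast hN1
      have := Real.add_one_le_exp 1
      change _ < (N:ℝ) + 1 at h5
      nlinarith
    have := Real.log_le_log (Real.exp_pos y) h6
    rwa [Real.log_exp, Real.log_mul hNp.ne' (Real.exp_pos 1).ne', Real.log_exp] at this
  have h5 := h1 0 le_rfl
  have h6 := h1 y hy
  have h7 : |Real.log N ^ 2/2 - y^2/2| ≤ y := by
    rw [abs_le]; constructor <;> nlinarith
  have h8 : C2 * Real.log N ≤ C2 * y := by gcongr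
  have h9 : 0 ≤ C1 * y := by positivity
  rw [abs_le] at h3 h4 h7 ⊢
  constructor <;> nlinarith [h3.1, h3.2, h4.1, h4.2, h7.1, h7.2]

lemma SS_avg (b : ℝ) : ∃ C > 0, ∀ L : ℝ, 1 ≤ L →
    |(∫ α in (0:ℝ)..1, gb b α * SS (α * L)) - L * ∫ α in (0:ℝ)..1, α * gb b α| ≤ C := by
  obtain ⟨C1, hC1, h1⟩ := SS_int
  set g' : ℝ → ℝ := fun α => ((-1) * Real.cosh (b*α) - (1-α) * (Real.sinh (b*α) * b)) / Real.cosh (b*α)^2 with hg'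
  have hgd : ∀ α, HasDerivAt (gb b) (g' α) α := by
    intro α
    have d1 : HasDerivAt (fun α : ℝ => 1 - α) (-1) α := by simpa using (hasDerivAt_id α).const_sub 1
    have d2 : HasDerivAt (fun α : ℝ => b * α) b α := by simpa using (hasDerivAt_id α).const_mul b
    exact d1.div d2.cosh (Real.cosh_pos _).ne'
  have hgc : Continuous g' := by
    refine Continuous.div (by fun_prop) (by fun_prop) fun α => ?_
    exact pow_ne_zero 2 (Real.cosh_pos _).ne'
  obtain ⟨G, hG⟩ := (isCompact_Icc (a := (0:ℝ)) (b := 1)).exists_bound_of_continuousOn hgc.continuousOn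
  have hG0 : 0 ≤ G := (norm_nonneg _).trans (hG 0 (by simp))
  refine ⟨G * (2 * C1) + 1, by positivity, fun L hL => ?_⟩
  have hLp : 0 < L := by linarith
  set Ψ : ℝ → ℝ := fun α => (∫ u in (0:ℝ)..(α*L), SS u) - (α*L)^2/2 with hΨ
  have hΨd : ∀ α, HasDerivAt Ψ (SS (α*L) * L - α*L*L) α := by
    intro α
    have d0 : HasDerivAt (fun α : ℝ => α * L) L α := by simpa using (hasDerivAt_id α).mul_const L
    have d1 : HasDerivAt (fun y => ∫ u in (0:ℝ)..y, SS u) (SS (α*L)) (α*L) :=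
      intervalIntegral.integral_hasDerivAt_right (SS_cont.intervalIntegrable _ _) (SS_cont.stronglyMeasurableAtFilter _ _) SS_cont.continuousAt
    have d2 := (d0.pow 2).div_const 2
    have := (d1.comp α d0).sub d2
    refine this.congr_deriv ?_
    simp; ring
  have hcS : Continuous (fun α => SS (α * L)) := SS_cont.comp (by fun_prop)
  have hparts := intervalIntegral.integral_mul_deriv_eq_deriv_mul (a := 0) (b := 1) (u := gb b) (u' := g') (v := Ψ) (v' := fun α => SS (α*L) * L - α*L*L)
    (fun α _ => hgd α) (fun α _ => hΨd α) (hgc.intervalIntegrable _ _) (Continuous.intervalIntegrable (by fun_prop) _ _)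
  have hΨ0 : Ψ 0 = 0 := by simp [hΨ]
  have hg1 : gb b 1 = 0 := by simp [gb]
  rw [hΨ0, hg1, zero_mul, mul_zero, sub_zero, zero_sub] at hparts
  have hgb := gb_cont b
  have e1 : ∫ α in (0:ℝ)..1, gb b α * (SS (α*L) * L - α*L*L) = L * ((∫ α in (0:ℝ)..1, gb b α * SS (α * L)) - L * ∫ α in (0:ℝ)..1, α * gb b α) := by
    rw [← intervalIntegral.integral_const_mul L (fun α => α * gb b α), ← intervalIntegral.integral_sub, ← intervalIntegral.integral_const_mul]
    · refine intervalIntegral.integral_congr fun α _ => ?_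
      ring
    · exact (hgb.mul hcS).intervalIntegrable _ _
    · exact Continuous.intervalIntegrable (by fun_prop) _ _
  have hb : |∫ α in (0:ℝ)..1, g' α * Ψ α| ≤ G * (2*C1*L) := by
    have := intervalIntegral.norm_integral_le_of_norm_le_const (a := 0) (b := 1) (f := fun α => g' α * Ψ α) (C := G * (2*C1*L)) (fun α hα => by
      rw [uIoc_of_le zero_le_one] at hα
      rw [norm_mul]
      refine mul_le_mul (hG α ⟨hα.1.le, hα.2⟩) ?_ (norm_nonneg _) hG0
      refine (h1 (α*L) (mul_nonneg hα.1.le hLp.le)).trans ?_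
      have : α * L ≤ L := by nlinarith [hα.2]
      calc C1 * (1 + α*L) ≤ C1 * (L + L) := by gcongr
        _ = _ := by ring)
    simpa using this
  rw [e1] at hparts
  rw [← abs_neg, ← hparts, abs_mul, abs_of_pos hLp] at hb
  have : L * |(∫ α in (0:ℝ)..1, gb b α * SS (α * L)) - L * ∫ α in (0:ℝ)..1, α * gb b α| ≤ L * (G * (2*C1)) := by linarith
  linarith [le_of_mul_le_mul_left this hLp]

noncomputable def wt (T t : ℝ) : ℝ := (1 + |t - T|) ^ (-(3/2) : ℝ) + (1 + |t - 2*T|) ^ (-(3/2) : ℝ)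

lemma wt_nonneg (T t : ℝ) : 0 ≤ wt T t := by unfold wt; positivity

lemma wt_int : ∃ W > 0, ∀ T, Integrable (wt T) ∧ ∫ t, wt T t ≤ W := by
  have h0 : Integrable (fun x : ℝ => (1 + |x|) ^ (-(3/2) : ℝ)) := by
    have := integrable_one_add_norm (E := ℝ) (μ := volume) (r := 3/2) (by simp; norm_num)
    simpa only [Real.norm_eq_abs] using this
  have hW : 0 ≤ ∫ x : ℝ, (1 + |x|) ^ (-(3/2) : ℝ) := integral_nonneg fun x => by positivity
  refine ⟨2 * (∫ x : ℝ, (1 + |x|) ^ (-(3/2) : ℝ)) + 1, by positivity, fun T => ?_⟩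
  have i1 := h0.comp_sub_right T
  have i2 := h0.comp_sub_right (2*T)
  refine ⟨i1.add i2, ?_⟩
  unfold wt
  rw [integral_add i1 i2, integral_sub_right_eq_self (fun x : ℝ => (1 + |x|) ^ (-(3/2) : ℝ)), integral_sub_right_eq_self (fun x : ℝ => (1 + |x|) ^ (-(3/2) : ℝ))]
  linarith

lemma far_sum : ∃ C > 0, ∀ T : ℝ, 4 ≤ T → ∀ t d : ℝ, d = min |t - T| |t - 2*T| → ∀ F : Finset ℂ,
    (∀ ρ ∈ F, xiF ρ = 0 ∧ d ≤ |t - ρ.im|) →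
    ∑ ρ ∈ F, (mX ρ : ℝ) * (1 / (1 + (t - ρ.im)^2)) ≤ C * Real.log T * (1 + d) ^ (-(3/4) : ℝ) := by
  obtain ⟨C, hC, h⟩ := zero_density
  refine ⟨30 * C, by positivity, fun T hT t d hd F hF => ?_⟩
  have hd0 : 0 ≤ d := hd ▸ le_min (abs_nonneg _) (abs_nonneg _)
  have hL : 1 ≤ Real.log T := by
    rw [Real.le_log_iff_exp_le (by linarith)]
    have := Real.exp_one_lt_d9; linarith
  have h1 := h t (1 + d) (by linarith) F (fun ρ hρ => (hF ρ hρ).1)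
  have hDp : 0 < 1 + d := by linarith
  have h2 : ∑ ρ ∈ F, (mX ρ : ℝ) * (1 / (1 + (t - ρ.im)^2)) ≤ 3 / (1 + d) * ∑ ρ ∈ F, (mX ρ : ℝ) * ((1+d) / ((1+d) ^ 2 + (t - ρ.im) ^ 2)) := by
    rw [Finset.mul_sum]
    refine Finset.sum_le_sum fun ρ hρ => ?_
    have hd2 := (hF ρ hρ).2
    have hd3 : d^2 ≤ (t - ρ.im)^2 := by rw [← sq_abs (t - ρ.im)]; exact pow_le_pow_left₀ hd0 hd2 2
    rw [mul_left_comm]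
    refine mul_le_mul_of_nonneg_left ?_ (by positivity)
    rw [div_mul_div_comm, div_le_div_iff₀ (by positivity) (by positivity)]
    nlinarith [sq_nonneg (d - 1)]
  have ht : |t| ≤ d + 2*T := by
    rw [hd]
    rcases min_choice |t-T| |t-2*T| with e | e <;> rw [e]
    · have := abs_add_le (t - T) T
      rw [sub_add_cancel, abs_of_pos (by linarith : 0 < T)] at this; linarith
    · have := abs_add_le (t - 2*T) (2*T)
      rwa [sub_add_cancel, abs_of_pos (by linarith : 0 < 2*T)] at this
  have h3 : Real.log (1 + d + |t| + 2) ≤ 10 * Real.log T * (1+d) ^ (1/4 : ℝ) := by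
    have h4 : 1 + d + |t| + 2 ≤ T^2 * (1+d) := by nlinarith [mul_nonneg hd0 (by nlinarith : 0 ≤ T^2 - 2)]
    have h5 := Real.log_le_log (by positivity) h4
    rw [Real.log_mul (by positivity) hDp.ne', Real.log_pow] at h5
    have h6 := Real.log_le_rpow_div hDp.le (show (0:ℝ) < 1/4 by norm_num)
    have h7 : 1 ≤ (1+d) ^ (1/4 : ℝ) := Real.one_le_rpow (by linarith) (by norm_num)
    push_cast at h5
    set q := (1+d) ^ (1/4 : ℝ)
    nlinarith [mul_le_mul_of_nonneg_right hL (by linarith : 0 ≤ q)]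
  calc _ ≤ _ := h2
    _ ≤ 3 / (1+d) * (C * (10 * Real.log T * (1+d) ^ (1/4 : ℝ))) := by gcongr; exact h1.trans (by gcongr)
    _ = 30 * C * Real.log T * ((1+d)^(1/4:ℝ) / (1+d)) := by ring
    _ = _ := by
      congr 1
      nth_rewrite 2 [← Real.rpow_one (1+d)]
      rw [← Real.rpow_sub hDp]; norm_num

lemma trunc : ∃ C > 0, ∀ T : ℝ, 4 ≤ T → ∀ u : ℝ, 0 ≤ u → ∀ t : ℝ,
    (t ∈ Icc T (2*T) → ‖ZL u t - LB T u t‖^2 ≤ C * Real.exp u * Real.log T^2 * wt T t) ∧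
    (t ∉ Ioc T (2*T) → ‖LB T u t‖^2 ≤ C * Real.exp u * Real.log T^2 * wt T t) := by
  obtain ⟨C, hC, h⟩ := far_sum
  obtain ⟨_, _, hsum⟩ := sum_zero_t
  refine ⟨(8/3*C)^2, by positivity, fun T hT u hu t => ?_⟩
  set d := min |t - T| |t - 2*T| with hd
  have hd0 : 0 ≤ d := le_min (abs_nonneg _) (abs_nonneg _)
  have hL : 0 ≤ Real.log T := Real.log_nonneg (by linarith)
  have hterm : ∀ ρ : Zs, ‖(mX ρ : ℂ) * fa ((ρ:ℂ) - sl t) u‖ ≤ 8/3 * Real.exp (u/2) * ((mX ρ : ℝ) * (1 / (1 + (t - (ρ:ℂ).im)^2))) := by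
    intro ρ
    have h1 := zs_coef_bound ρ t
    have h2 : ‖kf ((ρ:ℂ) - sl t) 1 u‖ ≤ Real.exp (u/2) := by
      refine (kf_norm_le hu).trans (Real.exp_le_exp.2 ?_)
      have := (abs_le.1 (zs_re ρ t)).2
      nlinarith
    unfold fa
    rw [norm_mul, norm_mul, Complex.norm_natCast]
    calc _ ≤ (mX ρ : ℝ) * (8/3 * (1 / (1 + (t - (ρ:ℂ).im) ^ 2)) * Real.exp (u/2)) := by gcongr
      _ = _ := by ring
  have hfin : ∀ F : Finset ℂ, (∀ ρ ∈ F, xiF ρ = 0 ∧ d ≤ |t - ρ.im|) →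
      ‖∑ ρ ∈ F, (mX ρ : ℂ) * fa (ρ - sl t) u‖ ≤ 8/3 * Real.exp (u/2) * (C * Real.log T * (1 + d) ^ (-(3/4) : ℝ)) := by
    intro F hF
    calc _ ≤ ∑ ρ ∈ F, ‖(mX ρ : ℂ) * fa (ρ - sl t) u‖ := norm_sum_le _ _
      _ ≤ ∑ ρ ∈ F, 8/3 * Real.exp (u/2) * ((mX ρ : ℝ) * (1 / (1 + (t - ρ.im)^2))) :=
          Finset.sum_le_sum fun ρ hρ => hterm ⟨ρ, (hF ρ hρ).1⟩
      _ = 8/3 * Real.exp (u/2) * ∑ ρ ∈ F, ((mX ρ : ℝ) * (1 / (1 + (t - ρ.im)^2))) := by rw [Finset.mul_sum]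
      _ ≤ _ := by gcongr; exact h T hT t d hd F hF
  have hsq : ∀ x : ℝ, 0 ≤ x → x ≤ 8/3 * Real.exp (u/2) * (C * Real.log T * (1 + d) ^ (-(3/4) : ℝ)) →
      x^2 ≤ (8/3*C)^2 * Real.exp u * Real.log T^2 * wt T t := by
    intro x hx0 hx
    have e1 : Real.exp (u/2) ^ 2 = Real.exp u := by rw [← Real.exp_nat_mul]; push_cast; ring_nf
    have e2 : ((1 + d) ^ (-(3/4) : ℝ))^2 = (1 + d) ^ (-(3/2) : ℝ) := by
      rw [← Real.rpow_natCast, ← Real.rpow_mul (by positivity)]; norm_num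
    have e3 : (1 + d) ^ (-(3/2) : ℝ) ≤ wt T t := by
      unfold wt
      rw [hd]
      have p1 : 0 ≤ (1 + |t - T|) ^ (-(3/2) : ℝ) := by positivity
      have p2 : 0 ≤ (1 + |t - 2*T|) ^ (-(3/2) : ℝ) := by positivity
      rcases min_choice |t-T| |t-2*T| with e | e <;> rw [e] <;> linarith
    calc x^2 ≤ _ := pow_le_pow_left₀ hx0 hx 2
      _ = (8/3*C)^2 * Real.exp (u/2)^2 * Real.log T^2 * ((1 + d) ^ (-(3/4) : ℝ))^2 := by ring
      _ ≤ _ := by rw [e1, e2]; gcongr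
  constructor
  · intro ht
    refine hsq _ (norm_nonneg _) ?_
    have hs : Summable (fun ρ : Zs => (mX ρ : ℂ) * fa ((ρ:ℂ) - sl t) u) :=
      Summable.of_norm_bounded ((hsum t).1.mul_left _) hterm
    have htend : Tendsto (fun F : Finset Zs => ‖∑ ρ ∈ F, (mX ρ : ℂ) * fa ((ρ:ℂ) - sl t) u - LB T u t‖) atTop (𝓝 ‖ZL u t - LB T u t‖) :=
      (Tendsto.sub_const hs.hasSum _).norm
    classical
    refine le_of_tendsto htend ?_
    filter_upwards [eventually_ge_atTop ((BF T).subtype (fun ρ => xiF ρ = 0))] with F hF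
    have hsub : BF T ⊆ F.map (Function.Embedding.subtype _) := by
      intro ρ hρ
      rw [Finset.mem_map]
      exact ⟨⟨ρ, (mem_BF.1 hρ).1⟩, hF (Finset.mem_subtype.2 hρ), rfl⟩
    have e : ∑ ρ ∈ F, (mX ρ : ℂ) * fa ((ρ:ℂ) - sl t) u = ∑ ρ ∈ F.map (Function.Embedding.subtype _), (mX ρ : ℂ) * fa (ρ - sl t) u := by
      rw [Finset.sum_map]; rfl
    rw [e, LB, ← Finset.sum_sdiff hsub, add_sub_cancel_right]
    refine hfin _ fun ρ hρ => ?_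
    rw [Finset.mem_sdiff, Finset.mem_map] at hρ
    obtain ⟨⟨σ, _, rfl⟩, hn⟩ := hρ
    refine ⟨σ.2, ?_⟩
    change d ≤ |t - (σ:ℂ).im|
    change (σ:ℂ) ∉ _ at hn
    rw [mem_BF] at hn
    by_cases h1 : T < (σ:ℂ).im
    · have h2 : 2*T < (σ:ℂ).im := by
        by_contra h3
        exact hn ⟨σ.2, h1, not_lt.1 h3⟩
      refine (min_le_right _ _).trans ?_
      rw [abs_of_nonpos (by linarith [ht.2]), abs_of_nonpos (by linarith [ht.2])]; linarith
    · refine (min_le_left _ _).trans ?_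
      rw [not_lt] at h1
      rw [abs_of_nonneg (by linarith [ht.1]), abs_of_nonneg (by linarith [ht.1])]; linarith
  · intro ht
    refine hsq _ (norm_nonneg _) (hfin _ fun ρ hρ => ?_)
    obtain ⟨h0, h1, h2⟩ := mem_BF.1 hρ
    refine ⟨h0, ?_⟩
    by_cases h3 : T < t
    · have h4 : 2*T < t := by
        by_contra h5
        exact ht ⟨h3, not_lt.1 h5⟩
      refine (min_le_right _ _).trans ?_
      rw [abs_of_nonneg (by linarith), abs_of_nonneg (by linarith)]; linarith
    · refine (min_le_left _ _).trans ?_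
      rw [not_lt] at h3
      rw [abs_of_nonpos (by linarith), abs_of_nonpos (by linarith)]; linarith

lemma sq_pert {a l r s : ℝ} (ha : 0 ≤ a) (hl : 0 ≤ l) (hs : 0 < s) (h : |l - a| ≤ r) :
    |l^2 - a^2| ≤ a^2 / s + (s + 1) * r^2 := by
  have hr : 0 ≤ r := (abs_nonneg _).trans h
  have e : l^2 - a^2 = (l - a) * (l + a) := by ring
  have h1 : l + a ≤ 2*a + r := by have := (abs_le.1 h).2; linarith
  have h2 : 2 * a * r ≤ a^2 / s + s * r^2 := by
    have : 0 ≤ (a - s * r)^2 / s := by positivity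
    have e2 : (a - s*r)^2 / s = a^2 / s + s * r^2 - 2 * a * r := by field_simp; ring
    linarith
  rw [e, abs_mul, abs_of_nonneg (by positivity : 0 ≤ l + a)]
  calc |l - a| * (l + a) ≤ r * (2*a+r) := by gcongr
    _ ≤ _ := by linarith

lemma normsq_sub (z : ℂ) (x : ℝ) : ‖(x:ℂ) - z‖^2 = ‖z‖^2 - 2 * x * z.re + x^2 := by
  rw [← Complex.normSq_eq_norm_sq, ← Complex.normSq_eq_norm_sq, Complex.normSq_apply, Complex.normSq_apply]
  simp; ring

noncomputable def AA (T u : ℝ) : ℝ := ∫ t in T..(2*T), ‖((Real.log T * Real.exp (-u) : ℝ) : ℂ) - PL u t‖^2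

lemma AA_bound : ∃ C > 0, ∀ T, 4 ≤ T → 1 ≤ Real.log T → ∀ u ∈ Icc 0 (Real.log T),
    |AA T u - (T * SS u + T * Real.log T ^ 2 * Real.exp (-2 * u))| ≤ C * (Real.exp u * Real.log T^2 + T) := by
  obtain ⟨C1, hC1, h1⟩ := PL_ms
  obtain ⟨C2, hC2, h2⟩ := PL_mean
  refine ⟨4 * C1 + 2 * C2, by positivity, fun T hT hL u hu => ?_⟩
  have hu0 := hu.1
  have hc := PL_cont hu0
  have k1 := h1 u hu0 T (by linarith)
  have k2 := h2 u hu0 T (by linarith)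
  have e : AA T u = (∫ t in T..(2*T), ‖PL u t‖^2) - 2 * (Real.log T * Real.exp (-u)) * (∫ t in T..(2*T), (PL u t).re)
      + T * (Real.log T * Real.exp (-u))^2 := by
    unfold AA
    simp_rw [normsq_sub]
    have i1 : IntervalIntegrable (fun t => ‖PL u t‖^2) volume T (2*T) := (by fun_prop : Continuous _).intervalIntegrable _ _
    have i2 : IntervalIntegrable (fun t => 2 * (Real.log T * Real.exp (-u)) * (PL u t).re) volume T (2*T) :=
      (by fun_prop : Continuous _).intervalIntegrable _ _
    rw [intervalIntegral.integral_add (i1.sub i2) (by simp), intervalIntegral.integral_sub i1 i2,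
      intervalIntegral.integral_const_mul, intervalIntegral.integral_const, smul_eq_mul]
    ring
  have e3 : Real.exp (-2*u) = Real.exp (-u)^2 := by rw [← Real.exp_nat_mul]; congr 1; push_cast; ring
  have hle : Real.log T ≤ T := (Real.log_le_sub_one_of_pos (by linarith)).trans (by linarith)
  have hee : Real.exp (-u) * Real.exp (u/2) ≤ 1 := by
    rw [← Real.exp_add]; exact Real.exp_le_one_iff.2 (by linarith)
  have b2 : |2 * (Real.log T * Real.exp (-u)) * (∫ t in T..(2*T), (PL u t).re)| ≤ 2 * C2 * T := by
    rw [abs_mul, abs_of_nonneg (by positivity : 0 ≤ 2 * (Real.log T * Real.exp (-u)))]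
    calc _ ≤ 2 * (Real.log T * Real.exp (-u)) * (C2 * Real.exp (u/2)) := by gcongr
      _ = 2 * C2 * Real.log T * (Real.exp (-u) * Real.exp (u/2)) := by ring
      _ ≤ 2 * C2 * T * 1 := by gcongr
      _ = _ := by ring
  have b1 : C1 * (1+u)^2 * Real.exp u ≤ 4 * C1 * (Real.exp u * Real.log T^2) := by
    have : (1+u)^2 ≤ (2 * Real.log T)^2 := by gcongr; linarith [hu.2]
    calc _ ≤ C1 * (2 * Real.log T)^2 * Real.exp u := by gcongr
      _ = _ := by ring
  have hx : 0 ≤ Real.exp u * Real.log T^2 := by positivity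
  rw [e, e3]
  rw [abs_le] at *
  constructor <;> nlinarith [mul_nonneg hC1.le (by linarith : 0 ≤ T), mul_nonneg hC2.le hx]

lemma NB_AA : ∃ C > 0, ∀ T, 4 ≤ T → 1 ≤ Real.log T → ∀ u ∈ Icc 0 (Real.log T),
    |NB T u - AA T u| ≤ AA T u / √(Real.log T) + C * √(Real.log T) * (Real.exp u * Real.log T^2 + T) := by
  obtain ⟨C1, hC1, h1⟩ := L_approx
  obtain ⟨C2, hC2, h2⟩ := trunc
  obtain ⟨W, hW, hw⟩ := wt_int
  refine ⟨4 * C1^2 + 5 * C2 * W, by positivity, fun T hT hL u hu => ?_⟩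
  have hu0 := hu.1
  set s := √(Real.log T) with hs
  have hs1 : 1 ≤ s := by rw [hs]; exact Real.one_le_sqrt.2 hL
  have hc := PL_cont hu0
  have hi := (NB_eq (T := T) hu0).2
  obtain ⟨wi, wb⟩ := hw T
  set D := C2 * Real.exp u * Real.log T^2 with hD
  have hD0 : 0 ≤ D := by positivity
  set A : ℝ → ℂ := fun t => ((Real.log T * Real.exp (-u) : ℝ) : ℂ) - PL u t with hA
  have hAc : Continuous (fun t => ‖A t‖^2) := by rw [hA]; fun_prop
  have hsplit : NB T u = (∫ t in Ioc T (2*T), ‖LB T u t‖^2) + ∫ t in (Ioc T (2*T))ᶜ, ‖LB T u t‖^2 := by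
    unfold NB; rw [integral_add_compl measurableSet_Ioc hi]
  have hAA : AA T u = ∫ t in Ioc T (2*T), ‖A t‖^2 := by
    unfold AA; rw [intervalIntegral.integral_of_le (by linarith)]
  have hwset : ∀ S : Set ℝ, MeasurableSet S → ∫ t in S, D * wt T t ≤ D * W := by
    intro S hS
    calc ∫ t in S, D * wt T t ≤ ∫ t, D * wt T t :=
          setIntegral_le_integral (wi.const_mul _) (Eventually.of_forall fun t => mul_nonneg hD0 (wt_nonneg _ _))
      _ = D * ∫ t, wt T t := integral_const_mul _ _
      _ ≤ _ := by gcongr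
  have hout0 : 0 ≤ ∫ t in (Ioc T (2*T))ᶜ, ‖LB T u t‖^2 := integral_nonneg fun t => by positivity
  have hout : ∫ t in (Ioc T (2*T))ᶜ, ‖LB T u t‖^2 ≤ D * W := by
    refine le_trans ?_ (hwset (Ioc T (2*T))ᶜ measurableSet_Ioc.compl)
    exact setIntegral_mono_on hi.integrableOn (wi.const_mul _).integrableOn measurableSet_Ioc.compl
      fun t ht => (h2 T hT u hu0 t).2 ht
  have iA : IntegrableOn (fun t => ‖A t‖^2) (Ioc T (2*T)) := hAc.integrableOn_Ioc
  have hpt : ∀ t ∈ Ioc T (2*T), |‖LB T u t‖^2 - ‖A t‖^2| ≤ (‖A t‖^2 / s + (s+1) * (2*C1^2)) + (s+1) * 2 * (D * wt T t) := by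
    intro t ht
    have ht' : t ∈ Icc T (2*T) := Ioc_subset_Icc_self ht
    have a1 := h1 T hT t ht' u hu
    have a2 := (h2 T hT u hu0 t).1 ht'
    have a3 : ‖LB T u t - A t‖ ≤ ‖ZL u t + PL u t - Real.log T * Real.exp (-u)‖ + ‖ZL u t - LB T u t‖ := by
      have : LB T u t - A t = (ZL u t + PL u t - Real.log T * Real.exp (-u)) - (ZL u t - LB T u t) := by
        simp only [hA]; push_cast; ring
      rw [this]; exact norm_sub_le _ _
    have a4 := sq_pert (norm_nonneg (A t)) (norm_nonneg (LB T u t)) (by linarith : 0 < s)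
      ((abs_norm_sub_norm_le (LB T u t) (A t)).trans a3)
    refine a4.trans ?_
    have a5 : (‖ZL u t + PL u t - Real.log T * Real.exp (-u)‖ + ‖ZL u t - LB T u t‖)^2 ≤ 2 * C1^2 + 2 * (D * wt T t) := by
      have : ‖ZL u t + PL u t - Real.log T * Real.exp (-u)‖^2 ≤ C1^2 := by gcongr
      nlinarith [sq_nonneg (‖ZL u t + PL u t - Real.log T * Real.exp (-u)‖ - ‖ZL u t - LB T u t‖)]
    have : (s+1) * (‖ZL u t + PL u t - Real.log T * Real.exp (-u)‖ + ‖ZL u t - LB T u t‖)^2 ≤ (s+1) * (2 * C1^2 + 2 * (D * wt T t)) := by gcongr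
    linarith
  have hin : |(∫ t in Ioc T (2*T), ‖LB T u t‖^2) - AA T u| ≤ AA T u / s + (s+1) * (2*C1^2) * T + (s+1) * 2 * (D * W) := by
    rw [hAA, ← integral_sub hi.integrableOn iA]
    have i1 : IntegrableOn (fun t => ‖A t‖^2 / s + (s+1) * (2*C1^2)) (Ioc T (2*T)) :=
      (by fun_prop : Continuous _).integrableOn_Ioc
    have i2 : IntegrableOn (fun t => (s+1) * 2 * (D * wt T t)) (Ioc T (2*T)) := ((wi.const_mul _).const_mul _).integrableOn
    have i3 : IntegrableOn (fun t => |‖LB T u t‖^2 - ‖A t‖^2|) (Ioc T (2*T)) := (hi.integrableOn.sub iA).abs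
    have ic : IntegrableOn (fun _ : ℝ => (s+1) * (2*C1^2)) (Ioc T (2*T)) := continuous_const.integrableOn_Ioc
    calc _ ≤ ∫ t in Ioc T (2*T), |‖LB T u t‖^2 - ‖A t‖^2| := abs_integral_le_integral_abs
      _ ≤ ∫ t in Ioc T (2*T), ((‖A t‖^2 / s + (s+1) * (2*C1^2)) + (s+1) * 2 * (D * wt T t)) :=
        setIntegral_mono_on i3 (i1.add i2) measurableSet_Ioc hpt
      _ = (∫ t in Ioc T (2*T), ‖A t‖^2) / s + (s+1) * (2*C1^2) * T + (s+1) * 2 * ∫ t in Ioc T (2*T), D * wt T t := by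
        rw [integral_add i1 i2, integral_add (iA.div_const s) ic, integral_div, integral_const_mul ((s+1)*2),
          setIntegral_const, Real.volume_real_Ioc_of_le (by linarith), smul_eq_mul]
        ring
      _ ≤ _ := by gcongr; exact hwset _ measurableSet_Ioc
  have hfin : (s+1) * (2*C1^2) * T + (s+1) * 2 * (D * W) + D * W ≤ (4 * C1^2 + 5 * C2 * W) * s * (Real.exp u * Real.log T^2 + T) := by
    have hX : 0 ≤ Real.exp u * Real.log T^2 := by positivity
    have hDe : D = C2 * (Real.exp u * Real.log T^2) := by rw [hD]; ring
    rw [hDe]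
    generalize Real.exp u * Real.log T^2 = X at *
    have g1 : (s+1) * (2*C1^2) * T ≤ (2*s) * (2*C1^2) * T := by gcongr; linarith
    have g2 : (s+1) * 2 * (C2 * X * W) ≤ (2*s) * 2 * (C2 * X * W) := by gcongr; linarith
    have g3 : 1 * (C2 * X * W) ≤ s * (C2 * X * W) := by gcongr
    have g4 : 0 ≤ C1^2 * s * X := by positivity
    have g5 : 0 ≤ C2 * W * s * T := by positivity
    nlinarith
  rw [abs_le] at hin ⊢
  rw [hsplit]
  have : 0 ≤ D * W := by positivity
  constructor <;> linarith [hin.1, hin.2]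

lemma NB_pt : ∃ C > 0, ∀ T, 4 ≤ T → 1 ≤ Real.log T → ∀ u ∈ Icc 0 (Real.log T),
    |NB T u - (T * SS u + T * Real.log T ^ 2 * Real.exp (-2 * u))| ≤
      (T * SS u + T * Real.log T ^ 2 * Real.exp (-2 * u)) / √(Real.log T)
       + C * √(Real.log T) * (Real.exp u * Real.log T^2 + T) := by
  obtain ⟨C1, hC1, h1⟩ := AA_bound
  obtain ⟨C2, hC2, h2⟩ := NB_AA
  refine ⟨2 * C1 + C2, by positivity, fun T hT hL u hu => ?_⟩
  have k1 := h1 T hT hL u hu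
  have k2 := h2 T hT hL u hu
  have hs1 : 1 ≤ √(Real.log T) := Real.one_le_sqrt.2 hL
  have hX : 0 ≤ Real.exp u * Real.log T^2 + T := by positivity
  generalize T * SS u + T * Real.log T ^ 2 * Real.exp (-2 * u) = M at *
  generalize Real.exp u * Real.log T^2 + T = X at *
  generalize √(Real.log T) = s at *
  have k3 : AA T u / s ≤ M / s + C1 * X := by
    calc AA T u / s ≤ (M + C1 * X) / s := by gcongr; linarith [(abs_le.1 k1).2]
      _ = M / s + C1 * X / s := by ring
      _ ≤ M / s + C1 * X := by gcongr; exact div_le_self (by positivity) hs1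
  have k4 : C1 * X ≤ C1 * X * s := le_mul_of_one_le_right (by positivity) hs1
  rw [abs_le] at *
  constructor <;> nlinarith

lemma gb_bounds {b α : ℝ} (hb0 : 0 < b) (hb1 : b ≤ 1) (hα : α ∈ Icc (0:ℝ) 1) :
    0 ≤ gb b α ∧ gb b α ≤ 1 - α ∧ 1 - 2 * α ≤ gb b α := by
  obtain ⟨h0, h1⟩ := hα
  have hc := Real.cosh_pos (b * α)
  have hc1 := Real.one_le_cosh (b * α)
  unfold gb
  refine ⟨div_nonneg (by linarith) hc.le, div_le_self (by linarith) hc1, ?_⟩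
  have hx : b * α ≤ α := mul_le_of_le_one_left h0 hb1
  have hx0 : 0 ≤ b * α := by positivity
  have h2 : Real.cosh (b*α) ≤ Real.exp (b*α) := by
    rw [Real.cosh_eq]
    have : Real.exp (-(b*α)) ≤ Real.exp (b*α) := Real.exp_le_exp.2 (by linarith)
    linarith
  have h3 : 1 - α ≤ Real.exp (-(b*α)) := by linarith [Real.add_one_le_exp (-(b*α))]
  have h4 : (1 - α) * Real.cosh (b*α) ≤ 1 := by
    calc _ ≤ Real.exp (-(b*α)) * Real.exp (b*α) := by gcongr
      _ = 1 := by rw [← Real.exp_add]; simp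
  rw [le_div_iff₀ hc]
  nlinarith [sq_nonneg α, mul_nonneg h0 hc.le, mul_nonneg (by linarith : 0 ≤ 1 - α) (by linarith : 0 ≤ 1 - (1-α) * Real.cosh (b*α)), mul_nonneg (mul_nonneg h0 h0) hc.le]

lemma lin_exp_int (k c d p q : ℝ) : ∫ α in p..q, (c + k * (c * α + d)) * Real.exp (k * α)
    = (c * q + d) * Real.exp (k * q) - (c * p + d) * Real.exp (k * p) := by
  refine intervalIntegral.integral_eq_sub_of_hasDerivAt (f := fun α => (c * α + d) * Real.exp (k * α)) (fun α _ => ?_) ?_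
  · have d1 : HasDerivAt (fun α : ℝ => c * α + d) c α := by
      simpa using ((hasDerivAt_id α).const_mul c).add_const d
    have d2 : HasDerivAt (fun α : ℝ => Real.exp (k * α)) (Real.exp (k*α) * k) α := by
      simpa using ((hasDerivAt_id α).const_mul k).exp
    exact (d1.mul d2).congr_deriv (by ring)
  · exact (by fun_prop : Continuous _).intervalIntegrable _ _

lemma J_bound {b : ℝ} (hb0 : 0 < b) (hb1 : b ≤ 1) {L : ℝ} (hL : 1 ≤ L) :
    |(∫ α in (0:ℝ)..1, gb b α * (L^2 * Real.exp (-2 * (α * L)))) - L/2| ≤ 1 := by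
  have hg := gb_cont b
  have hL0 : 0 < L := by linarith
  have i0 : IntervalIntegrable (fun α => gb b α * (L^2 * Real.exp (-2 * (α * L)))) volume 0 1 :=
    (by fun_prop : Continuous _).intervalIntegrable _ _
  have up : (∫ α in (0:ℝ)..1, gb b α * (L^2 * Real.exp (-2 * (α * L)))) ≤ L/2 := by
    have h := lin_exp_int (-2*L) 0 (-(L/2)) 0 1
    calc _ ≤ ∫ α in (0:ℝ)..1, (0 + (-2*L) * (0 * α + (-(L/2)))) * Real.exp ((-2*L) * α) := by
          refine intervalIntegral.integral_mono_on zero_le_one i0 ((by fun_prop : Continuous _).intervalIntegrable _ _) fun α hα => ?_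
          have e1 : (0 + (-2*L) * (0 * α + (-(L/2)))) * Real.exp ((-2*L) * α) = 1 * (L^2 * Real.exp (-2 * (α * L))) := by
            rw [show (-2*L)*α = -2 * (α*L) by ring]; ring
          rw [e1]
          have := (gb_bounds hb0 hb1 hα).2.1
          gcongr
          linarith [hα.1]
      _ ≤ _ := by
          rw [h]; simp
          nlinarith [Real.exp_pos (-(2*L))]
  have lo : (L-1)/2 ≤ (∫ α in (0:ℝ)..1, gb b α * (L^2 * Real.exp (-2 * (α * L)))) := by
    have h := lin_exp_int (-2*L) L ((1-L)/2) 0 1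
    calc _ ≤ ∫ α in (0:ℝ)..1, (L + (-2*L) * (L * α + ((1-L)/2))) * Real.exp ((-2*L) * α) := by
          rw [h]; simp
          nlinarith [Real.exp_pos (-(2*L))]
      _ ≤ _ := by
          refine intervalIntegral.integral_mono_on zero_le_one ((by fun_prop : Continuous _).intervalIntegrable _ _) i0 fun α hα => ?_
          have e1 : (L + (-2*L) * (L * α + ((1-L)/2))) * Real.exp ((-2*L) * α) = (1 - 2*α) * (L^2 * Real.exp (-2 * (α * L))) := by
            rw [show (-2*L)*α = -2 * (α*L) by ring]; ring
          rw [e1]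
          have := (gb_bounds hb0 hb1 hα).2.2
          gcongr
  rw [abs_le]; constructor <;> linarith

lemma K_bound {b : ℝ} (hb0 : 0 < b) (hb1 : b ≤ 1) {L : ℝ} (hL : 1 ≤ L) :
    (∫ α in (0:ℝ)..1, gb b α * (Real.exp (α * L) * L^2 + Real.exp L)) ≤ 2 * Real.exp L := by
  have hg := gb_cont b
  have h := lin_exp_int L (-L) (L+1) 0 1
  have c1 : Continuous (fun α : ℝ => (-L + L * (-L * α + (L+1))) * Real.exp (L * α)) := by fun_prop
  calc _ ≤ ∫ α in (0:ℝ)..1, ((-L + L * (-L * α + (L+1))) * Real.exp (L * α) + Real.exp L) := by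
        refine intervalIntegral.integral_mono_on zero_le_one ((by fun_prop : Continuous _).intervalIntegrable _ _)
          ((by fun_prop : Continuous _).intervalIntegrable _ _) fun α hα => ?_
        have e1 : (-L + L * (-L * α + (L+1))) * Real.exp (L * α) = (1 - α) * (Real.exp (α * L) * L^2) := by
          rw [show L*α = α*L by ring]; ring
        rw [e1, mul_add]
        have h1 := (gb_bounds hb0 hb1 hα).2.1
        have h2 : gb b α ≤ 1 := by linarith [hα.1]
        have h3 : gb b α * Real.exp L ≤ 1 * Real.exp L := by gcongr
        have h4 : gb b α * (Real.exp (α * L) * L^2) ≤ (1 - α) * (Real.exp (α * L) * L^2) := by gcongr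
        linarith
    _ = ((-L * 1 + (L+1)) * Real.exp (L * 1) - (-L * 0 + (L+1)) * Real.exp (L * 0)) + Real.exp L := by
        rw [intervalIntegral.integral_add (c1.intervalIntegrable _ _) (by simp), h]; simp
    _ ≤ _ := by simp; linarith

lemma main_int {b : ℝ} (hb0 : 0 < b) (hb1 : b ≤ 1) : ∃ C > 0, ∀ T, 4 ≤ T → 1 ≤ Real.log T →
    |(∫ α in (0:ℝ)..1, gb b α * NB T (α * Real.log T))
      - T * Real.log T * (1/2 + ∫ α in (0:ℝ)..1, α * gb b α)| ≤ C * T * √(Real.log T) := by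
  obtain ⟨C1, hC1, h1⟩ := NB_pt
  obtain ⟨C2, hC2, h2⟩ := SS_avg b
  set I := ∫ α in (0:ℝ)..1, α * gb b α with hI
  have hg := gb_cont b
  have hI0 : 0 ≤ I := intervalIntegral.integral_nonneg zero_le_one fun α hα => mul_nonneg hα.1 (gb_bounds hb0 hb1 hα).1
  refine ⟨(C2 + 1) + (I + C2 + 2) + 2 * C1, by positivity, fun T hT hL => ?_⟩
  have hT0 : 0 < T := by linarith
  have h3 := h1 T hT hL
  have k2 := h2 _ hL
  have k3 := J_bound hb0 hb1 hL
  have k4 := K_bound hb0 hb1 hL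
  have hsq := Real.sq_sqrt (by linarith : 0 ≤ Real.log T)
  have hexp := Real.exp_log hT0
  have hs1 : 1 ≤ √(Real.log T) := Real.one_le_sqrt.2 hL
  set L := Real.log T with hLd
  set s := √L with hs
  rw [hexp] at k4
  have hSS := SS_cont
  have hNB : ContinuousOn (fun α => gb b α * NB T (α * L)) (uIcc 0 1) := by
    refine hg.continuousOn.mul ((NB_cont T).comp (by fun_prop) fun α hα => ?_)
    rw [uIcc_of_le zero_le_one] at hα
    exact mem_Ici.2 (mul_nonneg hα.1 (by linarith))
  set M : ℝ → ℝ := fun α => T * SS (α*L) + T * L^2 * Real.exp (-2 * (α*L)) with hM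
  have hMc : Continuous M := by rw [hM]; fun_prop
  have iN : IntervalIntegrable (fun α => gb b α * NB T (α * L)) volume 0 1 := hNB.intervalIntegrable
  have iM : IntervalIntegrable (fun α => gb b α * M α) volume 0 1 := (by fun_prop : Continuous _).intervalIntegrable _ _
  have hgM : ∫ α in (0:ℝ)..1, gb b α * M α = T * (∫ α in (0:ℝ)..1, gb b α * SS (α*L))
      + T * ∫ α in (0:ℝ)..1, gb b α * (L^2 * Real.exp (-2 * (α*L))) := by
    rw [← intervalIntegral.integral_const_mul, ← intervalIntegral.integral_const_mul, ← intervalIntegral.integral_add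
      ((by fun_prop : Continuous _).intervalIntegrable _ _) ((by fun_prop : Continuous _).intervalIntegrable _ _)]
    refine intervalIntegral.integral_congr fun α _ => ?_
    simp only [hM]; ring
  have hdiff : |(∫ α in (0:ℝ)..1, gb b α * NB T (α * L)) - ∫ α in (0:ℝ)..1, gb b α * M α|
      ≤ (∫ α in (0:ℝ)..1, gb b α * M α) / s + C1 * s * ∫ α in (0:ℝ)..1, gb b α * (Real.exp (α * L) * L^2 + T) := by
    rw [← intervalIntegral.integral_sub iN iM, ← intervalIntegral.integral_div, ← intervalIntegral.integral_const_mul,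
      ← intervalIntegral.integral_add (iM.div_const s) ((by fun_prop : Continuous _).intervalIntegrable _ _)]
    refine (intervalIntegral.abs_integral_le_integral_abs zero_le_one).trans ?_
    refine intervalIntegral.integral_mono_on zero_le_one (iN.sub iM).abs
      ((by fun_prop : Continuous _).intervalIntegrable _ _) fun α hα => ?_
    have hg0 := (gb_bounds hb0 hb1 hα).1
    have hu : α * L ∈ Icc 0 L := ⟨mul_nonneg hα.1 (by linarith), mul_le_of_le_one_left (by linarith) hα.2⟩
    have k := h3 _ hu
    rw [← mul_sub, abs_mul, abs_of_nonneg hg0]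
    calc _ ≤ gb b α * (M α / s + C1 * s * (Real.exp (α*L) * L^2 + T)) := by gcongr
      _ = _ := by ring
  set A1 := ∫ α in (0:ℝ)..1, gb b α * SS (α*L)
  set A2 := ∫ α in (0:ℝ)..1, gb b α * (L^2 * Real.exp (-2 * (α*L)))
  set A3 := ∫ α in (0:ℝ)..1, gb b α * M α
  set A4 := ∫ α in (0:ℝ)..1, gb b α * NB T (α * L)
  set A5 := ∫ α in (0:ℝ)..1, gb b α * (Real.exp (α * L) * L^2 + T)
  have m1 : |A3 - T * L * (1/2 + I)| ≤ T * (C2 + 1) := by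
    have e : A3 - T * L * (1/2 + I) = T * ((A1 - L * I) + (A2 - L/2)) := by rw [hgM]; ring
    rw [e, abs_mul, abs_of_pos hT0]
    gcongr
    exact (abs_add_le _ _).trans (by linarith)
  have m1' : T * (C2+1) ≤ (C2 + 1) * T * s := by
    have : T * (C2+1) * 1 ≤ T * (C2+1) * s := by gcongr
    linarith
  have m2 : A3 / s ≤ (I + C2 + 2) * T * s := by
    rw [div_le_iff₀ (by linarith)]
    have : A3 ≤ (I + C2 + 2) * T * L := by
      have q1 := (abs_le.1 m1).2
      have q2 : T * (C2+1) * 1 ≤ T * (C2+1) * L := by gcongr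
      nlinarith [mul_pos hT0 (by linarith : 0 < L)]
    calc A3 ≤ (I + C2 + 2) * T * L := this
      _ = _ := by rw [← hsq]; ring
  have m3 : C1 * s * A5 ≤ 2 * C1 * T * s := by
    calc C1 * s * A5 ≤ C1 * s * (2 * T) := by gcongr
      _ = _ := by ring
  have e : A4 - T * L * (1/2 + I) = (A4 - A3) + (A3 - T * L * (1/2 + I)) := by ring
  rw [e]
  refine (abs_add_le _ _).trans ?_
  linarith

/-- Unconditionally, for `0 < b ≤ 1`, as `T → ∞`,
`Σ_{ρ,ρ'} K_b(-i(ρ-ρ')log T) W(ρ-ρ')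
  = (1/(2π))(1 + 2∫₀¹ α(1-α)/cosh(bα) dα + O(1/√log T)) (T/(2π)) log T`. -/
theorem Kb_weighted_pair_sum (b : ℝ) (hb0 : 0 < b) (hb1 : b ≤ 1) :
    ∃ C > 0, ∀ᶠ T in atTop, ∃ E : ℝ, |E| ≤ C / Real.sqrt (Real.log T) ∧
      (∑ᶠ ρ ∈ zeroBand T, ∑ᶠ ρ' ∈ zeroBand T,
        (zetaMult ρ : ℂ) * (zetaMult ρ' : ℂ) *
          Kb b (-Complex.I * (ρ - ρ') * Real.log T) * Wweight (ρ - ρ'))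
      = (((1 / (2 * Real.pi)) *
          (1 + 2 * (∫ α in (0:ℝ)..1, α * (1 - α) / Real.cosh (b * α)) + E) *
          (T / (2 * Real.pi)) * Real.log T : ℝ) : ℂ) := by
  obtain ⟨C, hC, h⟩ := main_int hb0 hb1
  refine ⟨2 * C, by positivity, ?_⟩
  filter_upwards [eventually_ge_atTop 4, Real.tendsto_log_atTop.eventually_ge_atTop 1] with T hT hL
  have hT0 : 0 < T := by linarith
  have hI : (∫ α in (0:ℝ)..1, α * (1 - α) / Real.cosh (b * α)) = ∫ α in (0:ℝ)..1, α * gb b α := by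
    refine intervalIntegral.integral_congr fun α _ => ?_
    unfold gb; ring
  have k := h T hT hL
  rw [hI, S_eq b T (by linarith)]
  have hs1 : 1 ≤ √(Real.log T) := Real.one_le_sqrt.2 hL
  have hsq := Real.sq_sqrt (by linarith : 0 ≤ Real.log T)
  set L := Real.log T with hLd
  set s := √L with hs
  set I := ∫ α in (0:ℝ)..1, α * gb b α
  set F := ∫ α in (0:ℝ)..1, gb b α * NB T (α * L)
  have hL0 : 0 < L := by linarith
  refine ⟨2 * (F - T * L * (1/2 + I)) / (T * L), ?_, ?_⟩
  · rw [abs_div, abs_mul, abs_of_pos (by positivity : 0 < T * L), abs_of_pos (by norm_num : (0:ℝ) < 2),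
      div_le_div_iff₀ (by positivity) (by linarith)]
    calc _ ≤ 2 * (C * T * s) * s := by gcongr
      _ = 2 * C * (T * s^2) := by ring
      _ = _ := by rw [hsq]
  · congr 1
    have := Real.pi_pos
    field_simp
    ring
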